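/- arXiv:2208.06629 — 3 statements merged into one kernel-verified Lean document; each statement's English description precedes it below -/
import Mathlib

section
/- There exists a constant C > 0 such that for every integer n ≥ 2, Ũ(n) ≤ (7/8)·(n choose 2) + C·n·log n. -/
open scoped BigOperators

/-- A lazy transposition on `n` positions, encoded as a triple `(a, b, p)`. -/
abbrev LazyT (n : ℕ) := Fin n × Fin n × ℝ

/-- The triple `(a, b, p)` is a valid lazy transposition: `a ≠ b` and `p ∈ [0,1]`. -/
def LazyT.Valid {n : ℕ} (e : LazyT n) : Prop :=
  e.1 ≠ e.2.1 ∧ 0 ≤ e.2.2 ∧ e.2.2 ≤ 1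

/-- A star transposition: its first coordinate is position `1` (index `0` in `Fin n`). -/
def LazyT.IsStar {n : ℕ} (e : LazyT n) : Prop := (e.1 : ℕ) = 0

/-- `permDist L σ` is the probability that the composition of the independent lazy
transpositions in `L` (applied in order) equals the permutation `σ`. -/
noncomputable def permDist {n : ℕ} : List (LazyT n) → Equiv.Perm (Fin n) → ℝ
  | [], σ => if σ = 1 then 1 else 0
  | e :: L, σ =>
      e.2.2 * permDist L (σ * Equiv.swap e.1 e.2.1) + (1 - e.2.2) * permDist L σ

/-- `L` is a transposition shuffle on `n` points: all entries are valid lazy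
transpositions and the composition is uniformly distributed on `Perm (Fin n)`. -/
def IsShuffle {n : ℕ} (L : List (LazyT n)) : Prop :=
  (∀ e ∈ L, e.Valid) ∧
  ∀ σ : Equiv.Perm (Fin n), permDist L σ = 1 / (n.factorial : ℝ)

/-- `U n` is the minimum length of a transposition shuffle on `n` points. -/
noncomputable def U (n : ℕ) : ℕ :=
  sInf { ℓ : ℕ | ∃ L : List (LazyT n), L.length = ℓ ∧ IsShuffle L }

/-- The probability that, after applying the lazy transpositions in `L`, the `t`
labelled counters starting in positions `1, …, t` end up placed according to the
map `f` (counter `i` in position `f i`). -/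
noncomputable def placeProb {n t : ℕ} (ht : t ≤ n) (L : List (LazyT n))
    (f : Fin t → Fin n) : ℝ :=
  ∑ σ : Equiv.Perm (Fin n),
    if ∀ i : Fin t, σ (Fin.castLE ht i) = f i then permDist L σ else 0

/-- `L` is a `(t,n)`-shuffle: all entries are valid and the final placement of the
`t` counters is uniform over all `n!/(n-t)!` injections. -/
def IsTShuffle {n t : ℕ} (ht : t ≤ n) (L : List (LazyT n)) : Prop :=
  (∀ e ∈ L, e.Valid) ∧
  ∀ f : Fin t → Fin n, Function.Injective f →
    placeProb ht L f = ((n - t).factorial : ℝ) / (n.factorial : ℝ)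

/-- `Ut t n` is the minimum length of a `(t,n)`-shuffle. -/
noncomputable def Ut (t n : ℕ) : ℕ :=
  sInf { ℓ : ℕ | ∃ (ht : t ≤ n) (L : List (LazyT n)), L.length = ℓ ∧ IsTShuffle ht L }

/-- The probability that after applying `L` the set of positions occupied by the
`t` (indistinguishable) counters starting in positions `1, …, t` is exactly `S`. -/
noncomputable def occProb {n t : ℕ} (ht : t ≤ n) (L : List (LazyT n))
    (S : Finset (Fin n)) : ℝ :=
  ∑ σ : Equiv.Perm (Fin n),
    if Finset.image (fun i : Fin t => σ (Fin.castLE ht i)) Finset.univ = S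
    then permDist L σ else 0

/-- `L` shuffles `t` indistinguishable counters over `n` positions: all entries are
valid and the occupied set is uniform over all `n.choose t` subsets of size `t`. -/
def IsIndShuffle {n t : ℕ} (ht : t ≤ n) (L : List (LazyT n)) : Prop :=
  (∀ e ∈ L, e.Valid) ∧
  ∀ S : Finset (Fin n), S.card = t → occProb ht L S = 1 / (n.choose t : ℝ)

/-- `Uhat t n` is the minimum length of a sequence of lazy transpositions shuffling
`t` indistinguishable counters uniformly over `n` positions. -/
noncomputable def Uhat (t n : ℕ) : ℕ :=
  sInf { ℓ : ℕ | ∃ (ht : t ≤ n) (L : List (LazyT n)), L.length = ℓ ∧ IsIndShuffle ht L }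

/-- `Ustar n` is the minimum length of a transposition shuffle on `n` points all of
whose lazy transpositions are star transpositions. -/
noncomputable def Ustar (n : ℕ) : ℕ :=
  sInf { ℓ : ℕ | ∃ L : List (LazyT n), L.length = ℓ ∧ IsShuffle L ∧ ∀ e ∈ L, e.IsStar }

/-- `Utstar t n` is the minimum length of a `(t,n)`-shuffle all of whose lazy
transpositions are star transpositions. -/
noncomputable def Utstar (t n : ℕ) : ℕ :=
  sInf { ℓ : ℕ | ∃ (ht : t ≤ n) (L : List (LazyT n)),
    L.length = ℓ ∧ IsTShuffle ht L ∧ ∀ e ∈ L, e.IsStar }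

namespace StarSh
open Equiv Finset

set_option linter.unusedSectionVars false
section Alg
variable {α : Type*} [Fintype α] [DecidableEq α]

/-- The real group algebra of the symmetric group. -/
abbrev GA (α : Type*) := MonoidAlgebra ℝ (Equiv.Perm α)

/-- Group element in the group algebra. -/
noncomputable def gof (σ : Perm α) : GA α := MonoidAlgebra.single σ 1

theorem gof_mul (σ τ : Perm α) : gof σ * gof τ = gof (σ * τ) := by
  simp [gof, MonoidAlgebra.single_mul_single]

theorem gof_one : gof (1 : Perm α) = 1 := rfl

/-- A lazy transposition as element of the group algebra. -/
noncomputable def E (a b : α) (p : ℝ) : GA α := (1 - p) • 1 + p • gof (swap a b)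

/-- Permutations supported on `A`. -/
def Sy (A : Finset α) : Subgroup (Perm α) where
  carrier := {σ | ∀ x, x ∉ A → σ x = x}
  mul_mem' := by
    intro a b ha hb x hx
    simp only [Set.mem_ofPred_eq] at ha hb
    rw [Perm.mul_apply, hb x hx, ha x hx]
  one_mem' := by intro x _; rfl
  inv_mem' := by
    intro a ha x hx
    rw [Perm.inv_eq_iff_eq]
    exact (ha x hx).symm

theorem mem_Sy {A : Finset α} {σ : Perm α} : σ ∈ Sy A ↔ ∀ x, x ∉ A → σ x = x := Iff.rfl

theorem Sy_mono {A B : Finset α} (h : A ⊆ B) {σ : Perm α} (hs : σ ∈ Sy A) : σ ∈ Sy B :=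
  fun x hx => hs x (fun hA => hx (h hA))

theorem Sy_maps {A : Finset α} {σ : Perm α} (hs : σ ∈ Sy A) {x : α} : σ x ∈ A ↔ x ∈ A := by
  constructor
  · intro h
    by_contra hx
    rw [hs x hx] at h
    exact hx h
  · intro h
    by_contra hx
    have := hs _ hx
    rw [σ.injective this] at hx
    exact hx h

theorem swap_mem_Sy {A : Finset α} {a b : α} (ha : a ∈ A) (hb : b ∈ A) : swap a b ∈ Sy A := by
  intro x hx
  apply swap_apply_of_ne_of_ne
  · rintro rfl; exact hx ha
  · rintro rfl; exact hx hb

theorem Sy_comm {A B : Finset α} (h : Disjoint A B) {σ τ : Perm α} (hs : σ ∈ Sy A)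
    (ht : τ ∈ Sy B) : σ * τ = τ * σ := by
  ext x
  simp only [Perm.mul_apply]
  by_cases hA : x ∈ A
  · have hB : x ∉ B := Finset.disjoint_left.mp h hA
    have hB' : σ x ∉ B := Finset.disjoint_left.mp h ((Sy_maps hs).2 hA)
    rw [ht x hB, ht _ hB']
  · rw [hs x hA]
    by_cases hB : x ∈ B
    · have : τ x ∉ A := Finset.disjoint_right.mp h ((Sy_maps ht).2 hB)
      rw [hs _ this]
    · rw [ht x hB, hs x hA]

open Classical in
/-- The finite set of elements of `Sy A`. -/
noncomputable def SyF (A : Finset α) : Finset (Perm α) := Finset.univ.filter (· ∈ Sy A)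

theorem mem_SyF {A : Finset α} {σ : Perm α} : σ ∈ SyF A ↔ σ ∈ Sy A := by
  simp [SyF]

theorem SyF_card_pos (A : Finset α) : (0 : ℝ) < (SyF A).card := by
  have : 0 < (SyF A).card := Finset.card_pos.2 ⟨1, mem_SyF.2 (Sy A).one_mem⟩
  exact_mod_cast this

/-- Uniform element on `Sy A`. -/
noncomputable def Uu (A : Finset α) : GA α := ((SyF A).card : ℝ)⁻¹ • ∑ σ ∈ SyF A, gof σ

theorem gof_Uu {A : Finset α} {l : Perm α} (hl : l ∈ Sy A) : gof l * Uu A = Uu A := by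
  rw [Uu, mul_smul_comm, Finset.mul_sum]
  congr 1
  refine Finset.sum_bij (fun σ _ => l * σ) ?_ ?_ ?_ ?_
  · intro σ hσ
    exact mem_SyF.2 ((Sy A).mul_mem hl (mem_SyF.1 hσ))
  · intro a _ b _ h
    exact mul_left_cancel h
  · intro b hb
    exact ⟨l⁻¹ * b, mem_SyF.2 ((Sy A).mul_mem ((Sy A).inv_mem hl) (mem_SyF.1 hb)), by simp⟩
  · intro a _
    exact gof_mul _ _

theorem Uu_gof {A : Finset α} {l : Perm α} (hl : l ∈ Sy A) : Uu A * gof l = Uu A := by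
  rw [Uu, smul_mul_assoc, Finset.sum_mul]
  congr 1
  refine Finset.sum_bij (fun σ _ => σ * l) ?_ ?_ ?_ ?_
  · intro σ hσ
    exact mem_SyF.2 ((Sy A).mul_mem (mem_SyF.1 hσ) hl)
  · intro a _ b _ h
    exact mul_right_cancel h
  · intro b hb
    exact ⟨b * l⁻¹, mem_SyF.2 ((Sy A).mul_mem (mem_SyF.1 hb) ((Sy A).inv_mem hl)), by simp⟩
  · intro a _
    exact gof_mul _ _

theorem Uu_mul_of_inv {A : Finset α} {g : GA α} (h : ∀ l ∈ Sy A, gof l * g = g) :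
    Uu A * g = g := by
  rw [Uu, smul_mul_assoc, Finset.sum_mul, Finset.sum_congr rfl (fun σ hσ => h σ (mem_SyF.1 hσ)),
    Finset.sum_const, ← Nat.cast_smul_eq_nsmul ℝ, smul_smul,
    inv_mul_cancel₀ (SyF_card_pos A).ne', one_smul]

theorem mul_Uu_of_inv {A : Finset α} {g : GA α} (h : ∀ l ∈ Sy A, g * gof l = g) :
    g * Uu A = g := by
  rw [Uu, mul_smul_comm, Finset.mul_sum, Finset.sum_congr rfl (fun σ hσ => h σ (mem_SyF.1 hσ)),
    Finset.sum_const, ← Nat.cast_smul_eq_nsmul ℝ, smul_smul,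
    inv_mul_cancel₀ (SyF_card_pos A).ne', one_smul]

theorem Uu_Uu_right {A S : Finset α} (h : A ⊆ S) : Uu A * Uu S = Uu S :=
  Uu_mul_of_inv fun _ hl => gof_Uu (Sy_mono h hl)

theorem Uu_Uu_left {A S : Finset α} (h : A ⊆ S) : Uu S * Uu A = Uu S :=
  mul_Uu_of_inv fun _ hl => Uu_gof (Sy_mono h hl)

theorem E_Uu {S : Finset α} {a b : α} (ha : a ∈ S) (hb : b ∈ S) (p : ℝ) :
    E a b p * Uu S = Uu S := by
  rw [E, add_mul, smul_mul_assoc, smul_mul_assoc, one_mul, gof_Uu (swap_mem_Sy ha hb), ← add_smul]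
  simp

theorem Sy_small {A : Finset α} (h : A.card ≤ 1) {σ : Perm α} (hs : σ ∈ Sy A) : σ = 1 := by
  ext x
  by_cases hx : x ∈ A
  · exact (Finset.card_le_one.1 h) _ ((Sy_maps hs).2 hx) _ hx
  · exact hs x hx

theorem Uu_small {A : Finset α} (h : A.card ≤ 1) : Uu A = 1 := by
  have : Uu A * 1 = 1 := Uu_mul_of_inv fun l hl => by rw [Sy_small h hl, gof_one, one_mul]
  rwa [mul_one] at this

/-- Subalgebra generated by `Sy S`. -/
noncomputable def SA (S : Finset α) : Subalgebra ℝ (GA α) :=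
  Algebra.adjoin ℝ {g | ∃ σ ∈ Sy S, g = gof σ}

theorem gof_mem_SA {S : Finset α} {σ : Perm α} (h : σ ∈ Sy S) : gof σ ∈ SA S :=
  Algebra.subset_adjoin ⟨σ, h, rfl⟩

theorem SA_mono {A B : Finset α} (h : A ⊆ B) {g : GA α} (hg : g ∈ SA A) : g ∈ SA B := by
  refine (Algebra.adjoin_mono ?_ : SA A ≤ SA B) hg
  rintro _ ⟨σ, hσ, rfl⟩
  exact ⟨σ, Sy_mono h hσ, rfl⟩

theorem E_mem_SA {S : Finset α} {a b : α} (ha : a ∈ S) (hb : b ∈ S) (p : ℝ) : E a b p ∈ SA S :=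
  (SA S).add_mem ((SA S).smul_mem (SA S).one_mem _)
    ((SA S).smul_mem (gof_mem_SA (swap_mem_Sy ha hb)) _)

theorem Uu_mem_SA (S : Finset α) : Uu S ∈ SA S :=
  (SA S).smul_mem ((SA S).sum_mem fun _ h => gof_mem_SA (mem_SyF.1 h)) _

theorem SA_comm {A B : Finset α} (h : Disjoint A B) {f g : GA α} (hf : f ∈ SA A) (hg : g ∈ SA B) :
    Commute f g := by
  refine Algebra.commute_of_mem_adjoin_of_forall_mem_commute hg ?_
  rintro _ ⟨τ, hτ, rfl⟩
  refine (Algebra.commute_of_mem_adjoin_of_forall_mem_commute hf ?_).symm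
  rintro _ ⟨σ, hσ, rfl⟩
  change _ * _ = _ * _
  rw [gof_mul, gof_mul, Sy_comm h hσ hτ]

theorem coeff_gof_mul (σ τ : Perm α) (f : GA α) : (gof σ * f).coeff τ = f.coeff (σ⁻¹ * τ) := by
  simp [gof]

theorem coeff_mul_gof (σ τ : Perm α) (f : GA α) : (f * gof σ).coeff τ = f.coeff (τ * σ⁻¹) := by
  simp [gof]

/-- augmentation -/
noncomputable def aug : GA α →ₐ[ℝ] ℝ := MonoidAlgebra.lift ℝ ℝ (Perm α) 1

theorem aug_eq (f : GA α) : aug f = ∑ σ, f.coeff σ := by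
  rw [aug, MonoidAlgebra.lift_apply, Finsupp.sum_fintype] <;> simp

theorem aug_gof (σ : Perm α) : aug (gof σ) = 1 := by
  simp [aug, gof]

theorem aug_E (a b : α) (p : ℝ) : aug (E a b p) = 1 := by
  simp [E, aug_gof]

theorem aug_Uu (A : Finset α) : aug (Uu A) = 1 := by
  rw [Uu, map_smul, map_sum, Finset.sum_congr rfl (fun σ _ => aug_gof σ)]
  simp [(SyF_card_pos A).ne']

open Classical in
theorem coeff_Uu (A : Finset α) (σ : Perm α) :
    (Uu A).coeff σ = if σ ∈ Sy A then ((SyF A).card : ℝ)⁻¹ else 0 := by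
  rw [Uu, MonoidAlgebra.coeff_smul, MonoidAlgebra.coeff_sum, Finsupp.smul_apply,
    Finsupp.finsetSum_apply]
  simp only [gof, MonoidAlgebra.coeff_single, Finsupp.single_apply]
  rw [Finset.sum_ite_eq']
  simp [mem_SyF]

theorem eq_Uu {S : Finset α} {g : GA α} {κ : ℝ} (h1 : ∀ σ ∈ Sy S, g.coeff σ = κ)
    (h2 : ∀ σ, σ ∉ Sy S → g.coeff σ = 0) (h3 : aug g = 1) : g = Uu S := by
  classical
  have hk : g = (κ * (SyF S).card) • Uu S := by
    apply MonoidAlgebra.ext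
    ext σ
    rw [MonoidAlgebra.coeff_smul, Finsupp.smul_apply, coeff_Uu]
    split_ifs with h
    · rw [h1 σ h, smul_eq_mul, mul_assoc, mul_inv_cancel₀ (SyF_card_pos S).ne', mul_one]
    · rw [h2 σ h, smul_zero]
  have h4 := congrArg aug hk
  rw [h3, map_smul, aug_Uu, smul_eq_mul, mul_one] at h4
  rw [hk, ← h4, one_smul]

/-- support predicate -/
def Supp (D : Perm α → Prop) (f : GA α) : Prop := ∀ σ, f.coeff σ ≠ 0 → D σ

theorem Supp.mul {D D' D'' : Perm α → Prop} {f g : GA α} (hf : Supp D f) (hg : Supp D' g)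
    (h : ∀ a b, D a → D' b → D'' (a * b)) : Supp D'' (f * g) := by
  intro σ hσ
  rw [MonoidAlgebra.coeff_mul_apply_left, Finsupp.sum] at hσ
  obtain ⟨a, _, ha2⟩ := Finset.exists_ne_zero_of_sum_ne_zero hσ
  have := h a (a⁻¹ * σ) (hf a (left_ne_zero_of_mul ha2)) (hg _ (right_ne_zero_of_mul ha2))
  simpa using this

theorem Supp_Uu (A : Finset α) : Supp (· ∈ Sy A) (Uu A) := by
  classical
  intro σ h
  rw [coeff_Uu] at h
  by_contra hc
  simp [hc] at h

theorem Supp_gof (τ : Perm α) : Supp (· = τ) (gof τ) := by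
  classical
  intro σ h
  rw [gof, MonoidAlgebra.coeff_single, Finsupp.single_apply] at h
  by_contra hc
  exact h (if_neg fun h => hc h.symm)

theorem exists_perm_image (B : Finset α) : ∀ (k : ℕ) (P Q : Finset α), P ⊆ B → Q ⊆ B →
    P.card = Q.card → (P \ Q).card = k → ∃ l ∈ Sy B, P.image l = Q := by
  intro k
  induction k with
  | zero =>
    intro P Q _ _ hc h0
    refine ⟨1, (Sy B).one_mem, ?_⟩
    rw [Finset.card_eq_zero, Finset.sdiff_eq_empty_iff_subset] at h0
    have : P = Q := Finset.eq_of_subset_of_card_le h0 hc.ge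
    subst this
    ext x; simp
  | succ k ih =>
    intro P Q hP hQ hc hk
    have hk2 : (Q \ P).card = k + 1 := by
      rw [← hk]; exact (Finset.card_sdiff_comm hc).symm
    obtain ⟨a, ha⟩ : (P \ Q).Nonempty := Finset.card_pos.1 (by omega)
    obtain ⟨b, hb⟩ : (Q \ P).Nonempty := Finset.card_pos.1 (by omega)
    rw [Finset.mem_sdiff] at ha hb
    have hsw := swap_mem_Sy (hP ha.1) (hQ hb.1)
    have himg : P.image (swap a b) = insert b (P.erase a) := by
      ext x
      simp only [Finset.mem_image, Finset.mem_insert, Finset.mem_erase]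
      constructor
      · rintro ⟨y, hy, rfl⟩
        by_cases hya : y = a
        · subst hya; simp
        · have hyb : y ≠ b := by rintro rfl; exact hb.2 hy
          rw [swap_apply_of_ne_of_ne hya hyb]
          exact Or.inr ⟨hya, hy⟩
      · rintro (rfl | ⟨h1, h2⟩)
        · exact ⟨a, ha.1, by simp⟩
        · have hyb : x ≠ b := by rintro rfl; exact hb.2 h2
          exact ⟨x, h2, swap_apply_of_ne_of_ne h1 hyb⟩
    obtain ⟨l, hl, hl2⟩ := ih (P.image (swap a b)) Q (by
        intro x hx
        rw [Finset.mem_image] at hx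
        obtain ⟨y, hy, rfl⟩ := hx
        exact (Sy_maps hsw).2 (hP hy)) hQ (by
        rw [Finset.card_image_of_injective _ (swap a b).injective, hc]) (by
        rw [himg, Finset.insert_sdiff_of_mem _ hb.1, Finset.erase_sdiff_comm,
          Finset.card_erase_of_mem (Finset.mem_sdiff.2 ha), hk]; rfl)
    refine ⟨l * swap a b, (Sy B).mul_mem hl hsw, ?_⟩
    rw [← hl2, Finset.image_image]
    rfl

end Alg
end StarSh

namespace StarSh
open Equiv Finset
set_option linter.unusedSectionVars false
section Core
variable {α : Type*} [Fintype α] [DecidableEq α]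

/-- number of elements of `T` sent into `B` -/
def cnt (T B : Finset α) (σ : Perm α) : ℕ := (T.filter (fun t => σ t ∈ B)).card

theorem perm_split {S T : Finset α} {ρ : Perm α} (hρ : ρ ∈ Sy S)
    (h : ∀ t, ρ t ∈ T ↔ t ∈ T) : ∃ ρ1 ∈ Sy T, ∃ ρ2 ∈ Sy (S \ T), ρ = ρ1 * ρ2 := by
  set ρ1 : Perm α := Perm.ofSubtype (ρ.subtypePerm h) with hρ1
  have e1 : ∀ t ∈ T, ρ1 t = ρ t := by
    intro t ht
    rw [hρ1, Perm.ofSubtype_apply_of_mem _ ht]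
    rfl
  have e2 : ∀ t, t ∉ T → ρ1 t = t := by
    intro t ht
    rw [hρ1, Perm.ofSubtype_apply_of_not_mem _ ht]
  refine ⟨ρ1, e2, ρ1⁻¹ * ρ, ?_, by simp⟩
  intro x hx
  rw [Perm.mul_apply, Perm.inv_eq_iff_eq]
  by_cases hxT : x ∈ T
  · exact (e1 x hxT).symm
  · rw [e2 x hxT]
    apply hρ
    intro hS
    exact hx (Finset.mem_sdiff.2 ⟨hS, hxT⟩)

theorem cnt_image {T B : Finset α} (σ : Perm α) :
    ((T.image σ).filter (· ∈ B)).card = cnt T B σ := by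
  rw [Finset.filter_image, Finset.card_image_of_injective _ σ.injective]
  rfl

theorem cnt_add {A B T : Finset α} (hAB : Disjoint A B) {σ : Perm α}
    (hT : T ⊆ A ∪ B) (hσ : σ ∈ Sy (A ∪ B)) : cnt T A σ + cnt T B σ = T.card := by
  have h1 : T.filter (fun t => σ t ∈ A) = T.filter (fun t => ¬ σ t ∈ B) := by
    apply Finset.filter_congr
    intro t ht
    have := (Sy_maps hσ).2 (hT ht)
    rw [Finset.mem_union] at this
    constructor
    · intro h; exact Finset.disjoint_left.1 hAB h
    · intro h; exact this.resolve_right h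
  have := Finset.card_filter_add_card_filter_not (s := T) (fun t => σ t ∈ B)
  unfold cnt
  rw [h1]
  omega

theorem transit {A B T : Finset α} (hAB : Disjoint A B) (hT : T ⊆ A) {σ σ' : Perm α}
    (hσ : σ ∈ Sy (A ∪ B)) (hσ' : σ' ∈ Sy (A ∪ B)) (hc : cnt T B σ = cnt T B σ') :
    ∃ lA ∈ Sy A, ∃ lB ∈ Sy B, ∃ ρ1 ∈ Sy T, ∃ ρ2 ∈ Sy ((A ∪ B) \ T),
      lA * (lB * σ) = σ' * ρ1 * ρ2 := by
  have hTS : T ⊆ A ∪ B := hT.trans Finset.subset_union_left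
  have hcA : cnt T A σ = cnt T A σ' := by
    have h1 := cnt_add hAB hTS hσ
    have h2 := cnt_add hAB hTS hσ'
    omega
  obtain ⟨lA, hlA, iA⟩ := exists_perm_image A _ ((T.image σ).filter (· ∈ A))
    ((T.image σ').filter (· ∈ A)) (fun x hx => (Finset.mem_filter.1 hx).2)
    (fun x hx => (Finset.mem_filter.1 hx).2) (by rw [cnt_image, cnt_image, hcA]) rfl
  obtain ⟨lB, hlB, iB⟩ := exists_perm_image B _ ((T.image σ).filter (· ∈ B))
    ((T.image σ').filter (· ∈ B)) (fun x hx => (Finset.mem_filter.1 hx).2)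
    (fun x hx => (Finset.mem_filter.1 hx).2) (by rw [cnt_image, cnt_image, hc]) rfl
  have key : ∀ t ∈ T, lA (lB (σ t)) ∈ T.image σ' := by
    intro t ht
    have hS := (Sy_maps hσ).2 (hTS ht)
    rcases Finset.mem_union.1 hS with h | h
    · have hB : σ t ∉ B := Finset.disjoint_left.1 hAB h
      rw [hlB _ hB]
      have : lA (σ t) ∈ (T.image σ').filter (· ∈ A) := by
        rw [← iA]
        exact Finset.mem_image_of_mem _ (Finset.mem_filter.2 ⟨Finset.mem_image_of_mem _ ht, h⟩)
      exact (Finset.mem_filter.1 this).1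
    · have hB : lB (σ t) ∉ A := Finset.disjoint_right.1 hAB ((Sy_maps hlB).2 h)
      rw [hlA _ hB]
      have : lB (σ t) ∈ (T.image σ').filter (· ∈ B) := by
        rw [← iB]
        exact Finset.mem_image_of_mem _ (Finset.mem_filter.2 ⟨Finset.mem_image_of_mem _ ht, h⟩)
      exact (Finset.mem_filter.1 this).1
  set ρ : Perm α := σ'⁻¹ * (lA * (lB * σ)) with hρ
  have hρS : ρ ∈ Sy (A ∪ B) := (Sy _).mul_mem ((Sy _).inv_mem hσ')
    ((Sy _).mul_mem (Sy_mono Finset.subset_union_left hlA)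
      ((Sy _).mul_mem (Sy_mono Finset.subset_union_right hlB) hσ))
  have hρT : ∀ t ∈ T, ρ t ∈ T := by
    intro t ht
    obtain ⟨s, hs, hs2⟩ := Finset.mem_image.1 (key t ht)
    have : ρ t = s := by
      rw [hρ, Perm.mul_apply, Perm.inv_eq_iff_eq, hs2]; rfl
    rw [this]; exact hs
  have himg : T.image ρ = T := by
    apply Finset.eq_of_subset_of_card_le
    · intro x hx
      obtain ⟨t, ht, rfl⟩ := Finset.mem_image.1 hx
      exact hρT t ht
    · rw [Finset.card_image_of_injective _ ρ.injective]
  obtain ⟨ρ1, h1, ρ2, h2, h12⟩ := perm_split hρS (by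
    intro t
    refine ⟨fun h => ?_, hρT t⟩
    rw [← himg] at h
    obtain ⟨s, hs, hs2⟩ := Finset.mem_image.1 h
    rw [← ρ.injective hs2]; exact hs)
  refine ⟨lA, hlA, lB, hlB, ρ1, h1, ρ2, h2, ?_⟩
  rw [mul_assoc, ← h12, hρ]
  simp

theorem coeff_const {A B T : Finset α} (hAB : Disjoint A B) (hT : T ⊆ A) (M : GA α)
    {σ σ' : Perm α}
    (hσ : σ ∈ Sy (A ∪ B)) (hσ' : σ' ∈ Sy (A ∪ B)) (hc : cnt T B σ = cnt T B σ') :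
    (Uu A * Uu B * M * Uu T * Uu ((A ∪ B) \ T)).coeff σ =
    (Uu A * Uu B * M * Uu T * Uu ((A ∪ B) \ T)).coeff σ' := by
  obtain ⟨lA, hlA, lB, hlB, ρ1, h1, ρ2, h2, h⟩ := transit hAB hT hσ hσ' hc
  set F := Uu A * Uu B * M * Uu T * Uu ((A ∪ B) \ T) with hF
  have iA : gof lA * F = F := by
    rw [hF]; simp only [← mul_assoc]; rw [gof_Uu hlA]
  have iB : gof lB * F = F := by
    rw [hF]; simp only [← mul_assoc]
    rw [(SA_comm hAB.symm (gof_mem_SA hlB) (Uu_mem_SA A)).eq, mul_assoc (Uu A), gof_Uu hlB]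
  have i2 : F * gof ρ2 = F := by
    rw [hF, mul_assoc, Uu_gof h2]
  have i1 : F * gof ρ1 = F := by
    rw [hF, mul_assoc, ← (SA_comm Finset.disjoint_sdiff (gof_mem_SA h1) (Uu_mem_SA _)).eq,
      ← mul_assoc, mul_assoc _ (Uu T), Uu_gof h1]
  have a1 : F.coeff σ = F.coeff (lA * (lB * σ)) := by
    conv_rhs => rw [← iA, coeff_gof_mul, ← iB, coeff_gof_mul]
    congr 1; group
  have a2 : F.coeff σ' = F.coeff (σ' * ρ1 * ρ2) := by
    conv_rhs => rw [← i2, coeff_mul_gof, ← i1, coeff_mul_gof]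
    congr 1; group
  rw [a1, a2, h]

theorem supp_gen {A B T : Finset α} (g : Perm α) :
    Supp (fun σ => ∃ lA ∈ Sy A, ∃ lB ∈ Sy B, ∃ ρ1 ∈ Sy T, ∃ ρ2 ∈ Sy ((A ∪ B) \ T),
      σ = lA * lB * g * ρ1 * ρ2) (Uu A * Uu B * gof g * Uu T * Uu ((A ∪ B) \ T)) := by
  refine Supp.mul (D := fun σ => ∃ lA ∈ Sy A, ∃ lB ∈ Sy B, ∃ ρ1 ∈ Sy T,
      σ = lA * lB * g * ρ1) ?_ (Supp_Uu _) ?_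
  · refine Supp.mul (D := fun σ => ∃ lA ∈ Sy A, ∃ lB ∈ Sy B, 
      σ = lA * lB * g) ?_ (Supp_Uu _) ?_
    · refine Supp.mul (D := fun σ => ∃ lA ∈ Sy A, ∃ lB ∈ Sy B, 
        σ = lA * lB) ?_ (Supp_gof _) ?_
      · refine Supp.mul (Supp_Uu _) (Supp_Uu _) ?_
        intro a b ha hb
        exact ⟨a, ha, b, hb, rfl⟩
      · rintro _ _ ⟨a, ha, b, hb, rfl⟩ rfl
        exact ⟨a, ha, b, hb, rfl⟩
    · rintro _ r ⟨a, ha, b, hb, rfl⟩ hr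
      exact ⟨a, ha, b, hb, r, hr, rfl⟩
  · rintro _ s ⟨a, ha, b, hb, r, hr, rfl⟩ hs
    exact ⟨a, ha, b, hb, r, hr, s, hs, rfl⟩

theorem pos_const {A B T : Finset α} (hAB : Disjoint A B) (hT : T ⊆ A) (g : Perm α) (c : ℕ)
    (h : ∀ lA ∈ Sy A, ∀ lB ∈ Sy B, ∀ ρ1 ∈ Sy T, ∀ ρ2 ∈ Sy ((A ∪ B) \ T),
      lA * lB * g * ρ1 * ρ2 ∈ Sy (A ∪ B) ∧ cnt T B (lA * lB * g * ρ1 * ρ2) = c) :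
    ∃ v : ℝ, 0 < v ∧ ∀ σ, (Uu A * Uu B * gof g * Uu T * Uu ((A ∪ B) \ T)).coeff σ =
      open Classical in if σ ∈ Sy (A ∪ B) ∧ cnt T B σ = c then v else 0 := by
  classical
  set F := Uu A * Uu B * gof g * Uu T * Uu ((A ∪ B) \ T) with hF
  set σ0 := 1 * 1 * g * 1 * 1 with hσ0
  have h0 := h 1 (Sy _).one_mem 1 (Sy _).one_mem 1 (Sy _).one_mem 1 (Sy _).one_mem
  have hform : ∀ σ, F.coeff σ = if σ ∈ Sy (A ∪ B) ∧ cnt T B σ = c then F.coeff σ0 else 0 := by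
    intro σ
    split_ifs with hs
    · exact coeff_const hAB hT _ hs.1 h0.1 (hs.2.trans h0.2.symm)
    · by_contra hne
      obtain ⟨lA, hlA, lB, hlB, ρ1, h1, ρ2, h2, rfl⟩ := supp_gen g σ hne
      exact hs (h lA hlA lB hlB ρ1 h1 ρ2 h2)
  refine ⟨F.coeff σ0, ?_, hform⟩
  by_contra hneg
  have haug : aug F = 1 := by
    rw [hF]; simp [map_mul, aug_Uu, aug_gof]
  rw [aug_eq] at haug
  have : ∑ σ, F.coeff σ ≤ 0 := by
    apply Finset.sum_nonpos
    intro σ _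
    rw [hform]
    split_ifs
    · exact not_lt.1 hneg
    · exact le_rfl
  linarith

theorem core {A B T : Finset α} (hAB : Disjoint A B) (hT : T ⊆ A) {x b : α} (hx : x ∈ T)
    (hb : b ∈ B) : ∃ p : ℝ, 0 ≤ p ∧ p ≤ 1 ∧ ∃ κ : ℝ, ∀ σ,
      (Uu A * Uu B * E x b p * Uu T * Uu ((A ∪ B) \ T)).coeff σ =
      open Classical in if σ ∈ Sy (A ∪ B) ∧ cnt T B σ ≤ 1 then κ else 0 := by
  classical
  have memS : ∀ g ∈ Sy (A ∪ B), ∀ lA ∈ Sy A, ∀ lB ∈ Sy B, ∀ ρ1 ∈ Sy T, ∀ ρ2 ∈ Sy ((A ∪ B) \ T),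
      lA * lB * g * ρ1 * ρ2 ∈ Sy (A ∪ B) := by
    intro g hg lA hlA lB hlB ρ1 h1 ρ2 h2
    refine (Sy _).mul_mem ((Sy _).mul_mem ((Sy _).mul_mem ((Sy _).mul_mem ?_ ?_) hg) ?_) ?_
    · exact Sy_mono Finset.subset_union_left hlA
    · exact Sy_mono Finset.subset_union_right hlB
    · exact Sy_mono (hT.trans Finset.subset_union_left) h1
    · exact Sy_mono Finset.sdiff_subset h2
  have fixT : ∀ ρ2 ∈ Sy ((A ∪ B) \ T), ∀ t ∈ T, ρ2 t = t := by
    intro ρ2 h2 t ht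
    apply h2
    simp [ht]
  have hswS : swap x b ∈ Sy (A ∪ B) :=
    swap_mem_Sy (Finset.mem_union_left _ (hT hx)) (Finset.mem_union_right _ hb)
  have stayA : ∀ lA ∈ Sy A, ∀ lB ∈ Sy B, ∀ y ∈ A, lA (lB y) ∉ B := by
    intro lA hlA lB hlB y hy
    rw [hlB y (Finset.disjoint_left.1 hAB hy)]
    exact Finset.disjoint_left.1 hAB ((Sy_maps hlA).2 hy)
  obtain ⟨v0, hv0, f0⟩ := pos_const hAB hT 1 0 (by
    intro lA hlA lB hlB ρ1 h1 ρ2 h2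
    refine ⟨memS 1 (Sy _).one_mem lA hlA lB hlB ρ1 h1 ρ2 h2, ?_⟩
    rw [cnt, Finset.card_eq_zero, Finset.filter_eq_empty_iff]
    intro t ht
    simp only [Perm.mul_apply, Perm.one_apply, fixT ρ2 h2 t ht]
    exact stayA lA hlA lB hlB _ (hT ((Sy_maps h1).2 ht)))
  obtain ⟨v1, hv1, f1⟩ := pos_const hAB hT (swap x b) 1 (by
    intro lA hlA lB hlB ρ1 h1 ρ2 h2
    refine ⟨memS _ hswS lA hlA lB hlB ρ1 h1 ρ2 h2, ?_⟩
    rw [cnt, Finset.card_eq_one]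
    have hxT : ρ1⁻¹ x ∈ T := (Sy_maps ((Sy T).inv_mem h1)).2 hx
    refine ⟨ρ1⁻¹ x, ?_⟩
    ext t
    simp only [Finset.mem_filter, Finset.mem_singleton]
    constructor
    · rintro ⟨ht, h⟩
      simp only [Perm.mul_apply, fixT ρ2 h2 t ht] at h
      by_contra hne
      have h3 : ρ1 t ≠ x := by
        intro h; exact hne (by rw [← h]; simp)
      have h4 : ρ1 t ∈ A := hT ((Sy_maps h1).2 ht)
      have h5 : ρ1 t ≠ b := by
        rintro h; exact Finset.disjoint_left.1 hAB (h ▸ h4) hb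
      rw [swap_apply_of_ne_of_ne h3 h5] at h
      exact stayA lA hlA lB hlB _ h4 h
    · rintro rfl
      refine ⟨hxT, ?_⟩
      simp only [Perm.mul_apply, fixT ρ2 h2 _ hxT]
      rw [show ρ1 (ρ1⁻¹ x) = x by simp, swap_apply_left]
      have : lB b ∈ B := (Sy_maps hlB).2 hb
      rw [hlA _ (Finset.disjoint_right.1 hAB this)]
      exact this)
  have hs : 0 < v0 + v1 := by linarith
  refine ⟨v0 / (v0 + v1), by positivity, (div_le_one hs).2 (by linarith), v0 * v1 / (v0 + v1), ?_⟩
  intro σ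
  set p := v0 / (v0 + v1) with hp
  have hexp : Uu A * Uu B * E x b p * Uu T * Uu ((A ∪ B) \ T) =
      (1 - p) • (Uu A * Uu B * gof 1 * Uu T * Uu ((A ∪ B) \ T)) +
      p • (Uu A * Uu B * gof (swap x b) * Uu T * Uu ((A ∪ B) \ T)) := by
    rw [E, gof_one]
    simp only [mul_add, add_mul, mul_smul_comm, smul_mul_assoc]
  rw [hexp, MonoidAlgebra.coeff_add, Finsupp.add_apply, MonoidAlgebra.coeff_smul,
    MonoidAlgebra.coeff_smul, Finsupp.smul_apply, Finsupp.smul_apply, f0, f1]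
  by_cases hS : σ ∈ Sy (A ∪ B)
  · have h1p : 1 - p = v1 / (v0 + v1) := by rw [hp]; field_simp; ring
    rcases lt_trichotomy (cnt T B σ) 1 with h | h | h
    · have h' : cnt T B σ = 0 := by omega
      simp [hS, h']
      rw [h1p]; ring
    · simp [hS, h, hp]
      ring
    · have e1 : ¬ cnt T B σ = 0 := by omega
      have e2 : ¬ cnt T B σ = 1 := by omega
      have e3 : ¬ cnt T B σ ≤ 1 := by omega
      simp [e1, e2, e3]
  · simp [hS]

theorem core_single {A T : Finset α} {x y : α} (hy : y ∉ A) (hT : T ⊆ A) (hx : x ∈ T) :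
    ∃ p : ℝ, 0 ≤ p ∧ p ≤ 1 ∧
      Uu A * Uu {y} * E x y p * Uu T * Uu ((A ∪ {y}) \ T) = Uu (A ∪ {y}) := by
  classical
  obtain ⟨p, h0, h1, κ, h⟩ := core (B := {y}) (by simpa using hy) hT hx (Finset.mem_singleton_self y)
  refine ⟨p, h0, h1, eq_Uu (κ := κ) ?_ ?_ ?_⟩
  · intro σ hσ
    have hc : cnt T {y} σ ≤ 1 := by
      rw [cnt, Finset.card_le_one]
      intro a ha b hb
      simp only [Finset.mem_filter, Finset.mem_singleton] at ha hb
      exact σ.injective (ha.2.trans hb.2.symm)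
    rw [h, if_pos ⟨hσ, hc⟩]
  · intro σ hσ
    rw [h, if_neg fun hh => hσ hh.1]
  · simp [map_mul, aug_Uu, aug_E]

theorem core_double {A B T : Finset α} (hAB : Disjoint A B) (hT : T ⊆ A) {x b : α} (hx : x ∈ T)
    (hb : b ∈ B) (hT3 : T.card = 3) : ∃ p : ℝ, 0 ≤ p ∧ p ≤ 1 ∧
      ∀ τ ∈ Sy (A ∪ B), (∀ a ∈ A, τ a ∈ B) → (∀ a ∈ B, τ a ∈ A) →
      (1 / 2 : ℝ) • (Uu A * Uu B * E x b p * Uu T * Uu ((A ∪ B) \ T) +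
        gof τ * (Uu A * Uu B * E x b p * Uu T * Uu ((A ∪ B) \ T))) = Uu (A ∪ B) := by
  classical
  obtain ⟨p, h0, h1, κ, h⟩ := core hAB hT hx hb
  refine ⟨p, h0, h1, ?_⟩
  intro τ hτ hA hB
  have hTS : T ⊆ A ∪ B := hT.trans Finset.subset_union_left
  have hA' : ∀ s ∈ A ∪ B, τ⁻¹ s ∈ B ↔ s ∈ A := by
    intro s hs
    have h1 : τ⁻¹ s ∈ A ∪ B := (Sy_maps ((Sy _).inv_mem hτ)).2 hs
    constructor
    · intro h; have := hB _ h; simpa using this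
    · intro h
      rcases Finset.mem_union.1 h1 with h2 | h2
      · have := hA _ h2
        rw [show τ (τ⁻¹ s) = s by simp] at this
        exact absurd h (Finset.disjoint_right.1 hAB this)
      · exact h2
  refine eq_Uu (κ := κ / 2) ?_ ?_ ?_
  · intro σ hσ
    rw [MonoidAlgebra.coeff_smul, Finsupp.smul_apply, MonoidAlgebra.coeff_add, Finsupp.add_apply,
      coeff_gof_mul, h, h]
    have hm : τ⁻¹ * σ ∈ Sy (A ∪ B) := (Sy _).mul_mem ((Sy _).inv_mem hτ) hσ
    have hc : cnt T B (τ⁻¹ * σ) = cnt T A σ := by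
      unfold cnt
      congr 1
      apply Finset.filter_congr
      intro t ht
      rw [Perm.mul_apply]
      exact hA' _ ((Sy_maps hσ).2 (hTS ht))
    have hadd := cnt_add hAB hTS hσ
    by_cases hle : cnt T B σ ≤ 1
    · rw [if_pos ⟨hσ, hle⟩, if_neg (by rw [hc]; omega)]
      simp; ring
    · rw [if_neg (by tauto), if_pos ⟨hm, by omega⟩]
      simp; ring
  · intro σ hσ
    have hm : τ⁻¹ * σ ∉ Sy (A ∪ B) := by
      intro hh
      apply hσ
      have := (Sy _).mul_mem hτ hh
      simpa using this
    rw [MonoidAlgebra.coeff_smul, Finsupp.smul_apply, MonoidAlgebra.coeff_add, Finsupp.add_apply,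
      coeff_gof_mul, h, h, if_neg (by tauto), if_neg (by tauto)]
    simp
  · simp [map_mul, aug_Uu, aug_E, aug_gof]
    norm_num
end Core
end StarSh

namespace StarSh
open Equiv Finset
set_option linter.unusedSectionVars false
section Walk

/-- group algebra element of a list of lazy transpositions -/
noncomputable def elem {n : ℕ} : List (LazyT n) → GA (Fin n)
  | [] => 1
  | e :: L => elem L * E e.1 e.2.1 e.2.2

theorem permDist_eq {n : ℕ} (L : List (LazyT n)) (σ : Perm (Fin n)) :
    permDist L σ = (elem L).coeff σ := by
  induction L generalizing σ with
  | nil =>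
    rw [permDist, elem, MonoidAlgebra.one_def, MonoidAlgebra.coeff_single, Finsupp.single_apply]
    simp [eq_comm]
  | cons e L ih =>
    rw [permDist, elem, E, mul_add, mul_smul_comm, mul_smul_comm, mul_one,
      MonoidAlgebra.coeff_add, Finsupp.add_apply, MonoidAlgebra.coeff_smul,
      MonoidAlgebra.coeff_smul, Finsupp.smul_apply, Finsupp.smul_apply, coeff_mul_gof,
      Equiv.swap_inv, ih, ih]
    simp only [smul_eq_mul]
    ring

theorem elem_append {n : ℕ} (L L' : List (LazyT n)) : elem (L ++ L') = elem L' * elem L := by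
  induction L with
  | nil => simp [elem]
  | cons e L ih => rw [List.cons_append, elem, elem, ih, mul_assoc]

variable {n : ℕ} [NeZero n]

/-- hub walk from `h` to `h'` of length at most `k` realizing `g` -/
def RW (h h' : Fin n) (k : ℕ) (g : GA (Fin n)) : Prop :=
  ∀ φ : Perm (Fin n), φ h = 0 → ∃ φ' : Perm (Fin n), φ' h' = 0 ∧ ∃ L : List (LazyT n),
    L.length ≤ k ∧ (∀ e ∈ L, e.Valid ∧ e.IsStar) ∧ elem L = gof φ' * g * gof φ⁻¹

theorem RW.one (h : Fin n) : RW h h 0 1 := by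
  intro φ hφ
  refine ⟨φ, hφ, [], le_rfl, by simp, ?_⟩
  rw [mul_one, gof_mul, mul_inv_cancel, gof_one]; rfl

theorem RW.mono {h h' : Fin n} {k k' : ℕ} {g : GA (Fin n)} (H : RW h h' k g) (hk : k ≤ k') :
    RW h h' k' g := by
  intro φ hφ
  obtain ⟨φ', h1, L, h2, h3⟩ := H φ hφ
  exact ⟨φ', h1, L, h2.trans hk, h3⟩

theorem RW.comp {h h' h'' : Fin n} {k k' : ℕ} {g g' : GA (Fin n)} (H' : RW h' h'' k' g')
    (H : RW h h' k g) : RW h h'' (k + k') (g' * g) := by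
  intro φ hφ
  obtain ⟨φ', h1, L, h2, h3, h4⟩ := H φ hφ
  obtain ⟨φ'', i1, L', i2, i3, i4⟩ := H' φ' h1
  refine ⟨φ'', i1, L ++ L', ?_, ?_, ?_⟩
  · rw [List.length_append]; omega
  · intro e he
    rcases List.mem_append.1 he with he | he
    · exact h3 e he
    · exact i3 e he
  · rw [elem_append, h4, i4]
    have : gof φ'⁻¹ * gof φ' = 1 := by rw [gof_mul, inv_mul_cancel, gof_one]
    calc gof φ'' * g' * gof φ'⁻¹ * (gof φ' * g * gof φ⁻¹)
        = gof φ'' * g' * (gof φ'⁻¹ * gof φ') * g * gof φ⁻¹ := by simp only [mul_assoc]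
      _ = _ := by rw [this]; simp only [mul_assoc, one_mul]

theorem conj_E (φ : Perm (Fin n)) (a b : Fin n) (p : ℝ) :
    gof φ * E a b p * gof φ⁻¹ = E (φ a) (φ b) p := by
  rw [E, E, mul_add, add_mul, mul_smul_comm, smul_mul_assoc, mul_smul_comm, smul_mul_assoc,
    mul_one, gof_mul, gof_mul, gof_mul, mul_inv_cancel, gof_one]
  congr 3
  rw [Equiv.swap_apply_apply]

theorem RW.stay {h z : Fin n} (hz : h ≠ z) {p : ℝ} (h0 : 0 ≤ p) (h1 : p ≤ 1) :
    RW h h 1 (E h z p) := by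
  intro φ hφ
  refine ⟨φ, hφ, [(0, φ z, p)], le_rfl, ?_, ?_⟩
  · intro e he
    rw [List.mem_singleton] at he
    subst he
    refine ⟨⟨?_, h0, h1⟩, ?_⟩
    · rw [← hφ]; exact fun hh => hz (φ.injective hh)
    · simp [LazyT.IsStar]
  · rw [conj_E, hφ]; simp [elem]

theorem swap_E {a b : Fin n} {p : ℝ} : gof (swap a b) * E a b p = E a b (1 - p) := by
  rw [E, E, mul_add, mul_smul_comm, mul_smul_comm, mul_one, gof_mul, swap_mul_self, gof_one,
    add_comm]
  simp

theorem RW.go {h z : Fin n} (hz : h ≠ z) {p : ℝ} (h0 : 0 ≤ p) (h1 : p ≤ 1) :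
    RW h z 1 (E h z p) := by
  intro φ hφ
  obtain ⟨φ', hφ', L, hL1, hL2, hL3⟩ :=
    RW.stay hz (p := 1 - p) (by linarith) (by linarith) φ hφ
  refine ⟨φ * swap h z, by simp [hφ], [(0, φ z, 1 - p)], le_rfl, ?_, ?_⟩
  · intro e he
    rw [List.mem_singleton] at he
    subst he
    refine ⟨⟨?_, by simpa using h1, by simpa using h0⟩, ?_⟩
    · rw [← hφ]; exact fun hh => hz (φ.injective hh)
    · simp [LazyT.IsStar]
  · rw [← gof_mul, mul_assoc (gof φ), swap_E, conj_E, hφ]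
    simp [elem]

theorem RW.move (h z : Fin n) : RW h z 1 1 := by
  by_cases hz : h = z
  · subst hz
    exact (RW.one h).mono (by omega)
  · have := RW.go hz (p := 0) le_rfl zero_le_one
    have e : E h z 0 = 1 := by simp [E]
    rwa [e] at this

/-- change of endpoints -/
theorem RW.reloc {h h' : Fin n} {k : ℕ} {g : GA (Fin n)} (H : RW h h' k g) (a b : Fin n) :
    RW a b (k + 2) g := by
  have := (RW.move h' b).comp (H.comp (RW.move a h))
  rw [one_mul, mul_one] at this
  exact this.mono (by omega)

end Walk

section Spread
variable {n : ℕ} [NeZero n]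

theorem spread {b : Fin n} {B : Finset (Fin n)} (hb : b ∈ B) :
    ∃ SB ∈ SA B, RW b b (B.card - 1) SB ∧ SB * Uu (B \ {b}) = Uu B := by
  obtain ⟨B', hB', rfl⟩ : ∃ B', b ∉ B' ∧ B = B' ∪ {b} :=
    ⟨B.erase b, by simp, by ext x; simp; constructor
                            · intro h; by_cases hx : x = b <;> tauto
                            · rintro (rfl | h) <;> tauto⟩
  clear hb
  induction B' using Finset.induction_on with
  | empty =>
    refine ⟨1, (SA _).one_mem, by simpa using RW.one b, ?_⟩
    rw [Uu_small (by simp), Uu_small (by simp), one_mul]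
  | insert y C hy ih =>
    have hbC : b ∉ C := fun h => hB' (Finset.mem_insert_of_mem h)
    have hyb : b ≠ y := by rintro rfl; exact hB' (Finset.mem_insert_self _ _)
    obtain ⟨X, hX, hw, hp⟩ := ih hbC
    have hyA : y ∉ C ∪ {b} := by simp [hy, hyb.symm]
    obtain ⟨p, p0, p1, hcore⟩ := core_single (A := C ∪ {b}) (T := {b}) (x := b) hyA
      (by simp) (by simp)
    have hS : (insert y C) ∪ {b} = (C ∪ {b}) ∪ {y} := by ext x; simp; tauto
    have hcard : ((insert y C) ∪ {b}).card = (C ∪ {b}).card + 1 := by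
      rw [hS, Finset.card_union_of_disjoint (by simpa using hyA)]; simp
    have hpos : 0 < (C ∪ {b}).card := Finset.card_pos.2 ⟨b, by simp⟩
    refine ⟨X * E b y p, (SA _).mul_mem (SA_mono ?_ hX) (E_mem_SA (by simp) (by simp) p), ?_, ?_⟩
    · rw [hS]; exact Finset.subset_union_left
    · exact (hw.comp (RW.stay hyb p0 p1)).mono (by omega)
    · rw [hS]
      rw [Uu_small (A := {y}) (by simp), Uu_small (A := {b}) (by simp), mul_one, mul_one] at hcore
      have hsub : (C ∪ {b}) \ {b} ⊆ (C ∪ {b} ∪ {y}) \ {b} :=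
        Finset.sdiff_subset_sdiff Finset.subset_union_left le_rfl
      have hcomm : E b y p * Uu ((C ∪ {b}) \ {b}) = Uu ((C ∪ {b}) \ {b}) * E b y p := by
        refine SA_comm (A := {b, y}) (B := (C ∪ {b}) \ {b}) ?_ (E_mem_SA (by simp) (by simp) p)
          (Uu_mem_SA _)
        rw [Finset.disjoint_left]
        intro a ha
        simp only [Finset.mem_insert, Finset.mem_singleton] at ha
        rcases ha with rfl | rfl
        · simp
        · simp [hy]
      rw [← hcore, ← hp, ← Uu_Uu_right hsub]
      calc X * E b y p * (Uu ((C ∪ {b}) \ {b}) * Uu ((C ∪ {b} ∪ {y}) \ {b}))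
          = X * (E b y p * Uu ((C ∪ {b}) \ {b})) * Uu ((C ∪ {b} ∪ {y}) \ {b}) := by
            simp only [mul_assoc]
        _ = _ := by rw [hcomm, Uu_Uu_right hsub]; simp only [mul_assoc]

/-- crude cost -/
def k0 : ℕ → ℕ
  | 0 => 1
  | N + 1 => k0 N + N + 2

theorem crude (N : ℕ) : ∀ S : Finset (Fin n), S.card = N → ∀ h z : Fin n, RW h z (k0 N) (Uu S) := by
  induction N with
  | zero =>
    intro S hS h z
    rw [Uu_small (by omega)]
    exact RW.move h z
  | succ N ih =>
    intro S hS h z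
    obtain ⟨b, hb⟩ : S.Nonempty := Finset.card_pos.1 (by omega)
    obtain ⟨X, _, hw, hp⟩ := spread hb
    have h1 := ih (S \ {b}) (by rw [Finset.sdiff_singleton_eq_erase, Finset.card_erase_of_mem hb]; omega) h b
    have h2 := (RW.move b z).comp (hw.comp h1)
    rw [one_mul, hp] at h2
    exact h2.mono (by rw [k0]; omega)

end Spread
end StarSh

namespace StarSh
open Equiv Finset
set_option linter.unusedSectionVars false
section FlipSec
variable {α : Type*} [Fintype α] [DecidableEq α]

theorem extend_alg {A B T : Finset α} (hAB : Disjoint A B) (hT : T ⊆ A) {x b : α} (hx : x ∈ T)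
    (hb : b ∈ B) {XA SB : GA α} (hX2 : XA * Uu T * Uu (A \ T) = Uu A)
    (hS1 : SB ∈ SA B) (hS2 : SB * Uu (B \ {b}) = Uu B) (p : ℝ) :
    (XA * SB * Uu T * E x b p) * Uu T * Uu ((A ∪ B) \ T) =
      Uu A * Uu B * E x b p * Uu T * Uu ((A ∪ B) \ T) := by
  have hTB : Disjoint T B := hAB.mono_left hT
  set R := Uu ((A ∪ B) \ T) with hR
  set a := Uu (A \ T) with ha
  set c := Uu (B \ {b}) with hc
  set t := Uu T with ht
  set e := E x b p with he
  have r1 : a * R = R := Uu_Uu_right (Finset.sdiff_subset_sdiff Finset.subset_union_left le_rfl)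
  have r2 : c * R = R := by
    apply Uu_Uu_right
    intro y hy
    have hyB := (Finset.mem_sdiff.1 hy).1
    exact Finset.mem_sdiff.2 ⟨Finset.mem_union_right _ hyB, Finset.disjoint_right.1 hTB hyB⟩
  have ta : Commute t a := SA_comm Finset.disjoint_sdiff (Uu_mem_SA _) (Uu_mem_SA _)
  have tc : Commute t c :=
    SA_comm (hTB.mono_right Finset.sdiff_subset) (Uu_mem_SA _) (Uu_mem_SA _)
  have eE : e ∈ SA {x, b} := E_mem_SA (by simp) (by simp) p
  have ea : Commute e a := by
    refine SA_comm ?_ eE (Uu_mem_SA _)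
    rw [Finset.disjoint_left]
    intro y hy
    simp only [Finset.mem_insert, Finset.mem_singleton] at hy
    rcases hy with rfl | rfl
    · simp [hx]
    · simp [Finset.disjoint_right.1 hAB hb]
  have ec : Commute e c := by
    refine SA_comm ?_ eE (Uu_mem_SA _)
    rw [Finset.disjoint_left]
    intro y hy
    simp only [Finset.mem_insert, Finset.mem_singleton] at hy
    rcases hy with rfl | rfl
    · simp [Finset.disjoint_left.1 hTB hx]
    · simp
  have st : Commute SB t := SA_comm hTB.symm hS1 (Uu_mem_SA _)
  have sa : Commute SB a :=
    SA_comm (hAB.symm.mono_right Finset.sdiff_subset) hS1 (Uu_mem_SA _)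
  have q1 : e * t * (a * c) = a * c * (e * t) :=
    ((ea.mul_right ec).mul_left (ta.mul_right tc)).eq
  have q2 : SB * (t * a) = t * a * SB := (st.mul_right sa).eq
  calc XA * SB * t * e * t * R = XA * SB * t * e * t * (a * (c * R)) := by rw [r2, r1]
    _ = XA * SB * t * (e * t * (a * c)) * R := by simp only [mul_assoc]
    _ = XA * (SB * (t * a)) * c * e * t * R := by rw [q1]; simp only [mul_assoc]
    _ = (XA * t * a) * (SB * c) * e * t * R := by rw [q2]; simp only [mul_assoc]
    _ = _ := by rw [hX2, hS2]

/-- A flip between `A` and `B`. -/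
def Flip (A B : Finset α) (P : GA α) : Prop :=
  P ∈ SA (A ∪ B) ∧ P * Uu (A ∪ B) = Uu (A ∪ B) ∧
    ∃ τ ∈ Sy (A ∪ B), (∀ a ∈ A, τ a ∈ B) ∧ (∀ a ∈ B, τ a ∈ A) ∧ P * gof τ = P

theorem absorb_mono {C S : Finset α} (h : C ⊆ S) {P : GA α} (hP : P * Uu C = Uu C) :
    P * Uu S = Uu S := by
  rw [← Uu_Uu_right h, ← mul_assoc, hP]

theorem Flip.empty : Flip (∅ : Finset α) ∅ 1 :=
  ⟨(SA _).one_mem, one_mul _, 1, (Sy _).one_mem, by simp, by simp, by rw [gof_one, one_mul]⟩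

theorem Flip.pair (a b : α) : Flip {a} {b} (E a b (1 / 2)) := by
  refine ⟨E_mem_SA (by simp) (by simp) _, E_Uu (by simp) (by simp) _, swap a b,
    swap_mem_Sy (by simp) (by simp), by simp, by simp, ?_⟩
  rw [E, add_mul, smul_mul_assoc, smul_mul_assoc, one_mul, gof_mul, swap_mul_self, gof_one, add_comm]
  norm_num

theorem Flip.mul {A B A' B' : Finset α} {P P' : GA α} (h : Flip A B P) (h' : Flip A' B' P')
    (hd : Disjoint (A ∪ B) (A' ∪ B')) : Flip (A ∪ A') (B ∪ B') (P * P') := by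
  obtain ⟨h1, h2, τ, h3, h4, h5, h6⟩ := h
  obtain ⟨i1, i2, τ', i3, i4, i5, i6⟩ := h'
  have s1 : A ∪ B ⊆ A ∪ A' ∪ (B ∪ B') := by
    intro x; simp only [Finset.mem_union]; tauto
  have s2 : A' ∪ B' ⊆ A ∪ A' ∪ (B ∪ B') := by
    intro x; simp only [Finset.mem_union]; tauto
  have f1 : ∀ x ∈ A' ∪ B', τ x = x := fun x hx => h3 x (Finset.disjoint_right.1 hd hx)
  have f2 : ∀ x ∈ A ∪ B, τ' x = x := fun x hx => i3 x (Finset.disjoint_left.1 hd hx)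
  refine ⟨(SA _).mul_mem (SA_mono s1 h1) (SA_mono s2 i1), ?_, τ * τ',
    (Sy _).mul_mem (Sy_mono s1 h3) (Sy_mono s2 i3), ?_, ?_, ?_⟩
  · rw [mul_assoc, absorb_mono s2 i2, absorb_mono s1 h2]
  · intro a ha
    rw [Perm.mul_apply]
    rcases Finset.mem_union.1 ha with ha | ha
    · rw [f2 a (Finset.mem_union_left _ ha)]
      exact Finset.mem_union_left _ (h4 a ha)
    · rw [f1 _ (Finset.mem_union_right _ (i4 a ha))]
      exact Finset.mem_union_right _ (i4 a ha)
  · intro a ha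
    rw [Perm.mul_apply]
    rcases Finset.mem_union.1 ha with ha | ha
    · rw [f2 a (Finset.mem_union_right _ ha)]
      exact Finset.mem_union_left _ (h5 a ha)
    · rw [f1 _ (Finset.mem_union_left _ (i5 a ha))]
      exact Finset.mem_union_right _ (i5 a ha)
  · have hc : P' * gof τ = gof τ * P' := (SA_comm hd (gof_mem_SA h3) i1).symm.eq
    calc P * P' * gof (τ * τ') = P * (P' * gof τ) * gof τ' := by
          rw [← gof_mul]; simp only [mul_assoc]
      _ = (P * gof τ) * (P' * gof τ') := by rw [hc]; simp only [mul_assoc]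
      _ = P * P' := by rw [h6, i6]

theorem dbl {A B T : Finset α} (hAB : Disjoint A B) (hT : T ⊆ A) (hT3 : T.card = 3)
    {x b : α} (hx : x ∈ T)
    (hb : b ∈ B) {XA SB : GA α} (hX2 : XA * Uu T * Uu (A \ T) = Uu A)
    (hS1 : SB ∈ SA B) (hS2 : SB * Uu (B \ {b}) = Uu B) :
    ∃ p : ℝ, 0 ≤ p ∧ p ≤ 1 ∧ ∀ N, Flip A B N →
    (N * (XA * SB * Uu T * E x b p)) * Uu T * Uu ((A ∪ B) \ T) = Uu (A ∪ B) := by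
  obtain ⟨p, h0, h1, h⟩ := core_double hAB hT hx hb hT3
  refine ⟨p, h0, h1, ?_⟩
  rintro N ⟨_, n2, τ, hτ, t1, t2, t3⟩
  have hf := h τ hτ t1 t2
  rw [mul_assoc N, mul_assoc N, extend_alg hAB hT hx hb hX2 hS1 hS2]
  set f := Uu A * Uu B * E x b p * Uu T * Uu ((A ∪ B) \ T)
  have : N * Uu (A ∪ B) = N * f := by
    rw [← hf, mul_smul_comm, mul_add, ← mul_assoc N (gof τ), t3, ← two_smul ℝ (N * f), smul_smul]
    norm_num
  rw [← this, n2]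

end FlipSec

section Col
variable {n : ℕ} [NeZero n]

theorem E_comm {a b c d : Fin n} (h1 : a ≠ c) (h2 : a ≠ d) (h3 : b ≠ c) (h4 : b ≠ d) (p q : ℝ) :
    Commute (E a b p) (E c d q) := by
  refine SA_comm (A := {a, b}) (B := {c, d}) ?_ (E_mem_SA (by simp) (by simp) _)
    (E_mem_SA (by simp) (by simp) _)
  simp [h1.symm, h2.symm, h3.symm, h4.symm]

theorem column {c0 c1 c2 c3 c4 c5 c6 c7 : Fin n} (hn : [c0, c1, c2, c3, c4, c5, c6, c7].Nodup) :
    RW c0 c0 10 ((E c0 c4 (1/2) * E c1 c5 (1/2)) * (E c2 c6 (1/2) * E c3 c7 (1/2)) *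
      (E c0 c2 (1/2) * E c1 c3 (1/2)) * E c0 c1 (1/2)) := by
  simp only [List.nodup_cons, List.mem_cons, not_or, List.not_mem_nil] at hn
  obtain ⟨⟨n01, n02, n03, n04, n05, n06, n07, -⟩, ⟨n12, n13, n14, n15, n16, n17, -⟩,
    ⟨n23, n24, n25, n26, n27, -⟩, ⟨n34, n35, n36, n37, -⟩, ⟨n45, n46, n47, -⟩,
    ⟨n56, n57, -⟩, ⟨n67, -⟩, -⟩ := hn
  have a0 : (0 : ℝ) ≤ 1 / 2 := by norm_num
  have a1 : (1 / 2 : ℝ) ≤ 1 := by norm_num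
  have w := (RW.stay n04 a0 a1).comp ((RW.move c2 c0).comp ((RW.stay n26 a0 a1).comp
    ((RW.go n02 a0 a1).comp ((RW.move c1 c0).comp ((RW.stay n15 a0 a1).comp ((RW.move c3 c1).comp
    ((RW.stay n37 a0 a1).comp ((RW.go n13 a0 a1).comp (RW.go n01 a0 a1)))))))))
  simp only [one_mul] at w
  have k1 : Commute (E c1 c5 (1/2)) (E c2 c6 (1/2)) := E_comm n12 n16 (Ne.symm n25) n56 _ _
  have k2 : Commute (E c1 c5 (1/2)) (E c0 c2 (1/2)) :=
    E_comm (Ne.symm n01) n12 (Ne.symm n05) (Ne.symm n25) _ _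
  have k3 : Commute (E c3 c7 (1/2)) (E c0 c2 (1/2)) :=
    E_comm (Ne.symm n03) (Ne.symm n23) (Ne.symm n07) (Ne.symm n27) _ _
  have e : (E c0 c4 (1/2) * E c1 c5 (1/2)) * (E c2 c6 (1/2) * E c3 c7 (1/2)) *
      (E c0 c2 (1/2) * E c1 c3 (1/2)) * E c0 c1 (1/2) =
      E c0 c4 (1/2) * (E c2 c6 (1/2) * (E c0 c2 (1/2) * (E c1 c5 (1/2) * (E c3 c7 (1/2) *
      (E c1 c3 (1/2) * E c0 c1 (1/2)))))) := by
    calc _ = E c0 c4 (1/2) * (E c1 c5 (1/2) * E c2 c6 (1/2)) * (E c3 c7 (1/2) *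
          E c0 c2 (1/2)) * E c1 c3 (1/2) * E c0 c1 (1/2) := by simp only [mul_assoc]
      _ = E c0 c4 (1/2) * E c2 c6 (1/2) * (E c1 c5 (1/2) * E c0 c2 (1/2)) * E c3 c7 (1/2) *
          E c1 c3 (1/2) * E c0 c1 (1/2) := by rw [k1.eq, k3.eq]; simp only [mul_assoc]
      _ = _ := by rw [k2.eq]; simp only [mul_assoc]
  rw [e]
  exact w

theorem column_flips {c0 c1 c2 c3 c4 c5 c6 c7 : Fin n}
    (hn : [c0, c1, c2, c3, c4, c5, c6, c7].Nodup) :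
    Flip ({c0} ∪ {c1}) ({c2} ∪ {c3}) (E c0 c2 (1/2) * E c1 c3 (1/2)) ∧
    Flip ({c0} ∪ {c1} ∪ ({c2} ∪ {c3})) ({c4} ∪ {c5} ∪ ({c6} ∪ {c7}))
      (E c0 c4 (1/2) * E c1 c5 (1/2) * (E c2 c6 (1/2) * E c3 c7 (1/2))) := by
  simp only [List.nodup_cons, List.mem_cons, not_or, List.not_mem_nil] at hn
  obtain ⟨⟨n01, n02, n03, n04, n05, n06, n07, -⟩, ⟨n12, n13, n14, n15, n16, n17, -⟩,
    ⟨n23, n24, n25, n26, n27, -⟩, ⟨n34, n35, n36, n37, -⟩, ⟨n45, n46, n47, -⟩,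
    ⟨n56, n57, -⟩, ⟨n67, -⟩, -⟩ := hn
  refine ⟨(Flip.pair c0 c2).mul (Flip.pair c1 c3) ?_, ((Flip.pair c0 c4).mul (Flip.pair c1 c5)
    ?_).mul ((Flip.pair c2 c6).mul (Flip.pair c3 c7) ?_) ?_⟩ <;>
  · simp only [Finset.disjoint_union_left, Finset.disjoint_union_right,
        Finset.disjoint_singleton]
    simp only [ne_eq, *, Ne.symm n12, Ne.symm n14, Ne.symm n34, Ne.symm n36,
      Ne.symm n24, Ne.symm n25, Ne.symm n35,
      not_false_eq_true, and_self]

set_option maxHeartbeats 1000000 in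
theorem columns (m : ℕ) : ∀ A0 B3 B2 B1 : Finset (Fin n), Disjoint A0 B3 → Disjoint (A0 ∪ B3) B2 →
    Disjoint (A0 ∪ B3 ∪ B2) B1 → A0.card = m → B3.card = m → B2.card = 2 * m → B1.card = 4 * m →
    ∃ P1 P2 P3 : GA (Fin n), Flip (A0 ∪ B3 ∪ B2) B1 P1 ∧ Flip (A0 ∪ B3) B2 P2 ∧ Flip A0 B3 P3 ∧
      ∀ h z, RW h z (11 * m + 1) (P1 * P2 * P3) := by
  induction m with
  | zero =>
    intro A0 B3 B2 B1 _ _ _ h0 h3 h2 h1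
    simp only [mul_zero, Finset.card_eq_zero] at h0 h1 h2 h3
    subst h0 h1 h2 h3
    refine ⟨1, 1, 1, Flip.empty, Flip.empty, Flip.empty, ?_⟩
    intro h z
    simpa using RW.move h z
  | succ m ih =>
    intro A0 B3 B2 B1 d3 d2 d1 h0 h3 h2 h1
    obtain ⟨c0, A, m0, rfl, k0⟩ := Finset.card_eq_succ.1 h0
    obtain ⟨c1, C3, m1, rfl, k3⟩ := Finset.card_eq_succ.1 h3
    obtain ⟨c2, C, m2, rfl, r2⟩ :=
      Finset.card_eq_succ.1 (show B2.card = (2 * m + 1) + 1 by rw [h2]; ring)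
    obtain ⟨c3, C2, m3, rfl, q2⟩ := Finset.card_eq_succ.1 r2
    obtain ⟨c4, D, m4, rfl, r3⟩ :=
      Finset.card_eq_succ.1 (show B1.card = (4 * m + 3) + 1 by rw [h1]; ring)
    obtain ⟨c5, D, m5, rfl, r4⟩ := Finset.card_eq_succ.1 r3
    obtain ⟨c6, D, m6, rfl, r5⟩ := Finset.card_eq_succ.1 r4
    obtain ⟨c7, C1, m7, rfl, q1⟩ := Finset.card_eq_succ.1 r5
    clear h0 h1 h2 h3
    simp only [Finset.mem_insert, not_or, Finset.disjoint_insert_left,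
      Finset.disjoint_insert_right, Finset.disjoint_union_left, Finset.mem_union] at m0 m1 m2 m3 m4 m5 m6 m7 d1 d2 d3
    obtain ⟨P1, P2, P3, f1, f2, f3, hw⟩ := ih A C3 C2 C1 (by tauto)
      (by rw [Finset.disjoint_union_left]; tauto)
      (by rw [Finset.disjoint_union_left, Finset.disjoint_union_left]; tauto) k0 k3 q2 q1
    have hnd : [c0, c1, c2, c3, c4, c5, c6, c7].Nodup := by
      simp only [List.nodup_cons, List.mem_cons, not_or, List.not_mem_nil, List.nodup_nil]
      grind
    have hD : Disjoint ({c0, c1, c2, c3, c4, c5, c6, c7} : Finset (Fin n)) (A ∪ C3 ∪ C2 ∪ C1) := by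
      rw [Finset.disjoint_left]
      intro x hx
      simp only [Finset.mem_insert, Finset.mem_singleton] at hx
      simp only [Finset.mem_union, not_or]
      rcases hx with rfl | rfl | rfl | rfl | rfl | rfl | rfl | rfl <;> tauto
    have hcol := column hnd
    clear d1 d2 d3 m0 m1 m2 m3 m4 m5 m6 m7 ih
    have g3 := Flip.pair c0 c1
    obtain ⟨g2, g1⟩ := column_flips hnd
    have s3 : {c0} ∪ {c1} ⊆ ({c0, c1, c2, c3, c4, c5, c6, c7} : Finset (Fin n)) := by
      simp only [Finset.union_subset_iff, Finset.singleton_subset_iff, Finset.mem_insert,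
        Finset.mem_singleton, true_or, or_true, and_self]
    have s2 : {c0} ∪ {c1} ∪ ({c2} ∪ {c3}) ⊆
        ({c0, c1, c2, c3, c4, c5, c6, c7} : Finset (Fin n)) := by
      simp only [Finset.union_subset_iff, Finset.singleton_subset_iff, Finset.mem_insert,
        Finset.mem_singleton, true_or, or_true, and_self]
    have s1 : {c0} ∪ {c1} ∪ ({c2} ∪ {c3}) ∪ ({c4} ∪ {c5} ∪ ({c6} ∪ {c7})) ⊆
        ({c0, c1, c2, c3, c4, c5, c6, c7} : Finset (Fin n)) := by
      simp only [Finset.union_subset_iff, Finset.singleton_subset_iff, Finset.mem_insert,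
        Finset.mem_singleton, true_or, or_true, and_self]
    have t3 : A ∪ C3 ⊆ A ∪ C3 ∪ C2 ∪ C1 := by
      intro x; simp only [Finset.mem_union]; tauto
    have t2 : A ∪ C3 ∪ C2 ⊆ A ∪ C3 ∪ C2 ∪ C1 := by
      intro x; simp only [Finset.mem_union]; tauto
    set L1 := E c0 c4 (1/2) * E c1 c5 (1/2) * (E c2 c6 (1/2) * E c3 c7 (1/2))
    set L2 := E c0 c2 (1/2) * E c1 c3 (1/2)
    set L3 := E c0 c1 (1/2)
    have k1 : Commute L2 P1 := SA_comm hD (SA_mono s2 g2.1) f1.1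
    have k2 : Commute L3 P1 := SA_comm hD (SA_mono s3 g3.1) f1.1
    have k3 : Commute L3 P2 := SA_comm hD (SA_mono s3 g3.1) (SA_mono t2 f2.1)
    refine ⟨L1 * P1, L2 * P2, L3 * P3, ?_, ?_, ?_, ?_⟩
    · have := g1.mul f1 (hD.mono_left s1)
      convert this using 1 <;>
      · simp only [Finset.insert_eq]; ac_rfl
    · have := g2.mul f2 ((hD.mono_left s2).mono_right t2)
      convert this using 1 <;>
      · simp only [Finset.insert_eq]; ac_rfl
    · have := g3.mul f3 ((hD.mono_left s3).mono_right t3)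
      simpa only [Finset.insert_eq] using this
    · intro h z
      have e : L1 * P1 * (L2 * P2) * (L3 * P3) = L1 * L2 * L3 * (P1 * P2 * P3) := by
        calc _ = L1 * (P1 * L2) * (P2 * L3) * P3 := by simp only [mul_assoc]
          _ = L1 * L2 * (P1 * L3) * P2 * P3 := by rw [← k1.eq, ← k3.eq]; simp only [mul_assoc]
          _ = _ := by rw [← k2.eq]; simp only [mul_assoc]
      have w := (RW.move c0 z).comp (hcol.comp (hw h c0))
      rw [one_mul] at w
      rw [e]
      exact w.mono (by omega)

end Col
end StarSh

namespace StarSh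
open Equiv Finset
set_option linter.unusedSectionVars false
section Vsec
variable {n : ℕ} [NeZero n]

/-- three-counter shuffles of size `N` and cost `k` -/
def V (n : ℕ) [NeZero n] (N k : ℕ) : Prop :=
  ∀ S T : Finset (Fin n), S.card = N → T ⊆ S → T.card = 3 → ∀ x ∈ T,
    ∃ X ∈ SA S, RW x x k X ∧ X * Uu T * Uu (S \ T) = Uu S

theorem V_three : V n 3 0 := by
  intro S T hS hT hT3 x hx
  have : T = S := Finset.eq_of_subset_of_card_le hT (by omega)
  subst this
  refine ⟨1, (SA _).one_mem, RW.one x, ?_⟩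
  rw [Finset.sdiff_self, Uu_small (A := ∅) (by simp), one_mul, mul_one]

theorem V_succ {N k : ℕ} (hN : 3 ≤ N) (h : V n N k) : V n (N + 1) (k + 11) := by
  intro S T hS hT hT3 x hx
  obtain ⟨y, hy⟩ : (S \ T).Nonempty := by
    apply Finset.card_pos.1
    rw [Finset.card_sdiff_of_subset hT]; omega
  obtain ⟨hyS, hyT⟩ := Finset.mem_sdiff.1 hy
  have hA : T ⊆ S.erase y := fun t ht =>
    Finset.mem_erase.2 ⟨by rintro rfl; exact hyT ht, hT ht⟩
  have hSe : S.erase y ∪ {y} = S := by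
    rw [Finset.union_comm, ← Finset.insert_eq, Finset.insert_erase hyS]
  obtain ⟨X, hX, hw, hp⟩ := h (S.erase y) T (by rw [Finset.card_erase_of_mem hyS]; omega) hA hT3 x hx
  obtain ⟨p, p0, p1, hc⟩ := core_single (A := S.erase y) (y := y) (by simp) hA hx
  have he := extend_alg (A := S.erase y) (B := {y}) (by simp) hA hx (Finset.mem_singleton_self y)
    hp (SA _).one_mem (SB := 1) (by rw [one_mul, Finset.sdiff_self, Uu_small (by simp),
      Uu_small (by simp)]) p
  rw [hc, hSe, mul_one] at he
  refine ⟨X * Uu T * E x y p, ?_, ?_, he⟩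
  · exact (SA _).mul_mem ((SA _).mul_mem (SA_mono (Finset.erase_subset _ _) hX)
      (SA_mono hT (Uu_mem_SA _))) (E_mem_SA (hT hx) hyS p)
  · have hxy : x ≠ y := by rintro rfl; exact hyT hx
    have := (hw.comp (crude 3 T hT3 x x)).comp (RW.stay hxy p0 p1)
    exact this.mono (by simp only [k0]; omega)

theorem V_add {N k : ℕ} (hN : 3 ≤ N) (h : V n N k) (r : ℕ) : V n (N + r) (k + 11 * r) := by
  induction r with
  | zero => simpa using h
  | succ r ih => exact V_succ (N := N + r) (by omega) ih

theorem block {x b : Fin n} {T B : Finset (Fin n)} (hT3 : T.card = 3) (hxb : x ≠ b) (hb : b ∈ B)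
    {SB : GA (Fin n)} (hw : RW b b (B.card - 1) SB) {p : ℝ} (p0 : 0 ≤ p) (p1 : p ≤ 1) :
    RW x x (B.card + 11) (SB * Uu T * E x b p) := by
  have hpos : 0 < B.card := Finset.card_pos.2 ⟨b, hb⟩
  have := ((RW.move b x).comp (hw.comp (crude 3 T hT3 x b))).comp (RW.stay hxb p0 p1)
  rw [one_mul] at this
  exact this.mono (by simp only [k0]; omega)

theorem V_oct {m k : ℕ} (hm : 3 ≤ m) (h : V n m k) : V n (8 * m) (k + 18 * m + 34) := by
  intro S T hS hT hT3 x hx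
  obtain ⟨A, hTA, hAS, hA⟩ := Finset.exists_subsuperset_card_eq hT (n := m) (by omega) (by omega)
  obtain ⟨A3, hAA3, hA3S, hA3⟩ :=
    Finset.exists_subsuperset_card_eq hAS (n := 2 * m) (by omega) (by omega)
  obtain ⟨A2, hAA2, hA2S, hA2⟩ :=
    Finset.exists_subsuperset_card_eq hA3S (n := 4 * m) (by omega) (by omega)
  obtain ⟨B3, rfl, d3, c3⟩ : ∃ B3, A ∪ B3 = A3 ∧ Disjoint A B3 ∧ B3.card = m :=
    ⟨A3 \ A, Finset.union_sdiff_of_subset hAA3, Finset.disjoint_sdiff,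
      by rw [Finset.card_sdiff_of_subset hAA3]; omega⟩
  obtain ⟨B2, rfl, d2, c2⟩ : ∃ B2, A ∪ B3 ∪ B2 = A2 ∧ Disjoint (A ∪ B3) B2 ∧ B2.card = 2 * m :=
    ⟨A2 \ (A ∪ B3), Finset.union_sdiff_of_subset hAA2, Finset.disjoint_sdiff,
      by rw [Finset.card_sdiff_of_subset hAA2]; omega⟩
  obtain ⟨B1, rfl, d1, c1⟩ : ∃ B1, A ∪ B3 ∪ B2 ∪ B1 = S ∧ Disjoint (A ∪ B3 ∪ B2) B1 ∧
      B1.card = 4 * m :=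
    ⟨S \ (A ∪ B3 ∪ B2), Finset.union_sdiff_of_subset hA2S, Finset.disjoint_sdiff,
      by rw [Finset.card_sdiff_of_subset hA2S]; omega⟩
  obtain ⟨P1, P2, P3, f1, f2, f3, hcol⟩ := columns m A B3 B2 B1 d3 d2 d1 hA c3 c2 c1
  obtain ⟨b3, hb3⟩ : B3.Nonempty := Finset.card_pos.1 (by omega)
  obtain ⟨b2, hb2⟩ : B2.Nonempty := Finset.card_pos.1 (by omega)
  obtain ⟨b1, hb1⟩ : B1.Nonempty := Finset.card_pos.1 (by omega)
  obtain ⟨S3, hS3, w3, s3⟩ := spread hb3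
  obtain ⟨S2, hS2, w2, s2⟩ := spread hb2
  obtain ⟨S1, hS1, w1, s1⟩ := spread hb1
  obtain ⟨X, hX, hw, hp⟩ := h A T hA hTA hT3 x hx
  have hTA3 : T ⊆ A ∪ B3 := hTA.trans hAA3
  have hTA2 : T ⊆ A ∪ B3 ∪ B2 := hTA3.trans hAA2
  obtain ⟨p3, p30, p31, q3⟩ := dbl d3 hTA hT3 hx hb3 hp hS3 s3
  have r3 := q3 P3 f3
  obtain ⟨p2, p20, p21, q2⟩ := dbl d2 hTA3 hT3 hx hb2 r3 hS2 s2
  have r2 := q2 P2 f2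
  obtain ⟨p1, p10, p11, q1⟩ := dbl d1 hTA2 hT3 hx hb1 r2 hS1 s1
  have r1 := q1 P1 f1
  have n3 : x ≠ b3 := by
    rintro rfl; exact Finset.disjoint_left.1 d3 (hTA hx) hb3
  have n2 : x ≠ b2 := by
    rintro rfl; exact Finset.disjoint_left.1 d2 (hTA3 hx) hb2
  have n1 : x ≠ b1 := by
    rintro rfl; exact Finset.disjoint_left.1 d1 (hTA2 hx) hb1
  refine ⟨_, ?_, ?_, r1⟩
  · have u1 : A ∪ B3 ∪ B2 ⊆ A ∪ B3 ∪ B2 ∪ B1 := Finset.subset_union_left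
    have u2 : A ∪ B3 ⊆ A ∪ B3 ∪ B2 ∪ B1 := hA3S
    have v3 : B3 ⊆ A ∪ B3 ∪ B2 ∪ B1 := Finset.subset_union_right.trans u2
    have v2 : B2 ⊆ A ∪ B3 ∪ B2 ∪ B1 := Finset.subset_union_right.trans u1
    have v1 : B1 ⊆ A ∪ B3 ∪ B2 ∪ B1 := Finset.subset_union_right
    have UT : Uu T ∈ SA (A ∪ B3 ∪ B2 ∪ B1) := SA_mono hT (Uu_mem_SA _)
    have M := fun {f g : GA (Fin n)} => (SA (A ∪ B3 ∪ B2 ∪ B1)).mul_mem (x := f) (y := g)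
    exact M f1.1 (M (M (M (M (SA_mono u1 f2.1) (M (M (M (M (SA_mono u2 f3.1)
      (M (M (M (SA_mono hAS hX) (SA_mono v3 hS3)) UT) (E_mem_SA (hT hx) (v3 hb3) _)))
      (SA_mono v2 hS2)) UT) (E_mem_SA (hT hx) (v2 hb2) _))) (SA_mono v1 hS1)) UT)
      (E_mem_SA (hT hx) (v1 hb1) _))
  · have w := (((hcol x x).comp hw).comp (block hT3 n3 hb3 w3 p30 p31)).comp
      ((block hT3 n2 hb2 w2 p20 p21).comp (block hT3 n1 hb1 w1 p10 p11))
    simp only [mul_assoc] at w ⊢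
    exact w.mono (by omega)

theorem V_bound (N : ℕ) : 3 ≤ N → ∃ k, V n N k ∧ 8 * k ≤ 21 * N + 211200 := by
  induction N using Nat.strong_induction_on with
  | _ N ih =>
    intro hN
    by_cases hs : N < 2400
    · refine ⟨0 + 11 * (N - 3), ?_, by omega⟩
      have := V_add (n := n) le_rfl V_three (N - 3)
      rwa [show 3 + (N - 3) = N by omega] at this
    · obtain ⟨k, hk, hb⟩ := ih (N / 8) (by omega) (by omega)
      have := V_add (by omega) (V_oct (by omega) hk) (N % 8)
      rw [Nat.div_add_mod] at this
      exact ⟨_, this, by omega⟩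

theorem W_bound (N : ℕ) : ∃ k, (∀ S : Finset (Fin n), S.card = N → ∀ h z, RW h z k (Uu S)) ∧
    16 * k ≤ 7 * N ^ 2 + 211200 * N + 16 := by
  induction N using Nat.strong_induction_on with
  | _ N ih =>
    by_cases hN : N < 3
    · refine ⟨k0 N, crude N, ?_⟩
      interval_cases N <;> simp [k0]
    · obtain ⟨M, rfl⟩ : ∃ M, N = M + 3 := ⟨N - 3, by omega⟩
      obtain ⟨k, hk, hb⟩ := ih M (by omega)
      obtain ⟨k', hk', hb'⟩ := V_bound (n := n) (M + 3) (by omega)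
      refine ⟨k + k' + 11, ?_, by nlinarith⟩
      intro S hS h z
      obtain ⟨T, hT, hT3⟩ := Finset.exists_subset_card_eq (s := S) (n := 3) (by omega)
      obtain ⟨x, hx⟩ : T.Nonempty := Finset.card_pos.1 (by omega)
      obtain ⟨X, _, hw, hp⟩ := hk' S T hS hT hT3 x hx
      have w := ((RW.move x z).comp (hw.comp (crude 3 T hT3 x x))).comp
        (hk (S \ T) (by rw [Finset.card_sdiff_of_subset hT]; omega) h x)
      rw [one_mul, hp] at w
      exact w.mono (by simp only [k0]; omega)

theorem Ustar_le (n : ℕ) (hn : 2 ≤ n) : 16 * Ustar n ≤ 7 * n ^ 2 + 211200 * n + 16 := by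
  have : NeZero n := ⟨by omega⟩
  obtain ⟨k, hk, hb⟩ := W_bound (n := n) n
  obtain ⟨φ', _, L, hL, hv, he⟩ := hk Finset.univ (by simp) 0 0 1 (by simp)
  have hmem : ∀ σ : Perm (Fin n), σ ∈ Sy (Finset.univ : Finset (Fin n)) := fun σ x hx => by simp at hx
  rw [inv_one, gof_one, mul_one, gof_Uu (hmem _)] at he
  have : Ustar n ≤ L.length := by
    apply Nat.sInf_le
    refine ⟨L, rfl, ⟨fun e h => (hv e h).1, ?_⟩, fun e h => (hv e h).2⟩
    intro σ
    classical
    rw [permDist_eq, he, coeff_Uu, if_pos (hmem σ)]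
    have : SyF (Finset.univ : Finset (Fin n)) = Finset.univ := by
      ext σ; simp [mem_SyF, hmem]
    rw [this, Finset.card_univ, Fintype.card_perm, Fintype.card_fin, one_div]
  omega

end Vsec
end StarSh

theorem Ustar_upper_seven_eighths :
    ∃ C : ℝ, 0 < C ∧ ∀ n : ℕ, 2 ≤ n →
      (Ustar n : ℝ) ≤ (7 / 8) * (n.choose 2 : ℝ) + C * n * Real.log n := by
  refine ⟨211220, by norm_num, ?_⟩
  intro n hn
  have h := StarSh.Ustar_le n hn
  have h' : 16 * (Ustar n : ℝ) ≤ 7 * (n : ℝ) ^ 2 + 211200 * n + 16 := by exact_mod_cast h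
  have hn' : (2 : ℝ) ≤ n := by exact_mod_cast hn
  have hl : (1 / 2 : ℝ) ≤ Real.log n := by
    have h1 := Real.log_two_gt_d9
    have h2 := Real.log_le_log (by norm_num) hn'
    linarith
  have hc : (n : ℝ) * (1 / 2) ≤ n * Real.log n := mul_le_mul_of_nonneg_left hl (by linarith)
  rw [Nat.cast_choose_two]
  nlinarith
end

section
/- Let n₀ ≥ 2 and ε > 0, and suppose U(n₀) ≤ (1 − ε)·(n₀ choose 2). Then for every integer n ≥ n₀, U(n) ≤ (1 − δ)·(n choose 2), where δ = ε·(n₀ − 1)/(4·n₀). -/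
open scoped BigOperators

open Polynomial in
theorem splits_deriv {p : ℝ[X]} (hp : p.Splits) : (derivative p).Splits := by
  rw [splits_iff_card_roots] at hp ⊢
  have h1 := card_roots_le_derivative p
  have h2 := natDegree_derivative_le p
  have h3 := (derivative p).card_roots'
  by_cases h0 : p.natDegree = 0
  · omega
  · omega

open Polynomial in
theorem splits_iter {p : ℝ[X]} (hp : p.Splits) (k : ℕ) : (derivative^[k] p).Splits := by
  induction k with
  | zero => simpa using hp
  | succ k ih => rw [Function.iterate_succ_apply']; exact splits_deriv ih

open Polynomial in
noncomputable def rodH (t b : ℕ) : ℝ[X] :=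
  ∑ k ∈ Finset.range (t + 1), C ((t.choose k : ℝ) * (b.choose (t - k))) * (X ^ (t - k) * (X - C 1) ^ k)

open Polynomial in
theorem rodH_eq (t b : ℕ) (h : t ≤ b) :
    derivative^[t] ((X : ℝ[X]) ^ t * (X - C 1) ^ b) =
      C (t.factorial : ℝ) * rodH t b * (X - C 1) ^ (b - t) := by
  rw [mul_comm (X ^ t), iterate_derivative_mul, rodH, Finset.mul_sum, Finset.sum_mul]
  apply Finset.sum_congr rfl
  intro k hk
  have hk' : k ≤ t := by simpa [Nat.lt_succ_iff] using hk
  rw [iterate_derivative_X_sub_pow, iterate_derivative_X_pow_eq_smul]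
  have e1 : b - (t - k) = k + (b - t) := by omega
  rw [e1, pow_add]
  have e2 : (b.descFactorial (t - k) * t.descFactorial k) = t.factorial * b.choose (t - k) := by
    rw [Nat.descFactorial_eq_factorial_mul_choose]
    have := Nat.factorial_mul_descFactorial hk'
    calc _ = ((t-k).factorial * t.descFactorial k) * b.choose (t-k) := by ring
      _ = _ := by rw [this]
  have e3 : ((b.descFactorial (t - k) : ℝ[X]) * (t.descFactorial k : ℝ[X])) = (t.factorial : ℝ[X]) * (b.choose (t - k) : ℝ[X]) := by
    exact_mod_cast e2
  simp only [nsmul_eq_mul, smul_eq_C_mul, map_mul, map_natCast]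
  linear_combination ((t.choose k : ℝ[X]) * (X - C 1) ^ k * (X - C 1) ^ (b - t) * X ^ (t - k)) * e3

open Polynomial in
theorem rodH_eval (t b : ℕ) (x : ℝ) : (rodH t b).eval x =
    ∑ k ∈ Finset.range (t + 1), ((t.choose k : ℝ) * (b.choose (t - k))) * (x ^ (t - k) * (x - 1) ^ k) := by
  simp [rodH, eval_finset_sum]

open Polynomial in
theorem rodH_natDegree_le (t b : ℕ) : (rodH t b).natDegree ≤ t := by
  unfold rodH
  apply natDegree_sum_le_of_forall_le
  intro k hk
  have hk' : k ≤ t := by simpa [Nat.lt_succ_iff] using hk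
  refine (natDegree_C_mul_le _ _).trans ?_
  refine natDegree_mul_le.trans ?_
  rw [natDegree_X_pow, natDegree_pow, natDegree_X_sub_C]
  omega

open Polynomial in
theorem rodH_coeff (t b : ℕ) : 0 < (rodH t b).coeff t := by
  unfold rodH
  rw [finset_sum_coeff]
  have key : ∀ k ∈ Finset.range (t+1), (C ((t.choose k : ℝ) * (b.choose (t - k))) * (X ^ (t - k) * (X - C (1:ℝ)) ^ k)).coeff t = (t.choose k : ℝ) * (b.choose (t - k)) := by
    intro k hk
    have hk' : k ≤ t := by simpa [Nat.lt_succ_iff] using hk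
    have hm : (X ^ (t - k) * (X - C (1:ℝ)) ^ k).Monic := (monic_X_pow _).mul ((monic_X_sub_C 1).pow k)
    have hd : (X ^ (t - k) * (X - C (1:ℝ)) ^ k).natDegree = t := by
      rw [(monic_X_pow _).natDegree_mul ((monic_X_sub_C 1).pow k), natDegree_X_pow, natDegree_pow, natDegree_X_sub_C]
      omega
    have := hm.coeff_natDegree
    rw [hd] at this
    rw [coeff_C_mul, this, mul_one]
  rw [Finset.sum_congr rfl key]
  apply Finset.sum_pos'
  · intros; positivity
  · exact ⟨t, by simp, by simp⟩

theorem rodH_root (t b : ℕ) (x : ℝ) (h : (rodH t b).eval x = 0) : 0 ≤ x ∧ x ≤ 1 := by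
  rw [rodH_eval] at h
  by_contra hx
  rw [not_and_or, not_le, not_le] at hx
  rcases hx with hx | hx
  · have : 0 < (-1) ^ t * ∑ k ∈ Finset.range (t + 1), ((t.choose k : ℝ) * (b.choose (t - k))) * (x ^ (t - k) * (x - 1) ^ k) := by
      rw [Finset.mul_sum]
      have key : ∀ k ∈ Finset.range (t+1), (-1:ℝ) ^ t * (((t.choose k : ℝ) * (b.choose (t - k))) * (x ^ (t - k) * (x - 1) ^ k)) = ((t.choose k : ℝ) * (b.choose (t - k))) * ((-x) ^ (t - k) * (1 - x) ^ k) := by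
        intro k hk
        have hk' : k ≤ t := by simpa [Nat.lt_succ_iff] using hk
        have : (-1:ℝ)^t = (-1)^(t-k) * (-1)^k := by rw [← pow_add]; congr 1; omega
        rw [this, neg_pow x, show (1 - x) = -(x-1) by ring, neg_pow (x-1)]; ring
      rw [Finset.sum_congr rfl key]
      have h1 : 0 < -x := by linarith
      have h2 : 0 < 1 - x := by linarith
      apply Finset.sum_pos'
      · intros; positivity
      · exact ⟨t, by simp, by simp; positivity⟩
    rw [h] at this; simp at this
  · have h1 : 0 < x - 1 := by linarith
    have h2 : 0 < x := by linarith
    have : 0 < ∑ k ∈ Finset.range (t + 1), ((t.choose k : ℝ) * (b.choose (t - k))) * (x ^ (t - k) * (x - 1) ^ k) := by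
      apply Finset.sum_pos'
      · intros; positivity
      · exact ⟨t, by simp, by simp; positivity⟩
    linarith

open Polynomial in
/-- The hypergeometric generating polynomial is a product of Bernoulli ones. -/
theorem hyper_bernoulli (t b : ℕ) (h : t ≤ b) :
    ∃ (c : ℝ) (l : List ℝ), l.length = t ∧ (∀ r ∈ l, 0 ≤ r ∧ r ≤ 1) ∧
      (∑ k ∈ Finset.range (t + 1), C ((t.choose k : ℝ) * (b.choose (t - k))) * X ^ k)
        = C c * (l.map (fun r => C (1 - r) + C r * X)).prod := by
  have h0 : rodH t b ≠ 0 := by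
    intro h0; have := rodH_coeff t b; rw [h0] at this; simp at this
  have hdeg : (rodH t b).natDegree = t :=
    le_antisymm (rodH_natDegree_le t b) (le_natDegree_of_ne_zero (rodH_coeff t b).ne')
  have hs : (rodH t b).Splits := by
    have h1 : (derivative^[t] ((X : ℝ[X]) ^ t * (X - C 1) ^ b)).Splits :=
      splits_iter ((Splits.X_pow t).mul ((Splits.X_sub_C 1).pow b)) t
    rw [rodH_eq t b h] at h1
    refine h1.of_dvd ?_ ⟨C (t.factorial : ℝ) * (X - C 1) ^ (b - t), by ring⟩
    refine mul_ne_zero (mul_ne_zero ?_ h0) (pow_ne_zero _ (X_sub_C_ne_zero 1))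
    rw [Ne, C_eq_zero]; exact_mod_cast t.factorial_ne_zero
  refine ⟨(rodH t b).leadingCoeff, (rodH t b).roots.toList, ?_, ?_, ?_⟩
  · rw [Multiset.length_toList, ← hs.natDegree_eq_card_roots, hdeg]
  · intro r hr
    rw [Multiset.mem_toList, mem_roots h0] at hr
    exact rodH_root t b r hr
  · apply eq_of_infinite_eval_eq
    apply Set.Infinite.mono (s := Set.Ioi (1:ℝ)) _ (Set.Ioi_infinite 1)
    intro z hz
    have hz' : 1 - z ≠ 0 := by simp at hz; intro h; linarith
    simp only [Set.mem_setOf_eq]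
    have e := hs.eval_eq_prod_roots (1 / (1 - z))
    rw [rodH_eval] at e
    have hlen : (rodH t b).roots.toList.length = t := by
      rw [Multiset.length_toList, ← hs.natDegree_eq_card_roots, hdeg]
    have e' : ((rodH t b).roots.map (fun a => 1 / (1 - z) - a)).prod = ((rodH t b).roots.toList.map (fun a => 1 / (1 - z) - a)).prod := by
      conv_lhs => rw [← Multiset.coe_toList (rodH t b).roots]
      rw [Multiset.map_coe, Multiset.prod_coe]
    rw [e'] at e
    have gen : ∀ l : List ℝ, (l.map (fun r => C (1 - r) + C r * X)).prod.eval z = (1 - z) ^ l.length * (l.map (fun a => 1 / (1 - z) - a)).prod := by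
      intro l
      induction l with
      | nil => simp
      | cons a l ih =>
        simp only [List.map_cons, List.prod_cons, eval_mul, ih, List.length_cons, pow_succ]
        simp only [eval_add, eval_C, eval_mul, eval_X]
        field_simp
        ring
    rw [eval_mul, gen, hlen, eval_C, mul_left_comm, ← e, eval_finset_sum, Finset.mul_sum]
    apply Finset.sum_congr rfl
    intro k hk
    have hk' : k ≤ t := by simpa [Nat.lt_succ_iff] using hk
    have : (1 - z)^t = (1-z)^(t-k) * (1-z)^k := by rw [← pow_add]; congr 1; omega
    have e2 : 1 / (1 - z) - 1 = z / (1 - z) := by field_simp; ring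
    rw [this, e2]
    simp only [eval_mul, eval_C, eval_pow, eval_X, div_pow]
    field_simp
    simp

/-- Permutations supported on `S`. -/
def symS {n : ℕ} (S : Finset (Fin n)) : Subgroup (Equiv.Perm (Fin n)) where
  carrier := {σ | ∀ i, i ∉ S → σ i = i}
  mul_mem' := by
    intro a b ha hb i hi
    rw [Equiv.Perm.mul_apply, hb i hi, ha i hi]
  one_mem' := by intro i _; rfl
  inv_mem' := by
    intro a ha i hi
    rw [Equiv.Perm.inv_eq_iff_eq]
    exact (ha i hi).symm

theorem mem_symS {n : ℕ} {S : Finset (Fin n)} {σ : Equiv.Perm (Fin n)} :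
    σ ∈ symS S ↔ ∀ i, i ∉ S → σ i = i := Iff.rfl

theorem symS_mono {n : ℕ} {S S' : Finset (Fin n)} (h : S ⊆ S') : symS S ≤ symS S' :=
  fun _ hσ i hi => hσ i (fun hi' => hi (h hi'))

theorem symS_apply_mem {n : ℕ} {S : Finset (Fin n)} {σ : Equiv.Perm (Fin n)} (h : σ ∈ symS S)
    (i : Fin n) : σ i ∈ S ↔ i ∈ S := by
  constructor
  · intro hi
    by_contra hn
    rw [h i hn] at hi; exact hn hi
  · intro hi
    by_contra hn
    have := h _ hn
    exact hn ((σ.injective this).symm ▸ hi)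

theorem symS_commute {n : ℕ} {S S' : Finset (Fin n)} (h : Disjoint S S')
    {σ τ : Equiv.Perm (Fin n)} (hσ : σ ∈ symS S) (hτ : τ ∈ symS S') : σ * τ = τ * σ := by
  ext i
  simp only [Equiv.Perm.mul_apply]
  by_cases hi : i ∈ S
  · rw [hτ i (Finset.disjoint_left.mp h hi),
      hτ _ (Finset.disjoint_left.mp h ((symS_apply_mem hσ i).2 hi))]
  · rw [hσ i hi]
    by_cases hi' : i ∈ S'
    · rw [hσ _ (Finset.disjoint_right.mp h ((symS_apply_mem hτ i).2 hi'))]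
    · rw [hτ i hi', hσ i hi]

theorem symS_exists_map {n : ℕ} {S A B : Finset (Fin n)} (hA : A ⊆ S) (hB : B ⊆ S)
    (hc : A.card = B.card) : ∃ g ∈ symS S, A.image g = B := by
  classical
  have hcard : Fintype.card {x : {x // x ∈ S} // x.1 ∈ A} = Fintype.card {x : {x // x ∈ S} // x.1 ∈ B} := by
    have gen : ∀ A : Finset (Fin n), A ⊆ S → Fintype.card {x : {x // x ∈ S} // x.1 ∈ A} = A.card := by
      intro A hA
      rw [← Fintype.card_coe A]
      exact Fintype.card_congr ⟨fun x => ⟨x.1.1, x.2⟩, fun x => ⟨⟨x.1, hA x.2⟩, x.2⟩, fun _ => rfl, fun _ => rfl⟩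
    rw [gen A hA, gen B hB, hc]
  let e := Fintype.equivOfCardEq hcard
  refine ⟨Equiv.Perm.ofSubtype e.extendSubtype, ?_, ?_⟩
  · intro i hi
    exact Equiv.Perm.ofSubtype_apply_of_not_mem _ hi
  · apply Finset.eq_of_subset_of_card_le
    · intro y hy
      obtain ⟨a, ha, rfl⟩ := Finset.mem_image.mp hy
      rw [Equiv.Perm.ofSubtype_apply_of_mem _ (hA ha)]
      exact e.extendSubtype_mem ⟨a, hA ha⟩ ha
    · rw [Finset.card_image_of_injective _ (Equiv.injective _), hc]

/-- Number of elements of `T` sent into `Y`. -/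
def cnt {n : ℕ} (T Y : Finset (Fin n)) (σ : Equiv.Perm (Fin n)) : ℕ := (T.image σ ∩ Y).card

theorem symS_decomp {n : ℕ} {W T : Finset (Fin n)} {h : Equiv.Perm (Fin n)}
    (hh : h ∈ symS W) (him : T.image h = T) :
    ∃ a ∈ symS T, ∃ b ∈ symS (W \ T), h = a * b := by
  classical
  have hp : ∀ x, h x ∈ T ↔ x ∈ T := by
    intro x
    constructor
    · intro hx
      rw [← him] at hx
      obtain ⟨y, hy, e⟩ := Finset.mem_image.mp hx
      exact h.injective e ▸ hy
    · intro hx; rw [← him]; exact Finset.mem_image_of_mem _ hx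
  have ha : Equiv.Perm.ofSubtype (h.subtypePerm hp) ∈ symS T :=
    fun i hi => Equiv.Perm.ofSubtype_apply_of_not_mem _ hi
  refine ⟨_, ha, (Equiv.Perm.ofSubtype (h.subtypePerm hp))⁻¹ * h, ?_, by group⟩
  intro i hi
  rw [Equiv.Perm.mul_apply, Equiv.Perm.inv_eq_iff_eq]
  by_cases hiT : i ∈ T
  · rw [Equiv.Perm.ofSubtype_apply_of_mem _ hiT]; rfl
  · have : i ∉ W := fun hw => hi (Finset.mem_sdiff.2 ⟨hw, hiT⟩)
    rw [hh i this, ha i hiT]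

theorem double_coset {n : ℕ} {W T Y : Finset (Fin n)} (hT : T ⊆ W) (hY : Y ⊆ W)
    {σ τ : Equiv.Perm (Fin n)} (hσ : σ ∈ symS W) (hτ : τ ∈ symS W) (hN : cnt T Y σ = cnt T Y τ) :
    ∃ k₁ ∈ symS (W \ Y), ∃ k₂ ∈ symS Y, ∃ h₁ ∈ symS T, ∃ h₂ ∈ symS (W \ T),
      τ = k₁ * k₂ * σ * (h₁ * h₂) := by
  have sub : ∀ σ ∈ symS W, T.image σ \ Y ⊆ W \ Y := by
    intro σ hσ x hx
    rw [Finset.mem_sdiff] at hx ⊢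
    refine ⟨?_, hx.2⟩
    obtain ⟨y, hy, rfl⟩ := Finset.mem_image.mp hx.1
    exact (symS_apply_mem hσ y).2 (hT hy)
  have hc2 : (T.image σ \ Y).card = (T.image τ \ Y).card := by
    have h1 := Finset.card_sdiff_add_card_inter (T.image σ) Y
    have h2 := Finset.card_sdiff_add_card_inter (T.image τ) Y
    rw [Finset.card_image_of_injective _ (Equiv.injective _)] at h1 h2
    unfold cnt at hN
    omega
  obtain ⟨k₂, hk₂, e₂⟩ := symS_exists_map (S := Y) (Finset.inter_subset_right (s₁ := T.image σ)) (Finset.inter_subset_right (s₁ := T.image τ)) hN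
  obtain ⟨k₁, hk₁, e₁⟩ := symS_exists_map (sub σ hσ) (sub τ hτ) hc2
  have him : T.image (k₁ * k₂ * σ) ⊆ T.image τ := by
    intro x hx
    obtain ⟨y, hy, rfl⟩ := Finset.mem_image.mp hx
    simp only [Equiv.Perm.mul_apply]
    by_cases hyY : σ y ∈ Y
    · have h1 : k₂ (σ y) ∈ T.image τ ∩ Y := by
        rw [← e₂]
        exact Finset.mem_image_of_mem _ (Finset.mem_inter.2 ⟨Finset.mem_image_of_mem _ hy, hyY⟩)
      rw [Finset.mem_inter] at h1
      rw [hk₁ (k₂ (σ y)) (by simp [h1.2])]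
      exact h1.1
    · rw [hk₂ (σ y) hyY]
      have h1 : k₁ (σ y) ∈ T.image τ \ Y := by
        rw [← e₁]
        exact Finset.mem_image_of_mem _ (Finset.mem_sdiff.2 ⟨Finset.mem_image_of_mem _ hy, hyY⟩)
      exact (Finset.mem_sdiff.1 h1).1
  have him' : T.image (k₁ * k₂ * σ) = T.image τ := by
    apply Finset.eq_of_subset_of_card_le him
    rw [Finset.card_image_of_injective _ (Equiv.injective _), Finset.card_image_of_injective _ (Equiv.injective _)]
  have hκ : k₁ * k₂ * σ ∈ symS W :=
    mul_mem (mul_mem (symS_mono Finset.sdiff_subset hk₁) (symS_mono hY hk₂)) hσ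
  have hh : (k₁ * k₂ * σ)⁻¹ * τ ∈ symS W := mul_mem (inv_mem hκ) hτ
  have himh : T.image ((k₁ * k₂ * σ)⁻¹ * τ) = T := by
    rw [Equiv.Perm.coe_mul, ← Finset.image_image, ← him', Finset.image_image, ← Equiv.Perm.coe_mul,
      inv_mul_cancel, Equiv.Perm.coe_one, Finset.image_id]
  obtain ⟨a, ha, b, hb, e⟩ := symS_decomp hh himh
  exact ⟨k₁, hk₁, k₂, hk₂, a, ha, b, hb, by rw [← e]; group⟩

open Polynomial in
theorem subset_count {n : ℕ} {W Y : Finset (Fin n)} (hY : Y ⊆ W) (t b : ℕ) (hYc : Y.card = t)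
    (hW : W.card = t + b) :
    ∑ S ∈ W.powersetCard t, (X : ℝ[X]) ^ (S ∩ Y).card =
      ∑ k ∈ Finset.range (t + 1), C ((t.choose k : ℝ) * (b.choose (t - k))) * X ^ k := by
  classical
  have hmap : ∀ S ∈ W.powersetCard t, (S ∩ Y).card ∈ Finset.range (t + 1) := by
    intro S _
    have := Finset.card_le_card (Finset.inter_subset_right (s₁ := S) (s₂ := Y))
    simp; omega
  rw [← Finset.sum_fiberwise_of_maps_to hmap]
  apply Finset.sum_congr rfl
  intro k hk
  have hk' : k ≤ t := by simpa [Nat.lt_succ_iff] using hk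
  have hcard : ((W.powersetCard t).filter (fun S => (S ∩ Y).card = k)).card = t.choose k * b.choose (t - k) := by
    have hb : (W \ Y).card = b := by rw [Finset.card_sdiff_of_subset hY]; omega
    rw [← hYc, ← hb, ← Finset.card_powersetCard, hYc, ← Finset.card_powersetCard (t - k), ← Finset.card_product]
    apply Finset.card_bij' (fun S _ => (S ∩ Y, S \ Y)) (fun p _ => p.1 ∪ p.2)
    · intro S hS
      simp only [Finset.mem_filter, Finset.mem_powersetCard, Finset.mem_product] at hS ⊢
      have := Finset.card_sdiff_add_card_inter S Y
      exact ⟨⟨Finset.inter_subset_right, hS.2⟩, Finset.sdiff_subset_sdiff hS.1.1 le_rfl, by omega⟩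
    · rintro ⟨A, B⟩ h
      simp only [Finset.mem_filter, Finset.mem_powersetCard, Finset.mem_product] at h ⊢
      obtain ⟨⟨hA, hAc⟩, hB, hBc⟩ := h
      have hd : Disjoint A B := by
        rw [Finset.disjoint_left]; intro x hx hx'
        exact (Finset.mem_sdiff.1 (hB hx')).2 (hA hx)
      refine ⟨⟨Finset.union_subset (hA.trans hY) (hB.trans Finset.sdiff_subset), ?_⟩, ?_⟩
      · rw [Finset.card_union_of_disjoint hd]; omega
      · rw [← hAc]; congr 1
        ext x
        have := @hA x; have := @hB x
        simp only [Finset.mem_inter, Finset.mem_union, Finset.mem_sdiff] at *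
        tauto
    · intro S _
      ext x; simp only [Finset.mem_inter, Finset.mem_union, Finset.mem_sdiff]; tauto
    · rintro ⟨A, B⟩ h
      simp only [Finset.mem_powersetCard, Finset.mem_product] at h
      obtain ⟨⟨hA, hAc⟩, hB, hBc⟩ := h
      ext x
      · have := @hA x; have := @hB x
        simp only [Finset.mem_inter, Finset.mem_union, Finset.mem_sdiff] at *
        tauto
      · have := @hA x; have := @hB x
        simp only [Finset.mem_union, Finset.mem_sdiff] at *
        tauto
  rw [Finset.sum_congr rfl (g := fun _ => (X:ℝ[X])^k) (by intro S hS; rw [(Finset.mem_filter.1 hS).2]),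
    Finset.sum_const, hcard]
  simp

open Polynomial Classical in
theorem perm_count {n : ℕ} {W T Y : Finset (Fin n)} (hT : T ⊆ W) (hY : Y ⊆ W) (t b : ℕ)
    (hTc : T.card = t) (hYc : Y.card = t) (hW : W.card = t + b) :
    ∃ d : ℝ, ∑ σ ∈ Finset.univ.filter (· ∈ symS W), (X : ℝ[X]) ^ (cnt T Y σ) =
      C d * ∑ k ∈ Finset.range (t + 1), C ((t.choose k : ℝ) * (b.choose (t - k))) * X ^ k := by
  have hmap : ∀ σ ∈ Finset.univ.filter (· ∈ symS W), T.image σ ∈ W.powersetCard t := by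
    intro σ hσ
    rw [Finset.mem_filter] at hσ
    rw [Finset.mem_powersetCard, Finset.card_image_of_injective _ (Equiv.injective _)]
    refine ⟨?_, hTc⟩
    intro x hx
    obtain ⟨y, hy, rfl⟩ := Finset.mem_image.mp hx
    exact (symS_apply_mem hσ.2 y).2 (hT hy)
  refine ⟨(((Finset.univ.filter (· ∈ symS W)).filter (fun σ : Equiv.Perm (Fin n) => T.image σ = T)).card : ℝ), ?_⟩
  rw [← subset_count hY t b hYc hW, ← Finset.sum_fiberwise_of_maps_to hmap, Finset.mul_sum]
  apply Finset.sum_congr rfl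
  intro S hS
  rw [Finset.mem_powersetCard] at hS
  obtain ⟨g, hg, hgT⟩ := symS_exists_map hT hS.1 (hTc.trans hS.2.symm)
  rw [Finset.sum_congr rfl (g := fun _ => (X:ℝ[X])^(S ∩ Y).card) (by intro σ hσ; rw [cnt, (Finset.mem_filter.1 hσ).2]),
    Finset.sum_const]
  have : ((Finset.univ.filter (· ∈ symS W)).filter (fun σ : Equiv.Perm (Fin n) => T.image σ = S)).card = ((Finset.univ.filter (· ∈ symS W)).filter (fun σ : Equiv.Perm (Fin n) => T.image σ = T)).card := by
    apply Finset.card_bij' (fun σ _ => g⁻¹ * σ) (fun σ _ => g * σ)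
    · intro σ hσ
      simp only [Finset.mem_filter, Finset.mem_univ, true_and] at hσ ⊢
      refine ⟨mul_mem (inv_mem hg) hσ.1, ?_⟩
      rw [Equiv.Perm.coe_mul, ← Finset.image_image, hσ.2, ← hgT, Finset.image_image, ← Equiv.Perm.coe_mul,
        inv_mul_cancel, Equiv.Perm.coe_one, Finset.image_id]
    · intro σ hσ
      simp only [Finset.mem_filter, Finset.mem_univ, true_and] at hσ ⊢
      refine ⟨mul_mem hg hσ.1, ?_⟩
      rw [Equiv.Perm.coe_mul, ← Finset.image_image, hσ.2, hgT]
    · intro σ _; group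
    · intro σ _; group
  rw [this]
  simp

/-- Group algebra element of a list of lazy transpositions. -/
noncomputable def elt {n : ℕ} : List (LazyT n) → MonoidAlgebra ℝ (Equiv.Perm (Fin n))
  | [] => 1
  | e :: L => elt L * (e.2.2 • MonoidAlgebra.of ℝ _ (Equiv.swap e.1 e.2.1) + (1 - e.2.2) • 1)

theorem elt_coeff {n : ℕ} (L : List (LazyT n)) (σ : Equiv.Perm (Fin n)) :
    (elt L).coeff σ = permDist L σ := by
  induction L generalizing σ with
  | nil =>
    simp only [elt, permDist, MonoidAlgebra.one_def]
    rw [MonoidAlgebra.coeff_single, Finsupp.single_apply]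
    simp only [eq_comm]
  | cons e L ih =>
    simp only [elt, permDist, mul_add, mul_smul_comm, mul_one, MonoidAlgebra.coeff_add,
      MonoidAlgebra.coeff_smul, Finsupp.add_apply, Finsupp.smul_apply, MonoidAlgebra.of_apply,
      MonoidAlgebra.coeff_mul_single_apply, ih, smul_eq_mul, Equiv.swap_inv]

theorem elt_append {n : ℕ} (L L' : List (LazyT n)) : elt (L ++ L') = elt L' * elt L := by
  induction L with
  | nil => simp [elt]
  | cons e L ih => simp only [List.cons_append, elt, ih, mul_assoc]

open Classical in
/-- Uniform element on the permutations supported on `S`. -/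
noncomputable def uS {n : ℕ} (S : Finset (Fin n)) : MonoidAlgebra ℝ (Equiv.Perm (Fin n)) :=
  (((Finset.univ.filter (· ∈ symS S)).card : ℝ)⁻¹) •
    ∑ σ ∈ Finset.univ.filter (· ∈ symS S), MonoidAlgebra.of ℝ _ σ

open Classical in
theorem symS_card_ne {n : ℕ} (S : Finset (Fin n)) :
    ((Finset.univ.filter (· ∈ symS S)).card : ℝ) ≠ 0 := by
  have : (Finset.univ.filter (· ∈ symS S)).Nonempty := ⟨1, by simp [one_mem]⟩
  exact_mod_cast this.card_pos.ne'

theorem of_mul_uS {n : ℕ} {S : Finset (Fin n)} {τ : Equiv.Perm (Fin n)} (h : τ ∈ symS S) :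
    MonoidAlgebra.of ℝ _ τ * uS S = uS S := by
  classical
  unfold uS
  rw [mul_smul_comm, Finset.mul_sum]
  congr 1
  apply Finset.sum_bij' (fun σ _ => τ * σ) (fun σ _ => τ⁻¹ * σ)
  · intro σ hσ; simp only [Finset.mem_filter, Finset.mem_univ, true_and] at *; exact mul_mem h hσ
  · intro σ hσ; simp only [Finset.mem_filter, Finset.mem_univ, true_and] at *; exact mul_mem (inv_mem h) hσ
  · intro σ _; group
  · intro σ _; group
  · intro σ _; rw [map_mul]

theorem uS_mul_of {n : ℕ} {S : Finset (Fin n)} {τ : Equiv.Perm (Fin n)} (h : τ ∈ symS S) :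
    uS S * MonoidAlgebra.of ℝ _ τ = uS S := by
  classical
  unfold uS
  rw [smul_mul_assoc, Finset.sum_mul]
  congr 1
  apply Finset.sum_bij' (fun σ _ => σ * τ) (fun σ _ => σ * τ⁻¹)
  · intro σ hσ; simp only [Finset.mem_filter, Finset.mem_univ, true_and] at *; exact mul_mem hσ h
  · intro σ hσ; simp only [Finset.mem_filter, Finset.mem_univ, true_and] at *; exact mul_mem hσ (inv_mem h)
  · intro σ _; group
  · intro σ _; group
  · intro σ _; rw [map_mul]

theorem uS_mul_uS {n : ℕ} {S S' : Finset (Fin n)} (h : S ⊆ S') : uS S * uS S' = uS S' := by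
  classical
  conv_lhs => rw [uS]
  rw [smul_mul_assoc, Finset.sum_mul, Finset.sum_congr rfl (g := fun _ => uS S')
    (by intro σ hσ; exact of_mul_uS (symS_mono h (Finset.mem_filter.1 hσ).2)), Finset.sum_const,
    ← Nat.cast_smul_eq_nsmul ℝ, smul_smul, inv_mul_cancel₀ (symS_card_ne S), one_smul]

theorem uS_mul_uS' {n : ℕ} {S S' : Finset (Fin n)} (h : S ⊆ S') : uS S' * uS S = uS S' := by
  classical
  conv_lhs => rw [uS.eq_def S]
  rw [mul_smul_comm, Finset.mul_sum, Finset.sum_congr rfl (g := fun _ => uS S')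
    (by intro σ hσ; exact uS_mul_of (symS_mono h (Finset.mem_filter.1 hσ).2)), Finset.sum_const,
    ← Nat.cast_smul_eq_nsmul ℝ, smul_smul, inv_mul_cancel₀ (symS_card_ne S), one_smul]

theorem commute_uS {n : ℕ} {S : Finset (Fin n)} (z : MonoidAlgebra ℝ (Equiv.Perm (Fin n)))
    (h : ∀ σ ∈ symS S, Commute z (MonoidAlgebra.of ℝ _ σ)) : Commute z (uS S) := by
  classical
  unfold uS
  apply Commute.smul_right
  apply Commute.sum_right
  intro σ hσ
  exact h σ (Finset.mem_filter.1 hσ).2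

theorem commute_of_of {n : ℕ} {S S' : Finset (Fin n)} (h : Disjoint S S')
    {σ τ : Equiv.Perm (Fin n)} (hσ : σ ∈ symS S) (hτ : τ ∈ symS S') :
    Commute (MonoidAlgebra.of ℝ _ σ) (MonoidAlgebra.of ℝ _ τ) := by
  have : Commute σ τ := symS_commute h hσ hτ
  exact this.map (MonoidAlgebra.of ℝ _)

theorem uS_commute_uS {n : ℕ} {S S' : Finset (Fin n)} (h : Disjoint S S') :
    Commute (uS S) (uS S') := by
  apply commute_uS
  intro σ hσ
  apply Commute.symm
  apply commute_uS
  intro τ hτ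
  exact commute_of_of h.symm hσ hτ

theorem swap_mem_symS {n : ℕ} {S : Finset (Fin n)} {a b : Fin n} (ha : a ∈ S) (hb : b ∈ S) :
    Equiv.swap a b ∈ symS S := by
  intro i hi
  apply Equiv.swap_apply_of_ne_of_ne
  · rintro rfl; exact hi ha
  · rintro rfl; exact hi hb

theorem elt_commute_uS {n : ℕ} {S S' : Finset (Fin n)} (h : Disjoint S S') (L : List (LazyT n))
    (hL : ∀ e ∈ L, e.1 ∈ S ∧ e.2.1 ∈ S) : Commute (elt L) (uS S') := by
  apply commute_uS
  intro σ hσ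
  induction L with
  | nil => exact Commute.one_left _
  | cons e L ih =>
    rw [elt]
    apply Commute.mul_left
    · exact ih (fun e he => hL e (List.mem_cons_of_mem _ he))
    · have := hL e List.mem_cons_self
      apply Commute.add_left
      · exact (commute_of_of h (swap_mem_symS this.1 this.2) hσ).smul_left _
      · exact (Commute.one_left _).smul_left _

theorem cnt_swap {n : ℕ} {T Y : Finset (Fin n)} (hd : Disjoint T Y) {σ : Equiv.Perm (Fin n)}
    {a b : Fin n} (ha : a ∈ T) (hb : b ∈ Y) (hσa : σ a = a) (hσb : σ b = b) :
    cnt T Y (Equiv.swap a b * σ) = cnt T Y σ + 1 := by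
  have haY : a ∉ Y := Finset.disjoint_left.1 hd ha
  have hbT : b ∉ T := Finset.disjoint_right.1 hd hb
  unfold cnt
  rw [← Finset.card_insert_of_notMem (a := b)]
  · congr 1
    ext y
    simp only [Finset.mem_inter, Finset.mem_image, Finset.mem_insert, Equiv.Perm.mul_apply]
    constructor
    · rintro ⟨⟨i, hi, rfl⟩, hy⟩
      by_cases hia : i = a
      · left; rw [hia, hσa, Equiv.swap_apply_left]
      · right
        have h1 : σ i ≠ a := fun h => hia (σ.injective (h.trans hσa.symm))
        have h2 : σ i ≠ b := fun h => hbT ((σ.injective (h.trans hσb.symm)) ▸ hi)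
        rw [Equiv.swap_apply_of_ne_of_ne h1 h2] at hy ⊢
        exact ⟨⟨i, hi, rfl⟩, hy⟩
    · rintro (rfl | ⟨⟨i, hi, rfl⟩, hy⟩)
      · exact ⟨⟨a, ha, by rw [hσa, Equiv.swap_apply_left]⟩, hb⟩
      · refine ⟨⟨i, hi, ?_⟩, hy⟩
        have h1 : σ i ≠ a := fun h => haY (h ▸ hy)
        have h2 : σ i ≠ b := fun h => hbT ((σ.injective (h.trans hσb.symm)) ▸ hi)
        rw [Equiv.swap_apply_of_ne_of_ne h1 h2]
  · intro h
    obtain ⟨i, hi, e⟩ := Finset.mem_image.1 (Finset.mem_inter.1 h).1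
    exact hbT ((σ.injective (e.trans hσb.symm)) ▸ hi)

open Polynomial in
theorem cross_expand {n : ℕ} {W T Y : Finset (Fin n)} (hT : T ⊆ W) (hY : Y ⊆ W)
    (hd : Disjoint T Y) (K H : MonoidAlgebra ℝ (Equiv.Perm (Fin n)))
    (Φ : ℝ[X] →ₗ[ℝ] MonoidAlgebra ℝ (Equiv.Perm (Fin n)))
    (hΦ : ∀ σ ∈ symS W, Φ (X ^ cnt T Y σ) = K * MonoidAlgebra.of ℝ _ σ * H)
    (L : List (LazyT n)) (hL : ∀ e ∈ L, e.1 ∈ T ∧ e.2.1 ∈ Y)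
    (h1 : (L.map (fun e => e.1)).Nodup) (h2 : (L.map (fun e => e.2.1)).Nodup)
    (σ : Equiv.Perm (Fin n)) (hσ : σ ∈ symS W) (hfix : ∀ e ∈ L, σ e.1 = e.1 ∧ σ e.2.1 = e.2.1) :
    K * (elt L * MonoidAlgebra.of ℝ _ σ) * H =
      Φ ((L.map (fun e => C (1 - e.2.2) + C e.2.2 * X)).prod * X ^ cnt T Y σ) := by
  induction L generalizing σ with
  | nil => simp [elt, hΦ σ hσ]
  | cons e L ih =>
    have he := hL e List.mem_cons_self
    have hf := hfix e List.mem_cons_self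
    simp only [List.map_cons, List.nodup_cons] at h1 h2
    have hLL : ∀ e' ∈ L, e'.1 ∈ T ∧ e'.2.1 ∈ Y := fun e' he' => hL e' (List.mem_cons_of_mem _ he')
    have i1 := ih hLL h1.2 h2.2 σ hσ (fun e' he' => hfix e' (List.mem_cons_of_mem _ he'))
    have i2 := ih hLL h1.2 h2.2 (Equiv.swap e.1 e.2.1 * σ)
      (mul_mem (swap_mem_symS (hT he.1) (hY he.2)) hσ) (by
        intro e' he'
        have hf' := hfix e' (List.mem_cons_of_mem _ he')
        have hm' := hLL e' he'
        rw [Equiv.Perm.mul_apply, Equiv.Perm.mul_apply, hf'.1, hf'.2]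
        constructor
        · apply Equiv.swap_apply_of_ne_of_ne
          · intro h; exact h1.1 (h ▸ List.mem_map_of_mem he')
          · intro h; exact Finset.disjoint_left.1 hd hm'.1 (h ▸ he.2)
        · apply Equiv.swap_apply_of_ne_of_ne
          · intro h; exact Finset.disjoint_left.1 hd he.1 (h ▸ hm'.2)
          · intro h; exact h2.1 (h ▸ List.mem_map_of_mem he'))
    rw [cnt_swap hd he.1 he.2 hf.1 hf.2] at i2
    have e1 : elt (e :: L) * MonoidAlgebra.of ℝ _ σ =
        e.2.2 • (elt L * MonoidAlgebra.of ℝ _ (Equiv.swap e.1 e.2.1 * σ)) +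
        (1 - e.2.2) • (elt L * MonoidAlgebra.of ℝ _ σ) := by
      rw [elt, map_mul]
      simp only [mul_add, add_mul, mul_smul_comm, smul_mul_assoc, mul_one, mul_assoc]
    rw [e1]
    simp only [mul_add, add_mul, mul_smul_comm, smul_mul_assoc]
    rw [i1, i2, ← map_smul, ← map_smul, ← map_add]
    congr 1
    simp only [List.map_cons, List.prod_cons, smul_eq_C_mul]
    ring

theorem bern_eval_one (l : List ℝ) :
    (l.map (fun r => Polynomial.C (1 - r) + Polynomial.C r * Polynomial.X)).prod.eval 1 = 1 := by
  induction l with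
  | nil => simp
  | cons a l ih => simp only [List.map_cons, List.prod_cons, Polynomial.eval_mul, ih]; simp

open Polynomial in
theorem cross_core {n : ℕ} {W T Y : Finset (Fin n)} (hT : T ⊆ W) (hY : Y ⊆ W)
    (hd : Disjoint T Y) (hc : T.card = Y.card) :
    ∃ L : List (LazyT n), L.length = T.card ∧ (∀ e ∈ L, e.Valid) ∧
      (∀ e ∈ L, e.1 ∈ T ∧ e.2.1 ∈ Y) ∧
      uS (W \ Y) * uS Y * elt L * uS T * uS (W \ T) = uS W := by
  classical
  set t := T.card with ht
  obtain ⟨b, hb⟩ : ∃ b, W.card = t + b := ⟨W.card - t, by have := Finset.card_le_card hT; omega⟩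
  have htb : t ≤ b := by
    have h1 := Finset.card_le_card (Finset.union_subset hT hY)
    rw [Finset.card_union_of_disjoint hd] at h1
    omega
  obtain ⟨c, l, hl, hl01, hpoly⟩ := hyper_bernoulli t b htb
  obtain ⟨d, hcount⟩ := perm_count hT hY t b rfl hc.symm hb
  have hlenT : T.toList.length = t := by simp [ht]
  have hlenY : Y.toList.length = t := by simp [hc]
  let L : List (LazyT n) := T.toList.zip (Y.toList.zip l)
  have m1 : L.map (fun e => e.1) = T.toList := by
    show List.map Prod.fst (T.toList.zip (Y.toList.zip l)) = _
    apply List.map_fst_zip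
    simp [List.length_zip, hlenT, hlenY, hl]
  have m23 : L.map (fun e => e.2) = Y.toList.zip l := by
    show List.map Prod.snd (T.toList.zip (Y.toList.zip l)) = _
    apply List.map_snd_zip
    simp [List.length_zip, hlenT, hlenY, hl]
  have m2 : L.map (fun e => e.2.1) = Y.toList := by
    have : L.map (fun e => e.2.1) = (L.map (fun e => e.2)).map Prod.fst := by rw [List.map_map]; rfl
    rw [this, m23]
    apply List.map_fst_zip
    omega
  have m3 : L.map (fun e => e.2.2) = l := by
    have : L.map (fun e => e.2.2) = (L.map (fun e => e.2)).map Prod.snd := by rw [List.map_map]; rfl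
    rw [this, m23]
    apply List.map_snd_zip
    omega
  have hmem : ∀ e ∈ L, e.1 ∈ T ∧ e.2.1 ∈ Y := by
    intro e he
    constructor
    · rw [← Finset.mem_toList, ← m1]; exact List.mem_map_of_mem he
    · rw [← Finset.mem_toList, ← m2]; exact List.mem_map_of_mem he
  refine ⟨L, ?_, ?_, hmem, ?_⟩
  · rw [← hlenT, ← m1, List.length_map]
  · intro e he
    refine ⟨?_, hl01 _ ?_⟩
    · intro h
      have := hmem e he
      exact Finset.disjoint_left.1 hd this.1 (h ▸ this.2)
    · rw [← m3]; exact List.mem_map_of_mem he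
  set K := uS (W \ Y) * uS Y with hK
  set H := uS T * uS (W \ T) with hH
  let B : ℕ → MonoidAlgebra ℝ (Equiv.Perm (Fin n)) := fun k =>
    if h : ∃ σ ∈ symS W, cnt T Y σ = k then K * MonoidAlgebra.of ℝ _ h.choose * H else 0
  let Φ : ℝ[X] →ₗ[ℝ] MonoidAlgebra ℝ (Equiv.Perm (Fin n)) := (basisMonomials ℝ).constr ℝ B
  have hΦ : ∀ σ ∈ symS W, Φ (X ^ cnt T Y σ) = K * MonoidAlgebra.of ℝ _ σ * H := by
    intro σ hσ
    have e0 : (X : ℝ[X]) ^ cnt T Y σ = basisMonomials ℝ (cnt T Y σ) := by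
      rw [coe_basisMonomials, X_pow_eq_monomial]
    rw [e0]
    simp only [Φ, Module.Basis.constr_basis, B]
    have hex : ∃ σ' ∈ symS W, cnt T Y σ' = cnt T Y σ := ⟨σ, hσ, rfl⟩
    rw [dif_pos hex]
    obtain ⟨k₁, hk₁, k₂, hk₂, h₁, hh₁, h₂, hh₂, e⟩ := double_coset hT hY hσ hex.choose_spec.1 hex.choose_spec.2.symm
    rw [e]
    simp only [map_mul]
    have eK : K * (MonoidAlgebra.of ℝ _ k₁ * MonoidAlgebra.of ℝ _ k₂) = K := by
      have hcm : Commute (uS Y) (MonoidAlgebra.of ℝ _ k₁) := by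
        apply Commute.symm
        apply commute_uS
        intro τ hτ
        exact commute_of_of Finset.sdiff_disjoint hk₁ hτ
      rw [hK, mul_assoc, ← mul_assoc (uS Y), hcm.eq, mul_assoc (MonoidAlgebra.of ℝ _ k₁), uS_mul_of hk₂,
        ← mul_assoc, uS_mul_of hk₁]
    have eH : (MonoidAlgebra.of ℝ _ h₁ * MonoidAlgebra.of ℝ _ h₂) * H = H := by
      have hcm : Commute (MonoidAlgebra.of ℝ _ h₂) (uS T) := by
        apply commute_uS
        intro τ hτ
        exact commute_of_of Finset.sdiff_disjoint hh₂ hτ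
      rw [hH, mul_assoc, ← mul_assoc (MonoidAlgebra.of ℝ _ h₂), hcm.eq, mul_assoc (uS T), of_mul_uS hh₂,
        ← mul_assoc, of_mul_uS hh₁]
    calc _ = (K * (MonoidAlgebra.of ℝ _ k₁ * MonoidAlgebra.of ℝ _ k₂)) * MonoidAlgebra.of ℝ _ σ *
          ((MonoidAlgebra.of ℝ _ h₁ * MonoidAlgebra.of ℝ _ h₂) * H) := by simp only [mul_assoc]
      _ = _ := by rw [eK, eH]
  have hcnt1 : cnt T Y 1 = 0 := by
    unfold cnt
    rw [Equiv.Perm.coe_one, Finset.image_id, Finset.disjoint_iff_inter_eq_empty.1 hd, Finset.card_empty]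
  have main := cross_expand hT hY hd K H Φ hΦ L hmem (by rw [m1]; exact Finset.nodup_toList _)
    (by rw [m2]; exact Finset.nodup_toList _) 1 (one_mem _) (by intros; simp)
  rw [map_one, mul_one, hcnt1, pow_zero, mul_one] at main
  set Q := (L.map (fun e => C (1 - e.2.2) + C e.2.2 * X)).prod with hQ
  have hQl : Q = (l.map (fun r => C (1 - r) + C r * X)).prod := by
    rw [hQ]; congr 1
    conv_rhs => rw [← m3]
    rw [List.map_map]; rfl
  rw [hpoly, ← hQl] at hcount
  have hev := congrArg (fun p => Polynomial.eval 1 p) hcount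
  simp only [eval_finsetSum, eval_pow, eval_X, one_pow, eval_mul, eval_C] at hev
  rw [hQl, bern_eval_one, Finset.sum_const, nsmul_eq_mul, mul_one, mul_one] at hev
  calc _ = K * elt L * H := by simp only [hK, hH, mul_assoc]
    _ = Φ Q := main
    _ = K * uS W * H := by
      conv_rhs => rw [uS]
      rw [mul_smul_comm, smul_mul_assoc, Finset.mul_sum, Finset.sum_mul,
        Finset.sum_congr rfl (fun σ hσ => (hΦ σ (Finset.mem_filter.1 hσ).2).symm), ← map_sum, ← map_smul,
        hcount]
      congr 1
      rw [← mul_assoc, ← C_mul, smul_eq_C_mul, ← mul_assoc, ← C_mul, ← hev,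
        inv_mul_cancel₀ (symS_card_ne W), C_1, one_mul]
    _ = uS W := by
      rw [hK, hH, mul_assoc (uS (W \ Y)), uS_mul_uS hY, uS_mul_uS Finset.sdiff_subset, ← mul_assoc,
        uS_mul_uS' hT, uS_mul_uS' Finset.sdiff_subset]

/-- The uniform element on `S` is realised by a valid list of length `ℓ`. -/
def RealS {n : ℕ} (S : Finset (Fin n)) (ℓ : ℕ) : Prop :=
  ∃ L : List (LazyT n), L.length = ℓ ∧ (∀ e ∈ L, e.Valid) ∧ elt L = uS S

theorem symS_eq_one {n : ℕ} {S : Finset (Fin n)} (hS : S.card ≤ 1) {σ : Equiv.Perm (Fin n)}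
    (h : σ ∈ symS S) : σ = 1 := by
  ext i
  by_cases hi : i ∈ S
  · have h1 : σ i ∈ S := by
      by_contra hc
      have h2 := h _ hc
      rw [σ.injective h2] at hc
      exact hc hi
    rw [Finset.card_le_one.1 hS _ h1 _ hi]; rfl
  · rw [h i hi]; rfl

theorem uS_eq_one {n : ℕ} {S : Finset (Fin n)} (hS : S.card ≤ 1) : uS S = 1 := by
  classical
  have : Finset.univ.filter (· ∈ symS S) = {1} := by
    ext σ
    simp only [Finset.mem_filter, Finset.mem_univ, true_and, Finset.mem_singleton]
    exact ⟨symS_eq_one hS, fun h => h ▸ one_mem _⟩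
  unfold uS
  rw [this]
  simp [MonoidAlgebra.one_def]

theorem level_step {n t c : ℕ} (hP : ∀ S : Finset (Fin n), S.card = t → RealS S c) :
    ∀ (j : ℕ) (W T : Finset (Fin n)), T ⊆ W → T.card = t → W.card = (j + 1) * t →
      ∃ R : List (LazyT n), R.length = j * (t + 2 * c) + c ∧ (∀ e ∈ R, e.Valid) ∧
        elt R * uS (W \ T) = uS W := by
  intro j
  induction j with
  | zero =>
    intro W T hT hTc hW
    have hWT : W = T := (Finset.eq_of_subset_of_card_le hT (by omega)).symm
    obtain ⟨L, h1, h2, h3⟩ := hP T hTc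
    refine ⟨L, by omega, h2, ?_⟩
    rw [h3, hWT]
    exact uS_mul_uS' Finset.sdiff_subset
  | succ j ih =>
    intro W T hT hTc hW
    have hWTc : (W \ T).card = (j + 1) * t := by
      rw [Finset.card_sdiff_of_subset hT, hTc, hW, Nat.succ_mul]; omega
    obtain ⟨Y, hYs, hYc⟩ := Finset.exists_subset_card_eq (s := W \ T) (n := t)
      (by rw [hWTc]; nlinarith)
    have hY : Y ⊆ W := hYs.trans Finset.sdiff_subset
    have hd : Disjoint T Y := by
      rw [Finset.disjoint_left]
      intro a ha hb
      exact (Finset.mem_sdiff.1 (hYs hb)).2 ha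
    have hTW0 : T ⊆ W \ Y := by
      intro a ha
      exact Finset.mem_sdiff.2 ⟨hT ha, Finset.disjoint_left.1 hd ha⟩
    obtain ⟨R0, r1, r2, r3⟩ := ih (W \ Y) T hTW0 hTc
      (by rw [Finset.card_sdiff_of_subset hY, hYc, hW, Nat.succ_mul]; omega)
    obtain ⟨LT, t1, t2, t3⟩ := hP T hTc
    obtain ⟨LY, y1, y2, y3⟩ := hP Y hYc
    obtain ⟨X, x1, x2, x3, x4⟩ := cross_core hT hY hd (hTc.trans hYc.symm)
    refine ⟨LT ++ X ++ LY ++ R0, ?_, ?_, ?_⟩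
    · simp only [List.length_append, t1, x1, y1, r1, hTc]; ring
    · intro e he
      simp only [List.mem_append] at he
      rcases he with ((he | he) | he) | he
      · exact t2 e he
      · exact x2 e he
      · exact y2 e he
      · exact r2 e he
    · set Z := (W \ Y) \ T with hZ
      have hZTY : Disjoint (T ∪ Y) Z := by
        rw [Finset.disjoint_left]
        intro a ha hb
        simp only [hZ, Finset.mem_sdiff, Finset.mem_union] at ha hb
        tauto
      have hZs : Z ⊆ W \ T := by
        intro a ha
        simp only [hZ, Finset.mem_sdiff] at ha ⊢
        tauto
      have cT : Commute (uS T) (uS Z) :=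
        uS_commute_uS (Finset.disjoint_of_subset_left Finset.subset_union_left hZTY)
      have cY : Commute (uS Y) (uS Z) :=
        uS_commute_uS (Finset.disjoint_of_subset_left Finset.subset_union_right hZTY)
      have cX : Commute (elt X) (uS Z) := elt_commute_uS hZTY X (fun e he =>
        ⟨Finset.mem_union_left _ (x3 e he).1, Finset.mem_union_right _ (x3 e he).2⟩)
      have cA : Commute (uS Y * elt X * uS T) (uS Z) := (cY.mul_left cX).mul_left cT
      simp only [elt_append, t3, y3]
      calc _ = elt R0 * ((uS Y * elt X * uS T) * uS Z) * uS (W \ T) := by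
            simp only [mul_assoc, uS_mul_uS hZs]
        _ = (elt R0 * uS Z) * uS Y * elt X * uS T * uS (W \ T) := by
            rw [cA.eq]; simp only [mul_assoc]
        _ = uS W := by rw [r3, x4]

theorem block_real {n t c : ℕ} (hP : ∀ S : Finset (Fin n), S.card = t → RealS S c) :
    ∀ (q : ℕ) (S : Finset (Fin n)), S.card = q * t →
      RealS S (∑ j ∈ Finset.range q, (j * (t + 2 * c) + c)) := by
  intro q
  induction q with
  | zero =>
    intro S hS
    refine ⟨[], by simp, by simp, ?_⟩
    rw [uS_eq_one (by omega)]; rfl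
  | succ q ih =>
    intro S hS
    obtain ⟨T, hT, hTc⟩ := Finset.exists_subset_card_eq (s := S) (n := t) (by rw [hS]; nlinarith)
    obtain ⟨L, l1, l2, l3⟩ := ih (S \ T)
      (by rw [Finset.card_sdiff_of_subset hT, hTc, hS, Nat.succ_mul]; omega)
    obtain ⟨R, r1, r2, r3⟩ := level_step hP q S T hT hTc hS
    refine ⟨L ++ R, ?_, ?_, ?_⟩
    · rw [List.length_append, l1, r1, Finset.sum_range_succ]
    · intro e he
      rcases List.mem_append.1 he with he | he
      · exact l2 e he
      · exact r2 e he
    · rw [elt_append, l3, r3]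

theorem real_one {n : ℕ} (S : Finset (Fin n)) (hS : S.card = 1) : RealS S 0 :=
  ⟨[], rfl, by simp, by rw [uS_eq_one hS.le]; rfl⟩

theorem real_insert {n m ℓ : ℕ} (hP : ∀ S : Finset (Fin n), S.card = m → RealS S ℓ)
    (S : Finset (Fin n)) (hS : S.card = m + 1) : RealS S (ℓ + m) := by
  obtain ⟨T, hT, hTc⟩ := Finset.exists_subset_card_eq (s := S) (n := 1) (by omega)
  obtain ⟨R, r1, r2, r3⟩ := level_step real_one m S T hT hTc (by omega)
  obtain ⟨L, l1, l2, l3⟩ := hP (S \ T) (by rw [Finset.card_sdiff_of_subset hT]; omega)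
  refine ⟨L ++ R, ?_, ?_, ?_⟩
  · rw [List.length_append, l1, r1]; omega
  · intro e he
    rcases List.mem_append.1 he with he | he
    · exact l2 e he
    · exact r2 e he
  · rw [elt_append, l3, r3]

theorem real_insert_many {n m ℓ : ℕ} (hP : ∀ S : Finset (Fin n), S.card = m → RealS S ℓ) (r : ℕ) :
    ∀ S : Finset (Fin n), S.card = m + r →
      RealS S (ℓ + ∑ i ∈ Finset.range r, (m + i)) := by
  induction r with
  | zero => intro S hS; exact hP S hS
  | succ r ih =>
    intro S hS
    rw [Finset.sum_range_succ, ← add_assoc]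
    exact real_insert ih S (by omega)

theorem shuffle_of_real {n ℓ : ℕ} (h : RealS (Finset.univ : Finset (Fin n)) ℓ) :
    ∃ L : List (LazyT n), L.length = ℓ ∧ IsShuffle L := by
  classical
  obtain ⟨L, h1, h2, h3⟩ := h
  refine ⟨L, h1, h2, fun σ => ?_⟩
  rw [← elt_coeff, h3]
  unfold uS
  have : Finset.univ.filter (· ∈ symS (Finset.univ : Finset (Fin n))) = Finset.univ := by
    ext σ
    simp [mem_symS]
  rw [this, Finset.card_univ, Fintype.card_perm, Fintype.card_fin]
  simp only [MonoidAlgebra.coeff_smul, MonoidAlgebra.coeff_sum, Finsupp.smul_apply,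
    Finsupp.finsetSum_apply, MonoidAlgebra.of_apply, MonoidAlgebra.coeff_single,
    Finsupp.single_apply, Finset.sum_ite_eq', Finset.mem_univ, if_true, smul_eq_mul, mul_one, one_div]

theorem U_le_of_real {n ℓ : ℕ} (h : RealS (Finset.univ : Finset (Fin n)) ℓ) : U n ≤ ℓ :=
  Nat.sInf_le (shuffle_of_real h)

theorem U_attained (n : ℕ) : ∃ L : List (LazyT n), L.length = U n ∧ IsShuffle L := by
  have h := block_real (n := n) real_one n Finset.univ (by simp)
  exact Nat.sInf_mem (s := {ℓ : ℕ | ∃ L : List (LazyT n), L.length = ℓ ∧ IsShuffle L})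
    ⟨_, shuffle_of_real h⟩

theorem real_of_shuffle {n t : ℕ} {L : List (LazyT t)} (hL : IsShuffle L)
    (S : Finset (Fin n)) (hS : S.card = t) : RealS S L.length := by
  classical
  let e : Fin t ≃ {x // x ∈ S} := (S.equivFinOfCardEq hS).symm
  let φ : Equiv.Perm (Fin t) →* Equiv.Perm (Fin n) := Equiv.Perm.extendDomainHom e
  have hφi : Function.Injective φ := Equiv.Perm.extendDomainHom_injective e
  have hsw : ∀ a b : Fin t, φ (Equiv.swap a b) = Equiv.swap (e a : Fin n) (e b) := by
    intro a b
    ext i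
    show ((Equiv.swap a b).extendDomain e i : Fin n).val = _
    by_cases hi : i ∈ S
    · obtain ⟨j, hj⟩ := e.surjective ⟨i, hi⟩
      have hij : i = (e j : Fin n) := by rw [hj]
      rw [hij, Equiv.Perm.extendDomain_apply_image]
      have hinj : Function.Injective (fun x => (e x : Fin n)) :=
        Subtype.val_injective.comp e.injective
      have := hinj.map_swap (x := a) (y := b) (z := j)
      rw [this]
    · rw [Equiv.Perm.extendDomain_apply_not_subtype _ _ hi, Equiv.swap_apply_of_ne_of_ne]
      · rintro rfl; exact hi (e a).2
      · rintro rfl; exact hi (e b).2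
  have hfil : Finset.univ.filter (· ∈ symS S) = Finset.univ.image φ := by
    ext σ
    simp only [Finset.mem_filter, Finset.mem_univ, true_and, Finset.mem_image]
    constructor
    · intro h
      have hp : ∀ x, σ x ∈ S ↔ x ∈ S := by
        intro x
        by_cases hx : x ∈ S
        · simp only [hx, iff_true]; exact (symS_apply_mem h x).2 hx
        · rw [h x hx]
      refine ⟨e.symm.permCongr (σ.subtypePerm hp), ?_⟩
      ext i
      show (Equiv.Perm.extendDomain _ e i : Fin n).val = _
      by_cases hi : i ∈ S
      · rw [Equiv.Perm.extendDomain_apply_subtype _ _ hi]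
        simp [Equiv.permCongr_apply]
      · rw [Equiv.Perm.extendDomain_apply_not_subtype _ _ hi, h i hi]
    · rintro ⟨τ, rfl⟩ i hi
      exact Equiv.Perm.extendDomain_apply_not_subtype _ _ hi
  let Ψ := MonoidAlgebra.mapDomainRingHom ℝ φ
  have hΨof : ∀ σ, Ψ (MonoidAlgebra.of ℝ _ σ) = MonoidAlgebra.of ℝ _ (φ σ) := by
    intro σ
    simp [Ψ, MonoidAlgebra.of_apply]
  have hΨs : ∀ (r : ℝ) x, Ψ (r • x) = r • Ψ x := by
    intro r x
    exact MonoidAlgebra.mapDomain_smul _ _ _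
  let L' : List (LazyT n) := L.map (fun x => ((e x.1 : Fin n), (e x.2.1 : Fin n), x.2.2))
  have hLL : ∀ M : List (LazyT t),
      elt (M.map (fun x => ((e x.1 : Fin n), (e x.2.1 : Fin n), x.2.2))) = Ψ (elt M) := by
    intro M
    induction M with
    | nil => simp [elt]
    | cons x M ih =>
      rw [List.map_cons, elt, elt, ih, map_mul, map_add, hΨs, hΨs, hΨof, map_one, hsw]
  refine ⟨L', by simp [L'], ?_, ?_⟩
  · intro x hx
    obtain ⟨y, hy, rfl⟩ := List.mem_map.1 hx
    have := hL.1 y hy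
    refine ⟨?_, this.2⟩
    intro h
    exact this.1 (e.injective (Subtype.ext h))
  · rw [hLL L]
    have hel : elt L = ((t.factorial : ℝ)⁻¹) • ∑ σ, MonoidAlgebra.of ℝ _ σ := by
      ext σ
      rw [elt_coeff, hL.2 σ]
      simp only [MonoidAlgebra.coeff_smul, MonoidAlgebra.coeff_sum, Finsupp.smul_apply,
        Finsupp.finsetSum_apply, MonoidAlgebra.of_apply, MonoidAlgebra.coeff_single,
        Finsupp.single_apply, Finset.sum_ite_eq', Finset.mem_univ, if_true, smul_eq_mul, mul_one, one_div]
    rw [hel, hΨs, map_sum]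
    unfold uS
    rw [hfil, Finset.card_image_of_injective _ hφi, Finset.sum_image (fun a _ b _ h => hφi h),
      Finset.card_univ, Fintype.card_perm, Fintype.card_fin]
    simp only [hΨof]

theorem sum_levels (q : ℕ) (t c : ℝ) :
    ∑ j ∈ Finset.range q, ((j : ℝ) * (t + 2 * c) + c) = q * (q - 1) / 2 * t + q ^ 2 * c := by
  induction q with
  | zero => simp
  | succ q ih => rw [Finset.sum_range_succ, ih]; push_cast; ring

theorem sum_points (r : ℕ) (m : ℝ) :
    ∑ i ∈ Finset.range r, (m + (i : ℝ)) = r * m + r * (r - 1) / 2 := by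
  induction r with
  | zero => simp
  | succ r ih => rw [Finset.sum_range_succ, ih]; push_cast; ring

theorem constant_saving_propagates (n₀ : ℕ) (hn₀ : 2 ≤ n₀) (ε : ℝ) (hε : 0 < ε)
    (h : (U n₀ : ℝ) ≤ (1 - ε) * (n₀.choose 2 : ℝ)) :
    ∀ n : ℕ, n₀ ≤ n →
      (U n : ℝ) ≤ (1 - ε * ((n₀ : ℝ) - 1) / (4 * n₀)) * (n.choose 2 : ℝ) := by
  intro n hn
  obtain ⟨L, hLlen, hL⟩ := U_attained n₀
  have hP : ∀ S : Finset (Fin n), S.card = n₀ → RealS S (U n₀) := by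
    intro S hS
    rw [← hLlen]
    exact real_of_shuffle hL S hS
  have hq1 : 1 ≤ n / n₀ := (Nat.one_le_div_iff (by omega)).2 hn
  have hr : n % n₀ < n₀ := Nat.mod_lt _ (by omega)
  have hnqr : n = n / n₀ * n₀ + n % n₀ := by rw [mul_comm]; exact (Nat.div_add_mod n n₀).symm
  generalize n / n₀ = q at *
  generalize n % n₀ = r at *
  have hU := U_le_of_real (real_insert_many (block_real hP q) r Finset.univ (by simpa using hnqr))
  have hU' : (U n : ℝ) ≤ (q * (q - 1) / 2 * n₀ + q ^ 2 * (U n₀ : ℝ)) +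
      (r * (q * n₀ : ℝ) + r * (r - 1) / 2) := by
    rw [← sum_levels, ← sum_points]
    exact_mod_cast hU
  have hnR : (n : ℝ) = q * n₀ + r := by exact_mod_cast hnqr
  rw [Nat.cast_choose_two] at h ⊢
  have ht : (2 : ℝ) ≤ n₀ := by exact_mod_cast hn₀
  have hq : (1 : ℝ) ≤ q := by exact_mod_cast hq1
  have hrR : (r : ℝ) + 1 ≤ n₀ := by exact_mod_cast hr
  have hr0 : (0 : ℝ) ≤ r := by positivity
  generalize (U n₀ : ℝ) = c at *
  generalize (U n : ℝ) = u at *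
  generalize (n : ℝ) = N at *
  generalize (n₀ : ℝ) = t at *
  generalize (q : ℝ) = Q at *
  generalize (r : ℝ) = R at *
  have h2 : Q ^ 2 * c ≤ Q ^ 2 * ((1 - ε) * (t * (t - 1) / 2)) :=
    mul_le_mul_of_nonneg_left h (by positivity)
  have h3 : u ≤ N * (N - 1) / 2 - Q ^ 2 * ε * (t * (t - 1) / 2) := by
    rw [hnR]; nlinarith
  have hNt : N ≤ 2 * Q * t := by nlinarith
  have hN1 : 1 ≤ N := by nlinarith
  have h4 : N * (N - 1) ≤ (2 * Q * t) ^ 2 := by nlinarith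
  have h5 : ε * (t - 1) / (4 * t) * (N * (N - 1) / 2) ≤ Q ^ 2 * ε * (t * (t - 1) / 2) := by
    rw [div_mul_eq_mul_div, div_le_iff₀ (by linarith)]
    have h6 : 0 ≤ ε * (t - 1) := mul_nonneg hε.le (by linarith)
    nlinarith [mul_le_mul_of_nonneg_left h4 h6]
  linarith
end

section
/- For all integers t and n with 1 ≤ t and 2t ≤ n, U_t(n) ≤ 2·U(t) + t + U_t(n − t). -/
open scoped BigOperators

section PolyPart
open Polynomial

lemma roots_iter_deriv_mem (K : Set ℂ) (hK : Convex ℝ K) (F : ℂ[X])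
    (hF : ∀ z, F.eval z = 0 → z ∈ K) (k : ℕ) (hne : derivative^[k] F ≠ 0) :
    ∀ z, (derivative^[k] F).eval z = 0 → z ∈ K := by
  induction k with
  | zero => simpa using hF
  | succ k ih =>
    rw [Function.iterate_succ_apply'] at hne ⊢
    set P := derivative^[k] F with hP
    have hP0 : P ≠ 0 := by
      intro h; apply hne; rw [h]; simp
    have hdeg : 0 < P.degree := by
      by_contra h
      push Not at h
      apply hne
      rw [eq_C_of_degree_le_zero h]; simp
    intro z hz
    have h1 := rootSet_derivative_subset_convexHull_rootSet hdeg
    have h2 : z ∈ P.derivative.rootSet ℂ := by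
      rw [mem_rootSet]; exact ⟨hne, by simpa using hz⟩
    refine convexHull_min ?_ hK (h1 h2)
    intro w hw
    rw [mem_rootSet] at hw
    exact ih hP0 w (by simpa using hw.2)

noncomputable def hyperG (t m : ℕ) : ℂ[X] :=
  ∑ j ∈ Finset.range (t+1), C ((t.choose j * m.choose j : ℕ) : ℂ) * (X ^ j * (X + C 1) ^ (t - j))

lemma hyperG_deriv (t m : ℕ) (h : t ≤ m) :
    derivative^[t] ((X : ℂ[X]) ^ t * (X + C 1) ^ m) =
      C (t.factorial : ℂ) * ((X + C 1) ^ (m - t) * hyperG t m) := by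
  rw [iterate_derivative_mul, hyperG, Finset.mul_sum, Finset.mul_sum]
  refine Finset.sum_congr rfl fun j hj => ?_
  have hj' : j ≤ t := by simpa [Nat.lt_succ_iff] using hj
  rw [iterate_derivative_X_pow_eq_C_mul, iterate_derivative_X_add_pow]
  have e1 : t - (t - j) = j := by omega
  have e2 : m - j = (m - t) + (t - j) := by omega
  have e3 : t.descFactorial (t - j) * m.descFactorial j = t.factorial * m.choose j := by
    rw [Nat.descFactorial_eq_factorial_mul_choose m j, ← mul_assoc]
    congr 1
    have := Nat.factorial_mul_descFactorial (Nat.sub_le t j)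
    rw [e1] at this
    rw [mul_comm]; exact this
  have e3' : (t.descFactorial (t - j) : ℂ[X]) * (m.descFactorial j : ℂ[X])
     = (t.factorial : ℂ[X]) * (m.choose j : ℂ[X]) := by exact_mod_cast e3
  rw [e1, e2, pow_add]
  simp only [nsmul_eq_mul, map_natCast, Nat.cast_mul, map_mul]
  linear_combination ((t.choose j : ℂ[X])) * X ^ j * (X + C 1) ^ (m - t) * (X + C 1) ^ (t - j) * e3'

lemma hyperG_monics (t j : ℕ) (hj : j ≤ t) :
    ((X : ℂ[X]) ^ j * (X + C 1) ^ (t - j)).Monic ∧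
    ((X : ℂ[X]) ^ j * (X + C 1) ^ (t - j)).natDegree = t := by
  have h1 : ((X : ℂ[X]) ^ j).Monic := monic_X_pow j
  have h2 : ((X + C 1 : ℂ[X]) ^ (t - j)).Monic := (monic_X_add_C 1).pow _
  refine ⟨h1.mul h2, ?_⟩
  rw [h1.natDegree_mul h2, (monic_X_add_C (1:ℂ)).natDegree_pow, natDegree_X_pow,
    natDegree_X_add_C]
  omega

lemma vandermonde' (t m : ℕ) :
    ∑ j ∈ Finset.range (t+1), t.choose j * m.choose j = (t+m).choose t := by
  rw [Nat.add_choose_eq, Finset.Nat.sum_antidiagonal_eq_sum_range_succ_mk,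
    ← Finset.sum_range_reflect]
  refine Finset.sum_congr rfl fun j hj => ?_
  have hj' : j ≤ t := by simpa [Nat.lt_succ_iff] using hj
  have : t + 1 - 1 - j = t - j := by omega
  rw [this, Nat.choose_symm hj']

lemma hyperG_coeff (t m : ℕ) : (hyperG t m).coeff t = ((t+m).choose t : ℂ) := by
  rw [hyperG, finsetSum_coeff, ← vandermonde', Nat.cast_sum]
  refine Finset.sum_congr rfl fun j hj => ?_
  have hj' : j ≤ t := by simpa [Nat.lt_succ_iff] using hj
  obtain ⟨a, b⟩ := hyperG_monics t j hj'
  rw [coeff_C_mul]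
  have : ((X : ℂ[X]) ^ j * (X + C 1) ^ (t - j)).coeff t = 1 := by
    have := a.coeff_natDegree
    rwa [b] at this
  rw [this, mul_one]

lemma hyperG_natDegree (t m : ℕ) : (hyperG t m).natDegree = t := by
  apply le_antisymm
  · refine natDegree_sum_le_of_forall_le _ _ fun j hj => ?_
    have hj' : j ≤ t := by simpa [Nat.lt_succ_iff] using hj
    exact (natDegree_C_mul_le _ _).trans (hyperG_monics t j hj').2.le
  · apply le_natDegree_of_ne_zero
    rw [hyperG_coeff]
    exact_mod_cast (Nat.choose_pos (by omega)).ne'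

lemma hyperG_factor (t m : ℕ) (h : t ≤ m) :
    ∃ q : Fin t → ℝ, (∀ i, 0 ≤ q i ∧ q i ≤ 1) ∧
      hyperG t m = C ((t+m).choose t : ℂ) * ∏ i, (X + C (q i : ℂ)) := by
  have hlead : (hyperG t m).leadingCoeff = ((t+m).choose t : ℂ) := by
    rw [leadingCoeff, hyperG_natDegree, hyperG_coeff]
  have hne : hyperG t m ≠ 0 := by
    intro h0
    rw [h0] at hlead
    have : ((t+m).choose t : ℂ) ≠ 0 := by exact_mod_cast (Nat.choose_pos (by omega)).ne'
    exact this (by rw [← hlead]; simp)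
  have hD : derivative^[t] ((X : ℂ[X]) ^ t * (X + C 1) ^ m) ≠ 0 := by
    rw [hyperG_deriv t m h]
    refine mul_ne_zero ?_ (mul_ne_zero (pow_ne_zero _ (X_add_C_ne_zero 1)) hne)
    rw [Ne, C_eq_zero]
    exact_mod_cast t.factorial_ne_zero
  have hroots := roots_iter_deriv_mem (segment ℝ (-1) 0) (convex_segment _ _)
    ((X : ℂ[X]) ^ t * (X + C 1) ^ m) (by
      intro z hz
      simp only [eval_mul, eval_pow, eval_X, eval_add, eval_C, mul_eq_zero] at hz
      rcases hz with hz | hz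
      · rw [eq_zero_of_pow_eq_zero hz]; exact right_mem_segment _ _ _
      · have := eq_zero_of_pow_eq_zero hz
        rw [eq_neg_of_add_eq_zero_left this]; exact left_mem_segment _ _ _) t hD
  have hsp := IsAlgClosed.splits (hyperG t m)
  have hprod := hsp.eq_prod_roots
  have hcard : (hyperG t m).roots.card = t := by
    rw [← hsp.natDegree_eq_card_roots, hyperG_natDegree]
  obtain ⟨z, hz⟩ : ∃ z : Fin t → ℂ, Multiset.map z Finset.univ.val = (hyperG t m).roots := by
    generalize (hyperG t m).roots = s at hcard
    induction s using Quotient.inductionOn with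
    | h l =>
      have hl : l.length = t := by simpa using hcard
      subst hl
      refine ⟨l.get, ?_⟩
      simp
  have hz' : ∀ i, ∃ q : ℝ, 0 ≤ q ∧ q ≤ 1 ∧ z i = -(q : ℂ) := by
    intro i
    have hmem : z i ∈ (hyperG t m).roots := by
      rw [← hz]; exact Multiset.mem_map_of_mem _ (Finset.mem_univ i)
    have hr := (mem_roots hne).1 hmem
    have := hroots (z i) (by
      rw [hyperG_deriv t m h, eval_mul, eval_mul, hr.eq_zero]; simp)
    obtain ⟨a, b, ha, hb, hab, hs⟩ := this
    refine ⟨a, ha, by linarith, ?_⟩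
    rw [← hs]; simp
  choose q hq0 hq1 hq2 using hz'
  refine ⟨q, fun i => ⟨hq0 i, hq1 i⟩, ?_⟩
  rw [hprod, hlead, ← hz, Multiset.map_map]
  congr 1
  change ∏ i, (X - C (z i)) = _
  refine Finset.prod_congr rfl fun i _ => ?_
  rw [hq2]; simp

lemma exists_weights (t m : ℕ) (h : t ≤ m) :
    ∃ p : Fin t → ℝ, (∀ i, 0 ≤ p i ∧ p i ≤ 1) ∧
      ∀ k, k ≤ t → ∑ T ∈ Finset.powersetCard k (Finset.univ : Finset (Fin t)),
        ((∏ i ∈ T, p i) * ∏ i ∈ Finset.univ \ T, (1 - p i)) =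
        (t.choose k * m.choose k : ℝ) / ((t+m).choose t : ℝ) := by
  obtain ⟨q, hq, hG⟩ := hyperG_factor t m h
  refine ⟨fun i => 1 - q i, fun i => ⟨by linarith [(hq i).2], by linarith [(hq i).1]⟩, ?_⟩
  -- real-variable identity
  have hpt : ∀ u : ℝ, u < 1 →
      ∑ j ∈ Finset.range (t+1), (t.choose j * m.choose j : ℝ) * u ^ j =
        ((t+m).choose t : ℝ) * ∏ i, ((1 - q i) * u + q i) := by
    intro u hu
    have h1 : (1 - u) ≠ 0 := by linarith
    have hG' := congrArg (eval ((u / (1 - u) : ℝ) : ℂ)) hG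
    simp only [hyperG, eval_finsetSum, eval_mul, eval_C, eval_pow, eval_X, eval_add,
      eval_prod] at hG'
    have hR : ∑ j ∈ Finset.range (t+1), (t.choose j * m.choose j : ℝ) *
        ((u / (1 - u)) ^ j * (u / (1 - u) + 1) ^ (t - j)) =
        ((t+m).choose t : ℝ) * ∏ i, (u / (1 - u) + q i) := by
      apply Complex.ofReal_injective
      push_cast
      push_cast at hG'
      exact hG'
    have h2 : u / (1 - u) + 1 = 1 / (1 - u) := by field_simp; ring
    have h3 : ∏ i, ((1 - q i) * u + q i) = (1 - u) ^ t * ∏ i, (u / (1 - u) + q i) := by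
      have : (1 - u) ^ t = ∏ _i : Fin t, (1 - u) := by simp
      rw [this, ← Finset.prod_mul_distrib]
      refine Finset.prod_congr rfl fun i _ => ?_
      field_simp; ring
    rw [h3, mul_left_comm, ← hR, Finset.mul_sum]
    refine Finset.sum_congr rfl fun j hj => ?_
    have hj' : j ≤ t := by simpa [Nat.lt_succ_iff] using hj
    rw [h2, div_pow, div_pow]
    have : (1 - u) ^ t = (1 - u) ^ j * (1 - u) ^ (t - j) := by
      rw [← pow_add]; congr 1; omega
    rw [this]
    field_simp
    simp
  have hpoly : (∑ j ∈ Finset.range (t+1), C (t.choose j * m.choose j : ℝ) * X ^ j : ℝ[X]) =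
      C ((t+m).choose t : ℝ) * ∏ i, (C (1 - q i) * X + C (q i)) := by
    apply eq_of_infinite_eval_eq
    refine Set.Infinite.mono ?_ (Set.Iio_infinite (1:ℝ))
    intro u hu
    have := hpt u hu
    simp only [Set.mem_ofPred_eq, eval_finsetSum, eval_mul, eval_C, eval_pow, eval_X, eval_add,
      eval_prod]
    exact this
  intro k hk
  have hc := congrArg (fun P => coeff P k) hpoly
  simp only [finsetSum_coeff, coeff_C_mul, coeff_X_pow] at hc
  rw [Finset.sum_eq_single k (by intros; simp_all [eq_comm]) (by
    intro hh; exact absurd (Finset.mem_range.2 (by omega)) hh)] at hc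
  rw [Finset.prod_add, finsetSum_coeff] at hc
  have hpos : ((t+m).choose t : ℝ) ≠ 0 := by exact_mod_cast (Nat.choose_pos (by omega)).ne'
  rw [eq_div_iff hpos, mul_comm]
  simp only [if_true, mul_one] at hc
  rw [hc]
  congr 1
  rw [Finset.powersetCard_eq_filter, Finset.sum_filter]
  refine Finset.sum_congr rfl fun T hT => ?_
  rw [Finset.prod_mul_distrib, Finset.prod_const, ← map_prod, ← map_prod,
    mul_right_comm, ← C_mul, coeff_C_mul, coeff_X_pow]
  by_cases hk : T.card = k
  · simp [hk]
  · simp [hk, Ne.symm hk]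

end PolyPart

section EEPart
open Equiv

/-- Expectation of `G` under the composition of the lazy transpositions in `L`. -/
noncomputable def EE {n : ℕ} (L : List (LazyT n)) (G : Perm (Fin n) → ℝ) : ℝ :=
  ∑ σ, permDist L σ * G σ

lemma EE_nil {n : ℕ} (G : Perm (Fin n) → ℝ) : EE [] G = G 1 := by
  simp [EE, permDist]

lemma EE_cons {n : ℕ} (e : LazyT n) (L : List (LazyT n)) (G : Perm (Fin n) → ℝ) :
    EE (e :: L) G = e.2.2 * EE L (fun σ => G (σ * swap e.1 e.2.1)) + (1 - e.2.2) * EE L G := by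
  simp only [EE, permDist, add_mul, Finset.sum_add_distrib, Finset.mul_sum]
  congr 1
  · rw [← Equiv.sum_comp (Equiv.mulRight (swap e.1 e.2.1))]
    refine Finset.sum_congr rfl fun σ _ => ?_
    simp [mul_assoc]
  · refine Finset.sum_congr rfl fun σ _ => ?_
    ring

lemma EE_append {n : ℕ} (L M : List (LazyT n)) (G : Perm (Fin n) → ℝ) :
    EE (L ++ M) G = EE L (fun σ => EE M (fun τ => G (τ * σ))) := by
  induction L generalizing G with
  | nil => simp [EE_nil]
  | cons e L ih =>
    rw [List.cons_append, EE_cons, EE_cons, ih, ih]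
    simp only [mul_assoc]

/-- Transport of lazy transpositions along an embedding. -/
def mapL {m n : ℕ} (φ : Fin m ↪ Fin n) (L : List (LazyT m)) : List (LazyT n) :=
  L.map fun e => (φ e.1, φ e.2.1, e.2.2)

lemma mapL_valid {m n : ℕ} (φ : Fin m ↪ Fin n) (L : List (LazyT m)) (h : ∀ e ∈ L, e.Valid) :
    ∀ e ∈ mapL φ L, e.Valid := by
  intro e he
  obtain ⟨d, hd, rfl⟩ := List.mem_map.1 he
  obtain ⟨h1, h2⟩ := h d hd
  exact ⟨fun h => h1 (φ.injective h), h2⟩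

lemma viaEmb_swap {m n : ℕ} (φ : Fin m ↪ Fin n) (a b : Fin m) :
    Perm.viaEmbedding (swap a b) φ = swap (φ a) (φ b) := by
  ext x
  by_cases hx : x ∈ Set.range φ
  · obtain ⟨y, rfl⟩ := hx
    rw [Perm.viaEmbedding_apply, φ.injective.map_swap]
  · rw [Perm.viaEmbedding_apply_of_notMem _ _ _ hx, swap_apply_of_ne_of_ne]
    · rintro rfl; exact hx ⟨_, rfl⟩
    · rintro rfl; exact hx ⟨_, rfl⟩

lemma viaEmb_mul {m n : ℕ} (φ : Fin m ↪ Fin n) (a b : Perm (Fin m)) :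
    Perm.viaEmbedding (a * b) φ = Perm.viaEmbedding a φ * Perm.viaEmbedding b φ := 
  map_mul (Perm.viaEmbeddingHom φ) a b

lemma viaEmb_one {m n : ℕ} (φ : Fin m ↪ Fin n) :
    Perm.viaEmbedding (1 : Perm (Fin m)) φ = 1 := 
  map_one (Perm.viaEmbeddingHom φ)

lemma EE_mapL {m n : ℕ} (φ : Fin m ↪ Fin n) (L : List (LazyT m)) (G : Perm (Fin n) → ℝ) :
    EE (mapL φ L) G = EE L (fun τ => G (Perm.viaEmbedding τ φ)) := by
  induction L generalizing G with
  | nil => simp [mapL, EE_nil, viaEmb_one]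
  | cons e L ih =>
    have : mapL φ (e :: L) = (φ e.1, φ e.2.1, e.2.2) :: mapL φ L := rfl
    rw [this, EE_cons, EE_cons, ih, ih]
    simp only [viaEmb_mul, viaEmb_swap]

lemma EE_shuffle {n : ℕ} {L : List (LazyT n)} (h : IsShuffle L) (G : Perm (Fin n) → ℝ) :
    EE L G = 1 / (n.factorial : ℝ) * ∑ σ, G σ := by
  simp [EE, h.2, Finset.mul_sum]

lemma card_perm_agree {ι α : Type*} [Fintype α] [DecidableEq α] (S : Finset ι) (a c : ι → α)
    (ha : Set.InjOn a S) (hc : Set.InjOn c S) :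
    ∑ σ : Perm α, (if ∀ i ∈ S, σ (a i) = c i then (1:ℝ) else 0) =
      ((Fintype.card α - S.card).factorial : ℝ) := by
  classical
  have e0 : ∃ e : (a '' S) ≃ (c '' S), ∀ (i : ι) (hi : i ∈ S),
      (e ⟨a i, i, hi, rfl⟩ : α) = c i := by
    refine ⟨(Equiv.Set.imageOfInjOn a S ha).symm.trans (Equiv.Set.imageOfInjOn c S hc), ?_⟩
    intro i hi
    have : (⟨a i, i, hi, rfl⟩ : (a '' S)) = Equiv.Set.imageOfInjOn a S ha ⟨i, hi⟩ := rfl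
    rw [Equiv.trans_apply, this, Equiv.symm_apply_apply]
    rfl
  obtain ⟨e, he⟩ := e0
  rw [Finset.sum_boole]
  congr 1
  rw [← Fintype.card_subtype]
  have hiff : ∀ σ : Perm α, (∀ i ∈ S, σ (a i) = c i) ↔ ∀ x : (a '' S), σ x = e x := by
    intro σ
    constructor
    · rintro h ⟨_, i, hi, rfl⟩
      rw [he i hi]; exact h i hi
    · intro h i hi
      rw [← he i hi]; exact h ⟨a i, i, hi, rfl⟩
  rw [Fintype.card_congr (Equiv.subtypeEquivRight hiff)]
  rw [Fintype.card_congr (Equiv.Set.compl e)]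
  have hA : Fintype.card ((a '' S)ᶜ : Set α) = Fintype.card α - S.card := by
    rw [Fintype.card_compl_set]
    congr 1
    rw [Fintype.card_congr (Equiv.Set.imageOfInjOn a S ha).symm]
    simp
  have hC : Fintype.card ((c '' S)ᶜ : Set α) = Fintype.card α - S.card := by
    rw [Fintype.card_compl_set]
    congr 1
    rw [Fintype.card_congr (Equiv.Set.imageOfInjOn c S hc).symm]
    simp
  rw [Fintype.card_equiv (Fintype.equivOfCardEq (hA.trans hC.symm)), hA]

lemma placeProb_eq {n t : ℕ} (ht : t ≤ n) (L : List (LazyT n)) (f : Fin t → Fin n) :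
    placeProb ht L f = EE L (fun σ => if ∀ i, σ (Fin.castLE ht i) = f i then 1 else 0) := by
  simp [placeProb, EE]

lemma EE_tshuffle {n t : ℕ} (ht : t ≤ n) {L : List (LazyT n)} (h : IsTShuffle ht L)
    (H : (Fin t → Fin n) → ℝ) :
    EE L (fun σ => H (fun i => σ (Fin.castLE ht i))) =
      1 / (n.factorial : ℝ) * ∑ σ : Perm (Fin n), H (fun i => σ (Fin.castLE ht i)) := by
  classical
  have key : ∀ w : Perm (Fin n) → ℝ, ∑ σ, w σ * H (fun i => σ (Fin.castLE ht i)) =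
      ∑ f ∈ Finset.univ.filter (fun f : Fin t → Fin n => Function.Injective f),
        H f * ∑ σ, if ∀ i, σ (Fin.castLE ht i) = f i then w σ else 0 := by
    intro w
    simp only [Finset.mul_sum]
    rw [Finset.sum_comm]
    refine Finset.sum_congr rfl fun σ _ => ?_
    rw [Finset.sum_eq_single (fun i => σ (Fin.castLE ht i))]
    · simp [mul_comm]
    · intro f _ hf
      rw [if_neg, mul_zero]
      intro hh; exact hf (funext fun i => (hh i).symm)
    · intro hh
      exfalso; apply hh
      simp only [Finset.mem_filter, Finset.mem_univ, true_and]
      exact σ.injective.comp (Fin.castLE_injective ht)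
  have k1 := key (permDist L)
  have k2 := key (fun _ => 1 / (n.factorial : ℝ))
  rw [EE, k1, Finset.mul_sum, k2]
  refine Finset.sum_congr rfl fun f hf => ?_
  have hf' : Function.Injective f := by simpa using hf
  congr 1
  have := h.2 f hf'
  rw [placeProb] at this
  rw [this]
  have hc := card_perm_agree (Finset.univ : Finset (Fin t)) (Fin.castLE ht) f
    (Fin.castLE_injective ht).injOn hf'.injOn
  simp only [Finset.mem_univ, true_imp_iff, Finset.card_univ, Fintype.card_fin] at hc
  rw [div_eq_mul_one_div, mul_comm, ← hc, Finset.mul_sum]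
  refine Finset.sum_congr rfl fun σ _ => ?_
  split_ifs <;> simp

/-! Existence of shuffles. -/

lemma EE_star {n : ℕ} (c : Fin n) (S : Finset (Fin n)) (hc : c ∉ S) :
    ∃ L : List (LazyT n), (∀ e ∈ L, e.Valid) ∧
      (∀ g : Fin n → ℝ, EE L (fun σ => g (σ c)) = (g c + ∑ j ∈ S, g j) / (S.card + 1)) ∧
      (∀ g : Fin n → ℝ, ∀ x, x ≠ c → x ∉ S → EE L (fun σ => g (σ x)) = g x) := by
  induction S using Finset.induction_on with
  | empty => exact ⟨[], by simp, by simp [EE_nil], by simp [EE_nil]⟩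
  | insert a S ha ih =>
    have hca : c ≠ a := fun h => hc (by simp [h])
    have hcS : c ∉ S := fun h => hc (by simp [h])
    obtain ⟨L, hv, h1, h2⟩ := ih hcS
    have hpos : (0:ℝ) < (S.card : ℝ) + 2 := by positivity
    refine ⟨(c, a, 1 / ((S.card : ℝ) + 2)) :: L, ?_, ?_, ?_⟩
    · intro e he
      rcases List.mem_cons.1 he with rfl | he
      · refine ⟨hca, by positivity, ?_⟩
        change 1 / ((S.card : ℝ) + 2) ≤ 1
        rw [div_le_one hpos]
        have : (0:ℝ) ≤ S.card := by positivity
        linarith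
      · exact hv e he
    · intro g
      rw [EE_cons]
      simp only [Perm.mul_apply, swap_apply_left]
      rw [h1, h2 g a hca.symm ha, Finset.sum_insert ha, Finset.card_insert_of_notMem ha]
      have : (S.card : ℝ) + 1 ≠ 0 := by positivity
      push_cast
      have h3 : (S.card : ℝ) + 1 + 1 ≠ 0 := by positivity
      field_simp
      ring
    · intro g x hx hxS
      have hxa : x ≠ a := fun h => hxS (by simp [h])
      have hxS' : x ∉ S := fun h => hxS (by simp [h])
      rw [EE_cons]
      simp only [Perm.mul_apply, swap_apply_of_ne_of_ne hx hxa]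
      rw [h2 g x hx hxS']; ring

lemma sum_coset {n : ℕ} (g : Perm (Fin (n+1))) (G : Perm (Fin (n+1)) → ℝ) :
    ∑ h : Perm (Fin n), G (g * Perm.viaEmbedding h (Fin.succEmb n)) =
      ∑ σ : Perm (Fin (n+1)), if σ 0 = g 0 then G σ else 0 := by
  classical
  have h0 : ∀ h : Perm (Fin n), Perm.viaEmbedding h (Fin.succEmb n) 0 = 0 := by
    intro h
    apply Perm.viaEmbedding_apply_of_notMem
    rintro ⟨x, hx⟩
    exact Fin.succ_ne_zero x hx
  have hinj : Function.Injective
      (fun h : Perm (Fin n) => g * Perm.viaEmbedding h (Fin.succEmb n)) := by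
    intro h h' hh
    exact Perm.viaEmbeddingHom_injective (Fin.succEmb n) (mul_left_cancel hh)
  rw [← Finset.sum_filter, ← Finset.sum_image (s := Finset.univ)
    (g := fun h : Perm (Fin n) => g * Perm.viaEmbedding h (Fin.succEmb n)) hinj.injOn]
  refine Finset.sum_congr ?_ fun _ _ => rfl
  apply Finset.eq_of_subset_of_card_le
  · intro σ hσ
    obtain ⟨h, _, rfl⟩ := Finset.mem_image.1 hσ
    simp [h0]
  · rw [Finset.card_image_of_injective _ hinj]
    have := card_perm_agree (Finset.univ : Finset Unit) (fun _ => (0 : Fin (n+1)))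
      (fun _ => g 0) (by intro x; simp) (by intro x; simp)
    simp only [Finset.mem_univ, forall_const, Fintype.card_fin] at this
    rw [Finset.sum_boole] at this
    have h2 : (Finset.univ.filter fun σ : Perm (Fin (n+1)) => σ 0 = g 0).card
      = (n + 1 - 1).factorial := by simpa using this
    rw [h2, Finset.card_univ, Fintype.card_perm]; simp

lemma exists_shuffle (n : ℕ) : ∃ L : List (LazyT n), IsShuffle L := by
  classical
  induction n with
  | zero =>
    refine ⟨[], by simp, ?_⟩
    intro σ
    have : σ = 1 := Subsingleton.elim _ _
    simp [permDist, this]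
  | succ n ih =>
    obtain ⟨L0, hL0⟩ := ih
    obtain ⟨L1, hv, h1, -⟩ := EE_star (0 : Fin (n+1)) (Finset.univ.erase 0) (by simp)
    refine ⟨mapL (Fin.succEmb n) L0 ++ L1, ?_, ?_⟩
    · intro e he
      rcases List.mem_append.1 he with he | he
      · exact mapL_valid _ _ hL0.1 e he
      · exact hv e he
    · intro ρ
      have hG : permDist (mapL (Fin.succEmb n) L0 ++ L1) ρ =
          EE (mapL (Fin.succEmb n) L0 ++ L1) (fun σ => if σ = ρ then 1 else 0) := by
        simp [EE]
      rw [hG]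
      generalize hGG : (fun σ : Perm (Fin (n+1)) => if σ = ρ then (1:ℝ) else 0) = G
      have hsum : ∑ σ, G σ = 1 := by simp [← hGG]
      rw [EE_append, EE_mapL, EE_shuffle hL0]
      have hswap : ∑ h : Perm (Fin n), EE L1 (fun τ => G (τ * Perm.viaEmbedding h (Fin.succEmb n)))
          = EE L1 (fun τ => (fun j => ∑ σ : Perm (Fin (n+1)), if σ 0 = j then G σ else 0) (τ 0)) := by
        simp only [← sum_coset, EE, Finset.mul_sum]
        rw [Finset.sum_comm]
      rw [hswap, h1 (fun j => ∑ σ : Perm (Fin (n+1)), if σ 0 = j then G σ else 0)]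
      have hadd := Finset.add_sum_erase Finset.univ
        (fun j : Fin (n+1) => ∑ σ : Perm (Fin (n+1)), if σ 0 = j then G σ else 0)
        (Finset.mem_univ 0)
      beta_reduce at hadd
      rw [hadd, Finset.sum_comm]
      simp only [Finset.sum_ite_eq, Finset.mem_univ, if_true, hsum]
      rw [Finset.card_erase_of_mem (Finset.mem_univ _), Finset.card_univ, Fintype.card_fin,
        Nat.factorial_succ]
      rw [Nat.add_sub_cancel]
      push_cast
      have := Nat.factorial_ne_zero n
      field_simp

lemma shuffle_tshuffle {n t : ℕ} (ht : t ≤ n) {L : List (LazyT n)} (h : IsShuffle L) :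
    IsTShuffle ht L := by
  refine ⟨h.1, fun f hf => ?_⟩
  rw [placeProb_eq, EE_shuffle h]
  have hc := card_perm_agree (Finset.univ : Finset (Fin t)) (Fin.castLE ht) f
    (Fin.castLE_injective ht).injOn hf.injOn
  simp only [Finset.mem_univ, true_imp_iff, Finset.card_univ, Fintype.card_fin] at hc
  rw [hc]; ring

end EEPart

section MainPart
open Equiv

/-- Positions after exchanging the pairs indexed by `T`. -/
def pos {t m : ℕ} (h : t ≤ m) (T : Finset (Fin t)) (i : Fin t) : Fin (t + m) :=
  if i ∈ T then Fin.natAdd t (Fin.castLE h i) else Fin.castAdd m i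

lemma castAdd_ne_natAdd {t m : ℕ} (i : Fin t) (j : Fin m) : Fin.castAdd m i ≠ Fin.natAdd t j := by
  intro h
  have := congrArg Fin.val h
  simp at this
  have := i.2
  omega

lemma swap_pos {t m : ℕ} (h : t ≤ m) (T : Finset (Fin t)) (a : Fin t) (ha : a ∉ T) (i : Fin t) :
    swap (Fin.castAdd m a) (Fin.natAdd t (Fin.castLE h a)) (pos h T i) = pos h (insert a T) i := by
  unfold pos
  by_cases hia : i = a
  · subst hia
    simp [ha]
  · by_cases hi : i ∈ T
    · simp only [hi, if_true, Finset.mem_insert, or_true]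
      apply swap_apply_of_ne_of_ne
      · exact (castAdd_ne_natAdd _ _).symm
      · intro hh
        exact hia (Fin.castLE_injective h (Fin.natAdd_injective _ _ hh))
    · simp only [hi, if_false, Finset.mem_insert, or_false, hia]
      apply swap_apply_of_ne_of_ne
      · intro hh; exact hia (Fin.castAdd_injective _ _ hh)
      · exact castAdd_ne_natAdd _ _

lemma EE_swaps {t m : ℕ} (h : t ≤ m) (p : Fin t → ℝ) (hp : ∀ i, 0 ≤ p i ∧ p i ≤ 1)
    (S : Finset (Fin t)) :
    ∃ L : List (LazyT (t + m)), L.length = S.card ∧ (∀ e ∈ L, e.Valid) ∧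
      ∀ T0 : Finset (Fin t), Disjoint T0 S → ∀ H : (Fin t → Fin (t + m)) → ℝ,
        EE L (fun σ => H (fun i => σ (pos h T0 i))) =
          ∑ T ∈ S.powerset, ((∏ i ∈ T, p i) * ∏ i ∈ S \ T, (1 - p i)) * H (pos h (T0 ∪ T)) := by
  induction S using Finset.induction_on with
  | empty =>
    refine ⟨[], rfl, by simp, ?_⟩
    intro T0 _ H
    simp [EE_nil]
  | insert a S ha ih =>
    obtain ⟨L, hlen, hv, hL⟩ := ih
    refine ⟨(Fin.castAdd m a, Fin.natAdd t (Fin.castLE h a), p a) :: L, ?_, ?_, ?_⟩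
    · simp [hlen, Finset.card_insert_of_notMem ha]
    · intro e he
      rcases List.mem_cons.1 he with rfl | he
      · exact ⟨castAdd_ne_natAdd _ _, hp a⟩
      · exact hv e he
    · intro T0 hT0 H
      rw [Finset.disjoint_insert_right] at hT0
      rw [EE_cons]
      simp only [Perm.mul_apply, swap_pos h T0 a hT0.1]
      rw [hL T0 hT0.2 H, hL (insert a T0) (by
        rw [Finset.disjoint_insert_left]; exact ⟨ha, hT0.2⟩) H, Finset.sum_powerset_insert ha,
        add_comm, Finset.mul_sum, Finset.mul_sum]
      congr 1
      · refine Finset.sum_congr rfl fun T hT => ?_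
        have haT : a ∉ T := fun hh => ha (Finset.mem_powerset.1 hT hh)
        have : insert a S \ T = insert a (S \ T) := by
          rw [Finset.insert_sdiff_of_notMem _ haT]
        rw [this, Finset.prod_insert (by simp [ha])]
        ring
      · refine Finset.sum_congr rfl fun T hT => ?_
        have haT : a ∉ T := fun hh => ha (Finset.mem_powerset.1 hT hh)
        have e1 : insert a S \ insert a T = S \ T := by
          rw [Finset.insert_sdiff_insert]
          ext x; simp only [Finset.mem_sdiff, Finset.mem_insert]
          constructor
          · rintro ⟨hx, hx'⟩; push Not at hx'; exact ⟨hx, hx'.2⟩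
          · rintro ⟨hx, hx'⟩
            refine ⟨hx, ?_⟩
            rintro (rfl | h2)
            · exact ha hx
            · exact hx' h2
        have e2 : T0 ∪ insert a T = insert a T0 ∪ T := by
          rw [Finset.union_insert, Finset.insert_union]
        rw [e1, e2, Finset.prod_insert haT]
        ring

/-- Counters which end up in the second block. -/
def blockB {t m : ℕ} (f : Fin t → Fin (t + m)) : Finset (Fin t) :=
  Finset.univ.filter fun i => t ≤ (f i : ℕ)

lemma count_final {t m : ℕ} (h : t ≤ m) (f : Fin t → Fin (t + m)) (hf : Function.Injective f)
    (T : Finset (Fin t)) :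
    ∑ ρ : Perm (Fin m), ∑ τ : Perm (Fin t),
      (if ∀ i, (if i ∈ T then Fin.natAdd t (ρ (Fin.castLE h i)) else Fin.castAdd m (τ i)) = f i
        then (1:ℝ) else 0) =
      if T = blockB f then ((m - T.card).factorial : ℝ) * (T.card.factorial : ℝ) else 0 := by
  classical
  split_ifs with hT
  · have hv : ∀ i, ∃ v : Fin m, i ∈ T → f i = Fin.natAdd t v := by
      intro i
      by_cases hi : i ∈ T
      · have h1 : t ≤ (f i : ℕ) := by
          rw [hT] at hi
          simpa [blockB] using hi
        refine ⟨⟨f i - t, by have := (f i).2; omega⟩, fun _ => ?_⟩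
        ext; simp; omega
      · exact ⟨Fin.castLE h i, fun hh => absurd hh hi⟩
    have hu : ∀ i, ∃ u : Fin t, i ∉ T → f i = Fin.castAdd m u := by
      intro i
      by_cases hi : i ∈ T
      · exact ⟨i, fun hh => absurd hi hh⟩
      · have h1 : (f i : ℕ) < t := by
          rw [hT] at hi
          simpa [blockB] using hi
        exact ⟨⟨f i, h1⟩, fun _ => by ext; simp⟩
    choose v hv using hv
    choose u hu using hu
    have hsplit : ∀ (ρ : Perm (Fin m)) (τ : Perm (Fin t)),
        (if ∀ i, (if i ∈ T then Fin.natAdd t (ρ (Fin.castLE h i)) else Fin.castAdd m (τ i)) = f i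
          then (1:ℝ) else 0) =
        (if ∀ i ∈ T, ρ (Fin.castLE h i) = v i then (1:ℝ) else 0) *
        (if ∀ i ∈ Tᶜ, τ (id i) = u i then (1:ℝ) else 0) := by
      intro ρ τ
      rw [ite_zero_mul_ite_zero, mul_one]
      refine if_congr ?_ rfl rfl
      constructor
      · intro hh
        refine ⟨fun i hi => ?_, fun i hi => ?_⟩
        · have := hh i
          rw [if_pos hi, hv i hi] at this
          exact Fin.natAdd_injective _ _ this
        · have hi' : i ∉ T := by simpa using hi
          have := hh i
          rw [if_neg hi', hu i hi'] at this
          exact Fin.castAdd_injective _ _ this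
      · rintro ⟨h1, h2⟩ i
        split_ifs with hi
        · rw [h1 i hi, hv i hi]
        · have := h2 i (by simpa using hi)
          rw [id] at this
          rw [this, hu i hi]
    simp only [hsplit]
    rw [← Finset.sum_mul_sum]
    have c1 := card_perm_agree T (Fin.castLE h) v (Fin.castLE_injective h).injOn (by
        intro i hi j hj hij
        apply hf; rw [hv i hi, hv j hj, hij])
    have c2 := card_perm_agree Tᶜ id u (fun _ _ _ _ h => h) (by
        intro i hi j hj hij
        have hi' : i ∉ T := by simpa using hi
        have hj' : j ∉ T := by simpa using hj
        apply hf; rw [hu i hi', hu j hj', hij])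
    have hle : T.card ≤ t := by simpa using Finset.card_le_univ T
    rw [Fintype.card_fin] at c1
    rw [Finset.card_compl, Fintype.card_fin, Nat.sub_sub_self hle] at c2
    rw [← c1, ← c2]
    congr!
  · refine Finset.sum_eq_zero fun ρ _ => Finset.sum_eq_zero fun τ _ => ?_
    rw [if_neg]
    intro hh
    apply hT
    ext i
    have := hh i
    simp only [blockB, Finset.mem_filter, Finset.mem_univ, true_and]
    rw [← this]
    split_ifs with hi
    · simp [hi]
    · simp [hi]

lemma sum_perm_map {t : ℕ} (w : Finset (Fin t) → ℝ) (S : Finset (Fin t)) :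
    (t.choose S.card : ℝ) * ∑ τ : Perm (Fin t), w (S.map τ.toEmbedding) =
      (t.factorial : ℝ) * ∑ T ∈ Finset.powersetCard S.card Finset.univ, w T := by
  classical
  have h1 : ∀ S' ∈ Finset.powersetCard S.card (Finset.univ : Finset (Fin t)),
      ∑ τ : Perm (Fin t), w (S'.map τ.toEmbedding) = ∑ τ : Perm (Fin t), w (S.map τ.toEmbedding) := by
    intro S' hS'
    have hc : S.card = S'.card := (Finset.mem_powersetCard.1 hS').2.symm
    obtain ⟨π, hπ⟩ := Equiv.Perm.exists_map_finset_eq S S' hc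
    rw [← Equiv.sum_comp (Equiv.mulRight π) (fun τ : Perm (Fin t) => w (S.map τ.toEmbedding))]
    refine Finset.sum_congr rfl fun τ _ => ?_
    rw [← hπ, Finset.map_map]
    rfl
  have h2 : ∑ S' ∈ Finset.powersetCard S.card (Finset.univ : Finset (Fin t)),
      ∑ τ : Perm (Fin t), w (S'.map τ.toEmbedding) =
      (t.choose S.card : ℝ) * ∑ τ : Perm (Fin t), w (S.map τ.toEmbedding) := by
    rw [Finset.sum_congr rfl h1, Finset.sum_const, Finset.card_powersetCard, nsmul_eq_mul]
    simp
  rw [← h2, Finset.sum_comm]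
  have h3 : ∀ τ : Perm (Fin t), ∑ S' ∈ Finset.powersetCard S.card (Finset.univ : Finset (Fin t)),
      w (S'.map τ.toEmbedding) = ∑ T ∈ Finset.powersetCard S.card Finset.univ, w T := by
    intro τ
    refine Finset.sum_bij' (fun S' _ => S'.map τ.toEmbedding)
      (fun S' _ => S'.map τ.symm.toEmbedding) ?_ ?_ ?_ ?_ ?_
    · intro a ha; simpa [Finset.mem_powersetCard] using ha
    · intro a ha; simpa [Finset.mem_powersetCard] using ha
    · intro a _; rw [Finset.map_map]; ext x; simp
    · intro a _; rw [Finset.map_map]; ext x; simp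
    · intro a _; rfl
  rw [Finset.sum_congr rfl fun τ _ => h3 τ, Finset.sum_const, Finset.card_univ, Fintype.card_perm,
    Fintype.card_fin, nsmul_eq_mul]

lemma viaEmb_A {t m : ℕ} (τ : Perm (Fin t)) (i : Fin t) :
    Perm.viaEmbedding τ (Fin.castAddEmb m) (Fin.castAdd m i) = Fin.castAdd m (τ i) :=
  Perm.viaEmbedding_apply τ (Fin.castAddEmb m) i

lemma viaEmb_A' {t m : ℕ} (τ : Perm (Fin t)) (j : Fin m) :
    Perm.viaEmbedding τ (Fin.castAddEmb m) (Fin.natAdd t j) = Fin.natAdd t j := by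
  apply Perm.viaEmbedding_apply_of_notMem
  rintro ⟨i, hi⟩
  exact castAdd_ne_natAdd _ _ hi

lemma viaEmb_B {t m : ℕ} (ρ : Perm (Fin m)) (j : Fin m) :
    Perm.viaEmbedding ρ (Fin.natAddEmb t) (Fin.natAdd t j) = Fin.natAdd t (ρ j) :=
  Perm.viaEmbedding_apply ρ (Fin.natAddEmb t) j

lemma viaEmb_B' {t m : ℕ} (ρ : Perm (Fin m)) (i : Fin t) :
    Perm.viaEmbedding ρ (Fin.natAddEmb t) (Fin.castAdd m i) = Fin.castAdd m i := by
  apply Perm.viaEmbedding_apply_of_notMem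
  rintro ⟨j, hj⟩
  exact castAdd_ne_natAdd _ _ hj.symm

/-- The second half: from `pos h T`, shuffle both blocks. -/
lemma EE_second {t m : ℕ} (h : t ≤ m) {LA : List (LazyT t)} (hA : IsShuffle LA)
    {LB : List (LazyT m)} (hB : IsTShuffle h LB) (f : Fin t → Fin (t + m))
    (hf : Function.Injective f) (T : Finset (Fin t)) :
    EE (mapL (Fin.natAddEmb t) LB ++ mapL (Fin.castAddEmb m) LA)
      (fun σ => if ∀ i, σ (pos h T i) = f i then (1:ℝ) else 0) =
    if T = blockB f then
      ((m - T.card).factorial : ℝ) * (T.card.factorial : ℝ) / (m.factorial * t.factorial)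
    else 0 := by
  rw [EE_append, EE_mapL]
  have hpt : ∀ (ρ : Perm (Fin m)) (τ : Perm (Fin t)) (i : Fin t),
      (Perm.viaEmbedding τ (Fin.castAddEmb m) * Perm.viaEmbedding ρ (Fin.natAddEmb t))
        (pos h T i) =
      if i ∈ T then Fin.natAdd t (ρ (Fin.castLE h i)) else Fin.castAdd m (τ i) := by
    intro ρ τ i
    unfold pos
    split_ifs
    · rw [Perm.mul_apply, viaEmb_B, viaEmb_A']
    · rw [Perm.mul_apply, viaEmb_B', viaEmb_A]
  simp only [EE_mapL, hpt, EE_shuffle hA]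
  have := EE_tshuffle h hB (fun r => 1 / (t.factorial : ℝ) * ∑ τ : Perm (Fin t),
    if ∀ i, (if i ∈ T then Fin.natAdd t (r i) else Fin.castAdd m (τ i)) = f i
      then (1:ℝ) else 0)
  rw [this, ← Finset.mul_sum, count_final h f hf T]
  split_ifs
  · field_simp
  · simp

lemma blockB_comp {t m : ℕ} (f : Fin t → Fin (t + m)) (τ : Perm (Fin t)) :
    blockB (fun i => f (τ.symm i)) = (blockB f).map τ.toEmbedding := by
  ext i
  simp [blockB, Finset.mem_map_equiv]

lemma main_construction {t m : ℕ} (h : t ≤ m) {LA : List (LazyT t)} (hA : IsShuffle LA)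
    {LB : List (LazyT m)} (hB : IsTShuffle h LB) :
    ∃ L : List (LazyT (t + m)), L.length = 2 * LA.length + t + LB.length ∧
      IsTShuffle (Nat.le_add_right t m) L := by
  obtain ⟨p, hp, hw⟩ := exists_weights t m h
  obtain ⟨LS, hlen, hv, hS⟩ := EE_swaps h p hp Finset.univ
  refine ⟨mapL (Fin.castAddEmb m) LA ++ (LS ++
    (mapL (Fin.natAddEmb t) LB ++ mapL (Fin.castAddEmb m) LA)), ?_, ?_, ?_⟩
  · simp [mapL, hlen]; ring
  · intro e he
    simp only [List.mem_append] at he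
    rcases he with he | he | he | he
    · exact mapL_valid _ _ hA.1 e he
    · exact hv e he
    · exact mapL_valid _ _ hB.1 e he
    · exact mapL_valid _ _ hA.1 e he
  · intro f hf
    set M := mapL (Fin.natAddEmb t) LB ++ mapL (Fin.castAddEmb m) LA with hM
    set W : Finset (Fin t) → ℝ := fun T =>
      (∏ i ∈ T, p i) * ∏ i ∈ Finset.univ \ T, (1 - p i) with hW
    set k := (blockB f).card with hk
    have hkt : k ≤ t := by simpa using Finset.card_le_univ (blockB f)
    rw [placeProb_eq, EE_append, EE_mapL, EE_shuffle hA]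
    have step : ∀ τ : Perm (Fin t),
        EE (LS ++ M) (fun σ => if ∀ i, (σ * Perm.viaEmbedding τ (Fin.castAddEmb m))
          (Fin.castLE (Nat.le_add_right t m) i) = f i then (1:ℝ) else 0) =
        W ((blockB f).map τ.toEmbedding) *
          (((m - k).factorial : ℝ) * (k.factorial : ℝ) / (m.factorial * t.factorial)) := by
      intro τ
      have hind : ∀ σ : Perm (Fin (t + m)),
          (if ∀ i, (σ * Perm.viaEmbedding τ (Fin.castAddEmb m))
            (Fin.castLE (Nat.le_add_right t m) i) = f i then (1:ℝ) else 0) =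
          (if ∀ i, σ (pos h ∅ i) = f (τ.symm i) then (1:ℝ) else 0) := by
        intro σ
        refine if_congr ?_ rfl rfl
        have hc : ∀ i, (σ * Perm.viaEmbedding τ (Fin.castAddEmb m))
            (Fin.castLE (Nat.le_add_right t m) i) = σ (Fin.castAdd m (τ i)) := by
          intro i
          rw [Perm.mul_apply]
          exact congrArg σ (viaEmb_A τ i)
        simp only [hc, pos, Finset.notMem_empty, if_false]
        constructor
        · intro hh i
          have := hh (τ.symm i)
          rwa [Equiv.apply_symm_apply] at this
        · intro hh i
          have := hh (τ i)
          rwa [Equiv.symm_apply_apply] at this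
      simp only [hind]
      rw [EE_append]
      simp only [Perm.mul_apply]
      have := hS ∅ (Finset.disjoint_empty_left _) (fun s => EE M (fun ρ =>
        if ∀ i, ρ (s i) = f (τ.symm i) then (1:ℝ) else 0))
      refine Eq.trans ?_ (this.trans ?_)
      · congr!
      have hf' : Function.Injective fun i => f (τ.symm i) := hf.comp τ.symm.injective
      simp only [Finset.empty_union, hM, EE_second h hA hB (fun i => f (τ.symm i)) hf',
        blockB_comp]
      rw [Finset.sum_eq_single ((blockB f).map τ.toEmbedding)]
      · simp [hW, hk]
      · intro T _ hT; rw [if_neg hT, mul_zero]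
      · intro hh; exact absurd (Finset.mem_powerset.2 (Finset.subset_univ _)) hh
    simp only [step]
    rw [← Finset.sum_mul]
    have h1 := sum_perm_map W (blockB f)
    rw [← hk, hw k hkt] at h1
    have hc1 : (t.choose k : ℝ) ≠ 0 := by exact_mod_cast (Nat.choose_pos hkt).ne'
    have h2 : ∑ τ : Perm (Fin t), W ((blockB f).map τ.toEmbedding) =
        (t.factorial : ℝ) * (m.choose k : ℝ) / ((t+m).choose t : ℝ) := by
      apply mul_left_cancel₀ hc1
      rw [h1]; ring
    rw [h2, Nat.add_sub_cancel_left]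
    have hm : (m.choose k : ℝ) * k.factorial * (m - k).factorial = m.factorial := by
      exact_mod_cast Nat.choose_mul_factorial_mul_factorial (hkt.trans h)
    have hn : ((t+m).choose t : ℝ) * t.factorial * m.factorial = (t+m).factorial := by
      have := Nat.choose_mul_factorial_mul_factorial (Nat.le_add_right t m)
      rw [Nat.add_sub_cancel_left] at this
      exact_mod_cast this
    have z1 : ((t+m).choose t : ℝ) ≠ 0 := by exact_mod_cast (Nat.choose_pos (by omega)).ne'
    have z2 : (t.factorial : ℝ) ≠ 0 := by exact_mod_cast t.factorial_ne_zero
    have z3 : (m.factorial : ℝ) ≠ 0 := by exact_mod_cast m.factorial_ne_zero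
    rw [← hn]
    field_simp
    linear_combination hm

end MainPart

theorem divide_and_conquer (t n : ℕ) (ht : 1 ≤ t) (hn : 2 * t ≤ n) :
    Ut t n ≤ 2 * U t + t + Ut t (n - t) := by
  obtain ⟨m, rfl⟩ : ∃ m, n = t + m := ⟨n - t, by omega⟩
  have h : t ≤ m := by omega
  rw [Nat.add_sub_cancel_left]
  have hU : U t ∈ { ℓ : ℕ | ∃ L : List (LazyT t), L.length = ℓ ∧ IsShuffle L } := by
    apply Nat.sInf_mem
    obtain ⟨L, hL⟩ := exists_shuffle t
    exact ⟨_, L, rfl, hL⟩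
  have hUt : Ut t m ∈ { ℓ : ℕ | ∃ (ht : t ≤ m) (L : List (LazyT m)),
      L.length = ℓ ∧ IsTShuffle ht L } := by
    apply Nat.sInf_mem
    obtain ⟨L, hL⟩ := exists_shuffle m
    exact ⟨_, h, L, rfl, shuffle_tshuffle h hL⟩
  obtain ⟨LA, hLA, hA⟩ := hU
  obtain ⟨h', LB, hLB, hB⟩ := hUt
  obtain ⟨L, hL, hT⟩ := main_construction h hA hB
  rw [← hLA, ← hLB, ← hL]
  exact Nat.sInf_le ⟨_, L, rfl, hT⟩
end
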